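/- arXiv:1810.04205 — 4 statements merged into one kernel-verified Lean document; each statement's English description precedes it below -/
import Mathlib

section
/- Let (X, ‖·‖) be a finite dimensional normed space with dim(X) ≥ 2, let Ω be an open subset of X, and let u₀ : cl(Ω) → ℝ be a 1-Lipschitz function such that lip(u₀, ∂Ω) < 1. Then for every ε > 0 there exists a 1-Lipschitz function w : cl(Ω) → ℝ which is differentiable at every point of Ω and satisfies ‖Dw(x)‖_* = 1 for almost every x ∈ Ω (with respect to Lebesgue measure), w = u₀ on ∂Ω, and |u₀ − w| ≤ ε on cl(Ω). -/
open Metric Set MeasureTheory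

/-- `lipOn f s` is the Lipschitz constant of `f` on `s`:
the infimum of all `L > 0` such that `|f x - f y| ≤ L * dist x y` for all `x, y ∈ s`. -/
noncomputable def lipOn {X : Type*} [PseudoMetricSpace X] (f : X → ℝ) (s : Set X) : ℝ :=
  sInf {L : ℝ | 0 < L ∧ ∀ x ∈ s, ∀ y ∈ s, |f x - f y| ≤ L * dist x y}

/-- `f` is `K`-Lipschitz on `s`. -/
def IsLipschitzWithOn {X : Type*} [PseudoMetricSpace X] (K : ℝ) (f : X → ℝ) (s : Set X) : Prop :=
  ∀ x ∈ s, ∀ y ∈ s, |f x - f y| ≤ K * dist x y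

open Filter Topology

/-- One step of the play operator: `b` is moved radially towards `a` until it reaches
the closed ball of radius `δ` around `a`. -/
noncomputable def playStep {E : Type*} [NormedAddCommGroup E] [NormedSpace ℝ E]
    (δ : ℝ) (b a : E) : E :=
  a - (δ / max δ ‖a - b‖) • (a - b)

section PlayOperator

variable {E : Type*} [NormedAddCommGroup E]

lemma norm_sub_playStep_le [NormedSpace ℝ E] {δ : ℝ} (hδ : 0 < δ) (b a : E) :
    ‖a - playStep δ b a‖ ≤ δ := by
  have hm : 0 < max δ ‖a - b‖ := lt_max_of_lt_left hδ
  have h : a - playStep δ b a = (δ / max δ ‖a - b‖) • (a - b) := by simp [playStep]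
  rw [h, norm_smul, Real.norm_of_nonneg (by positivity), div_mul_eq_mul_div, div_le_iff₀ hm]
  exact mul_le_mul_of_nonneg_left (le_max_right _ _) hδ.le

lemma playStep_energy [NormedSpace ℝ E] {δ : ℝ} (hδ : 0 < δ) (b a : E) :
    δ * ‖playStep δ b a - b‖ ≤ 1 / 2 * ‖a - b‖ ^ 2 - 1 / 2 * ‖a - playStep δ b a‖ ^ 2 := by
  rcases le_total ‖a - b‖ δ with h | h
  · have : playStep δ b a = b := by simp [playStep, max_eq_left h, div_self hδ.ne']
    simp [this]
  · have hr : 0 < ‖a - b‖ := hδ.trans_le h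
    have h1 : a - playStep δ b a = (δ / ‖a - b‖) • (a - b) := by
      simp [playStep, max_eq_right h]
    have h2 : playStep δ b a - b = (1 - δ / ‖a - b‖) • (a - b) := by
      simp only [playStep, max_eq_right h, sub_smul, one_smul]; abel
    have h3 : δ / ‖a - b‖ ≤ 1 := (div_le_one hr).2 h
    rw [h1, h2, norm_smul, norm_smul, Real.norm_of_nonneg (by linarith : 0 ≤ 1 - δ / ‖a - b‖),
      Real.norm_of_nonneg (by positivity), div_mul_cancel₀ _ hr.ne', sub_mul,
      div_mul_cancel₀ _ hr.ne']
    nlinarith [sq_nonneg (‖a - b‖ - δ)]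

lemma ContinuousOn.playStep [NormedSpace ℝ E] {X : Type*} [TopologicalSpace X] {s : Set X}
    {δ : ℝ} (hδ : 0 < δ) {b a : X → E} (hb : ContinuousOn b s) (ha : ContinuousOn a s) :
    ContinuousOn (fun x => playStep δ (b x) (a x)) s := by
  unfold _root_.playStep
  refine ha.sub (ContinuousOn.smul ?_ (ha.sub hb))
  refine continuousOn_const.div (continuousOn_const.sup (ha.sub hb).norm) fun x _ => ?_
  exact (lt_max_of_lt_left hδ).ne'

variable [InnerProductSpace ℝ E]

/-- A bounded sequence whose increments are almost orthogonal to the directions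
`a n + ∑ i ≤ n, 2⁻ⁱ • b (n + 1) i`, where `b · i` follows `a` through the play operator of
radius `1 / (i + 1)`, has square-summable increments and converges. -/
theorem cauchySeq_of_play {a : ℕ → E} {b : ℕ → ℕ → E} {C : ℝ}
    (hC : ∀ n, ‖a n‖ ≤ C) (hb0 : ∀ i, b 0 i = 0)
    (hb : ∀ n i, b (n + 1) i = if i ≤ n then playStep (1 / ((i : ℝ) + 1)) (b n i) (a n) else 0)
    (hv : ∀ n, -(1 / 2 : ℝ) ^ n ≤ inner ℝ
      (a n + ∑ i ∈ Finset.range (n + 1), (1 / 2 : ℝ) ^ i • b (n + 1) i) (a (n + 1) - a n)) :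
    Summable (fun n => ‖a (n + 1) - a n‖ ^ 2) ∧ CauchySeq a := by
  have hbz : ∀ n i, n ≤ i → b n i = 0 := by
    intro n i h
    cases n with
    | zero => exact hb0 i
    | succ n => rw [hb, if_neg (by omega)]
  set δ : ℕ → ℝ := fun i => 1 / ((i : ℝ) + 1) with hδdef
  have hδ : ∀ i, 0 < δ i := fun i => by simp only [hδdef]; positivity
  set φ : ℕ → ℕ → ℝ := fun n i => 1 / 2 * ‖a n‖ ^ 2 - 1 / 2 * ‖a n - b (n + 1) i‖ ^ 2 with hφ
  set Ψ : ℕ → ℝ := fun n => 1 / 2 * ‖a n‖ ^ 2 +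
    ∑ i ∈ Finset.range (n + 1), (1 / 2 : ℝ) ^ i * φ n i with hΨ
  set W : ℕ → ℝ := fun n =>
    ∑ i ∈ Finset.range (n + 2), (1 / 2 : ℝ) ^ i * (δ i * ‖b (n + 2) i - b (n + 1) i‖) with hW
  have hW0 : ∀ n, 0 ≤ W n := fun n => Finset.sum_nonneg fun i _ => by
    have := hδ i; positivity
  have hterm : ∀ n i, i < n + 2 → δ i * ‖b (n + 2) i - b (n + 1) i‖ +
      inner ℝ (b (n + 1) i) (a (n + 1) - a n) ≤ φ (n + 1) i - φ n i := by
    intro n i hi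
    have h1 := playStep_energy (hδ i) (b (n + 1) i) (a (n + 1))
    have h2 : b (n + 2) i = playStep (δ i) (b (n + 1) i) (a (n + 1)) := by
      rw [hb (n + 1) i, if_pos (by omega)]
    rw [← h2] at h1
    have h3 := norm_sub_sq_real (a (n + 1)) (b (n + 1) i)
    have h4 := norm_sub_sq_real (a n) (b (n + 1) i)
    simp only [hφ]
    rw [inner_sub_right, real_inner_comm (a (n + 1)), real_inner_comm (a n)]
    linarith
  have hstep : ∀ n, 1 / 2 * ‖a (n + 1) - a n‖ ^ 2 + W n - (1 / 2 : ℝ) ^ n ≤ Ψ (n + 1) - Ψ n := by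
    intro n
    have h1 : ∑ i ∈ Finset.range (n + 2), (1 / 2 : ℝ) ^ i *
        (δ i * ‖b (n + 2) i - b (n + 1) i‖ + inner ℝ (b (n + 1) i) (a (n + 1) - a n)) ≤
        ∑ i ∈ Finset.range (n + 2), (1 / 2 : ℝ) ^ i * (φ (n + 1) i - φ n i) := by
      refine Finset.sum_le_sum fun i hi => ?_
      exact mul_le_mul_of_nonneg_left (hterm n i (Finset.mem_range.1 hi)) (by positivity)
    simp only [mul_add, mul_sub, Finset.sum_add_distrib, Finset.sum_sub_distrib] at h1
    have h2 : ∑ i ∈ Finset.range (n + 2), (1 / 2 : ℝ) ^ i * φ n i =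
        ∑ i ∈ Finset.range (n + 1), (1 / 2 : ℝ) ^ i * φ n i := by
      rw [Finset.sum_range_succ _ (n + 1)]
      simp [hφ, hbz (n + 1) (n + 1) le_rfl]
    have h3 : ∑ i ∈ Finset.range (n + 2), (1 / 2 : ℝ) ^ i *
        inner ℝ (b (n + 1) i) (a (n + 1) - a n) = inner ℝ
        (∑ i ∈ Finset.range (n + 1), (1 / 2 : ℝ) ^ i • b (n + 1) i) (a (n + 1) - a n) := by
      rw [Finset.sum_range_succ _ (n + 1), hbz (n + 1) (n + 1) le_rfl, sum_inner]
      simp [real_inner_smul_left]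
    have h4 := hv n
    rw [inner_add_left, ← h3] at h4
    have h5 := norm_sub_sq_real (a (n + 1)) (a n)
    have h6 : inner ℝ (a n) (a (n + 1) - a n) = inner ℝ (a (n + 1)) (a n) - ‖a n‖ ^ 2 := by
      rw [inner_sub_right, real_inner_comm, real_inner_self_eq_norm_sq]
    simp only [hΨ, hW]
    rw [h2] at h1
    linarith
  have hgeom : ∀ N, ∑ n ∈ Finset.range N, (1 / 2 : ℝ) ^ n ≤ 2 := fun N => sum_geometric_two_le N
  have hΨle : ∀ n, Ψ n ≤ 3 / 2 * C ^ 2 := by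
    intro n
    have hsq : ‖a n‖ ^ 2 ≤ C ^ 2 := by gcongr; exact hC n
    have h1 : ∑ i ∈ Finset.range (n + 1), (1 / 2 : ℝ) ^ i * φ n i ≤
        ∑ i ∈ Finset.range (n + 1), (1 / 2 : ℝ) ^ i * (1 / 2 * C ^ 2) := by
      refine Finset.sum_le_sum fun i _ => mul_le_mul_of_nonneg_left ?_ (by positivity)
      simp only [hφ]
      nlinarith [sq_nonneg ‖a n - b (n + 1) i‖]
    rw [← Finset.sum_mul] at h1
    have h2 := mul_le_mul_of_nonneg_right (hgeom (n + 1)) (by positivity : 0 ≤ 1 / 2 * C ^ 2)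
    simp only [hΨ]
    linarith
  have hsum : ∀ N, ∑ n ∈ Finset.range N, (1 / 2 * ‖a (n + 1) - a n‖ ^ 2 + W n) ≤
      3 / 2 * C ^ 2 - Ψ 0 + 2 := by
    intro N
    have h1 : ∑ n ∈ Finset.range N, (1 / 2 * ‖a (n + 1) - a n‖ ^ 2 + W n - (1 / 2 : ℝ) ^ n) ≤
        ∑ n ∈ Finset.range N, (Ψ (n + 1) - Ψ n) := Finset.sum_le_sum fun n _ => hstep n
    rw [Finset.sum_range_sub, Finset.sum_sub_distrib] at h1
    linarith [hΨle N, hgeom N]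
  have hS : Summable fun n => 1 / 2 * ‖a (n + 1) - a n‖ ^ 2 + W n :=
    summable_of_sum_range_le (fun n => add_nonneg (by positivity) (hW0 n)) hsum
  constructor
  · refine Summable.of_nonneg_of_le (fun n => by positivity) (fun n => ?_) (hS.mul_left 2)
    linarith [hW0 n]
  · have hbC : ∀ i, CauchySeq fun n => b (n + 1) i := by
      intro i
      refine cauchySeq_of_summable_dist ?_
      have hc : 0 < (1 / 2 : ℝ) ^ i * δ i := mul_pos (by positivity) (hδ i)
      refine Summable.of_nonneg_of_le (fun n => dist_nonneg) (fun n => ?_)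
        (hS.mul_left ((1 / 2 : ℝ) ^ i * δ i)⁻¹)
      rw [dist_comm, dist_eq_norm, ← div_eq_inv_mul, le_div_iff₀ hc]
      by_cases hi : i < n + 2
      · have h1 : (1 / 2 : ℝ) ^ i * (δ i * ‖b (n + 2) i - b (n + 1) i‖) ≤ W n :=
          Finset.single_le_sum (f := fun i => (1 / 2 : ℝ) ^ i *
            (δ i * ‖b (n + 2) i - b (n + 1) i‖))
            (fun j _ => by have := hδ j; positivity) (Finset.mem_range.2 hi)
        have h2 : 0 ≤ 1 / 2 * ‖a (n + 1) - a n‖ ^ 2 := by positivity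
        simp only [Nat.succ_eq_add_one, add_assoc, one_add_one_eq_two]
        linarith
      · simp only [Nat.succ_eq_add_one]
        rw [hbz (n + 1) i (by omega), hbz (n + 1 + 1) i (by omega)]
        simp only [sub_self, norm_zero, zero_mul]
        exact add_nonneg (by positivity) (hW0 n)
    rw [Metric.cauchySeq_iff]
    intro ε hε
    obtain ⟨i, hi⟩ := exists_nat_one_div_lt (show 0 < ε / 4 by positivity)
    obtain ⟨N, hN⟩ := Metric.cauchySeq_iff.1 (hbC i) (ε / 4) (by positivity)
    have hclose : ∀ n, i ≤ n → dist (a n) (b (n + 1) i) < ε / 4 := by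
      intro n hn
      rw [dist_eq_norm, hb n i, if_pos hn]
      exact (norm_sub_playStep_le (hδ i) _ _).trans_lt hi
    refine ⟨max N i, fun m hm n hn => ?_⟩
    have h1 := hclose m (le_of_max_le_right hm)
    have h2 := hclose n (le_of_max_le_right hn)
    have h3 := hN m (le_of_max_le_left hm) n (le_of_max_le_left hn)
    have h4 := dist_triangle4 (a m) (b (m + 1) i) (b (n + 1) i) (a n)
    rw [dist_comm (b (n + 1) i)] at h4
    linarith

end PlayOperator

/-- The slope of the smoothed triangle wave `θ ↦ arcsin (ρ * sin θ)`. -/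
noncomputable def waveSlope (ρ θ : ℝ) : ℝ :=
  ρ * Real.cos θ / √(1 - (ρ * Real.sin θ) ^ 2)

section Wave

variable {ρ : ℝ}

lemma abs_mul_sin_lt_one (h0 : 0 ≤ ρ) (h1 : ρ < 1) (θ : ℝ) : |ρ * Real.sin θ| < 1 := by
  rw [abs_mul, abs_of_nonneg h0]
  exact (mul_le_of_le_one_right h0 (Real.abs_sin_le_one θ)).trans_lt h1

lemma contDiff_arcsin_mul_sin (h0 : 0 ≤ ρ) (h1 : ρ < 1) {n : WithTop ℕ∞} :
    ContDiff ℝ n fun θ => Real.arcsin (ρ * Real.sin θ) := by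
  refine contDiff_iff_contDiffAt.2 fun θ => ?_
  have h := abs_lt.1 (abs_mul_sin_lt_one h0 h1 θ)
  exact ContDiffAt.comp (g := Real.arcsin) θ (Real.contDiffAt_arcsin h.1.ne' h.2.ne)
    (contDiffAt_const.mul Real.contDiff_sin.contDiffAt)

lemma hasDerivAt_arcsin_mul_sin (h0 : 0 ≤ ρ) (h1 : ρ < 1) (θ : ℝ) :
    HasDerivAt (fun θ => Real.arcsin (ρ * Real.sin θ)) (waveSlope ρ θ) θ := by
  have h := abs_lt.1 (abs_mul_sin_lt_one h0 h1 θ)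
  convert! (Real.hasDerivAt_arcsin h.1.ne' h.2.ne).comp θ ((Real.hasDerivAt_sin θ).const_mul ρ)
    using 1
  rw [waveSlope]; ring

lemma abs_waveSlope_le_one (h0 : 0 ≤ ρ) (h1 : ρ < 1) (θ : ℝ) : |waveSlope ρ θ| ≤ 1 := by
  have h := sq_lt_one_iff_abs_lt_one _ |>.2 (abs_mul_sin_lt_one h0 h1 θ)
  have hs : 0 < √(1 - (ρ * Real.sin θ) ^ 2) := Real.sqrt_pos.2 (by linarith)
  rw [waveSlope, abs_div, abs_of_pos hs, div_le_one hs]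
  refine Real.abs_le_sqrt ?_
  have h2 : ρ ^ 2 ≤ 1 := pow_le_one₀ h0 h1.le
  rw [mul_pow, mul_pow, Real.cos_sq']
  linarith

lemma continuous_waveSlope (h0 : 0 ≤ ρ) (h1 : ρ < 1) : Continuous (waveSlope ρ) := by
  unfold waveSlope
  refine Continuous.div (by fun_prop) (by fun_prop) fun θ => ?_
  have h := sq_lt_one_iff_abs_lt_one _ |>.2 (abs_mul_sin_lt_one h0 h1 θ)
  exact (Real.sqrt_pos.2 (by linarith)).ne'

lemma tendsto_abs_waveSlope {θ : ℝ} (hθ : Real.cos θ ≠ 0) :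
    Tendsto (fun ρ => |waveSlope ρ θ|) (𝓝 1) (𝓝 1) := by
  have hpos : 0 < 1 - (1 * Real.sin θ) ^ 2 := by
    have := Real.sin_sq_add_cos_sq θ
    have : 0 < Real.cos θ ^ 2 := by positivity
    nlinarith
  have hc : ContinuousAt (fun ρ => |waveSlope ρ θ|) 1 := by
    unfold waveSlope
    refine (ContinuousAt.div (f := fun ρ : ℝ => ρ * Real.cos θ)
      (g := fun ρ : ℝ => √(1 - (ρ * Real.sin θ) ^ 2)) (by fun_prop) (by fun_prop)
      (Real.sqrt_pos.2 hpos).ne').abs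
  convert! hc.tendsto using 2
  have h2 : 1 - (1 * Real.sin θ) ^ 2 = Real.cos θ ^ 2 := by
    have := Real.sin_sq_add_cos_sq θ
    linarith
  rw [waveSlope, h2, Real.sqrt_sq_eq_abs, one_mul, abs_div, abs_abs, div_self (abs_pos.2 hθ).ne']

end Wave

section Oscillation

variable {X : Type*} [NormedAddCommGroup X] [NormedSpace ℝ X] [FiniteDimensional ℝ X]
  [MeasurableSpace X] [BorelSpace X] (μ : Measure X) [μ.IsAddHaarMeasure]

lemma ae_cos_comp_ne_zero {q : X →L[ℝ] ℝ} (hq : q ≠ 0) {p : ℝ} (hp : p ≠ 0) :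
    ∀ᵐ y ∂μ, Real.cos (q y / p) ≠ 0 := by
  have hsurj : Function.Surjective (q : X →ₗ[ℝ] ℝ) :=
    LinearMap.surjective fun h => hq (ContinuousLinearMap.coe_injective h)
  have hmeas : MeasurableSet {t : ℝ | Real.cos (t / p) ≠ 0} :=
    (isOpen_ne_fun (by fun_prop) continuous_const).measurableSet
  refine (ae_comp_linearMap_mem_iff (μ := μ) (ν := volume) (q : X →ₗ[ℝ] ℝ) hsurj hmeas).2 ?_
  rw [ae_iff]
  refine Set.Countable.measure_zero ?_ volume
  refine (Set.countable_range fun k : ℤ => p * ((2 * k + 1) * Real.pi / 2)).mono fun t ht => ?_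
  simp only [ne_eq, mem_ofPred_eq, not_not] at ht
  obtain ⟨k, hk⟩ := Real.cos_eq_zero_iff.1 ht
  exact ⟨k, by simp only; rw [← hk]; field_simp⟩

lemma exists_measure_closedBall_diff_le (x : X) {r : ℝ} (hr : 0 < r) {κ : ENNReal} (hκ : 0 < κ) :
    ∃ ρ, 0 < ρ ∧ ρ < r ∧ μ (closedBall x r \ closedBall x ρ) ≤ κ := by
  have hcont : Tendsto (fun ρ : ℝ => ENNReal.ofReal (ρ ^ Module.finrank ℝ X) * μ (ball 0 1))
      (𝓝[<] r) (𝓝 (ENNReal.ofReal (r ^ Module.finrank ℝ X) * μ (ball 0 1))) := by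
    refine ENNReal.Tendsto.mul_const ?_ (Or.inr measure_ball_lt_top.ne)
    exact ENNReal.tendsto_ofReal
      ((continuous_pow _).continuousAt.tendsto.mono_left nhdsWithin_le_nhds)
  have hsub := ENNReal.Tendsto.sub (tendsto_const_nhds (x := μ (closedBall x r))) hcont
    (Or.inl measure_closedBall_lt_top.ne)
  rw [← Measure.addHaar_closedBall μ x hr.le, tsub_self] at hsub
  have hev := (hsub.eventually (gt_mem_nhds hκ)).and (Ioo_mem_nhdsLT hr)
  obtain ⟨ρ, h1, h2⟩ := hev.exists
  refine ⟨ρ, h2.1, h2.2, ?_⟩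
  rw [measure_sdiff (closedBall_subset_closedBall h2.2.le)
    measurableSet_closedBall.nullMeasurableSet measure_closedBall_lt_top.ne,
    Measure.addHaar_closedBall μ x h2.1.le]
  exact h1.le

/-- A small `C¹` oscillation in the direction `q`, supported in a ball, whose derivative is close
to a multiple of `q`, and close to `± τ • q` on most of the ball. -/
lemma exists_oscillation {q : X →L[ℝ] ℝ} (hq : q ≠ 0) (x : X) {r τ σ : ℝ} (hr : 0 < r)
    (hτ : 0 < τ) (hσ : 0 < σ) {κ : ENNReal} (hκ : 0 < κ) :
    ∃ P : X → ℝ, ContDiff ℝ 1 P ∧ (∀ y ∉ closedBall x r, P y = 0 ∧ fderiv ℝ P y = 0) ∧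
      (∀ y, |P y| ≤ σ) ∧ (∀ y, ∃ c : ℝ, |c| ≤ τ ∧ ‖fderiv ℝ P y - c • q‖ ≤ σ) ∧
      μ {y ∈ closedBall x r | ¬ ∃ c : ℝ, 3 / 4 * τ ≤ |c| ∧ ‖fderiv ℝ P y - c • q‖ ≤ σ} ≤ κ := by
  have hκ2 : 0 < κ / 2 := ENNReal.half_pos hκ.ne'
  obtain ⟨rin, hrin0, hrin, hμ⟩ := exists_measure_closedBall_diff_le μ x hr hκ2
  let χ : ContDiffBump x := ⟨rin, r, hrin0, hrin⟩
  have hχ : ContDiff ℝ 1 χ := χ.contDiff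
  obtain ⟨M, hM⟩ : ∃ M, ∀ y, ‖fderiv ℝ χ y‖ ≤ M :=
    (χ.hasCompactSupport.fderiv ℝ).exists_bound_of_continuous (hχ.continuous_fderiv one_ne_zero)
  have hM0 : 0 ≤ M := (norm_nonneg _).trans (hM x)
  set p : ℝ := σ / (2 * τ * (M + 1)) with hp
  have hp0 : 0 < p := by positivity
  have hpσ : 2 * τ * p * (M + 1) = σ := by rw [hp]; field_simp
  set ρ : ℕ → ℝ := fun k => 1 - 1 / ((k : ℝ) + 1) with hρ
  have hρ0 : ∀ k, 0 ≤ ρ k := fun k => by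
    have : 1 / ((k : ℝ) + 1) ≤ 1 := by rw [div_le_one (by positivity)]; simp
    simp only [hρ]; linarith
  have hρ1 : ∀ k, ρ k < 1 := fun k => by
    have : 0 < 1 / ((k : ℝ) + 1) := by positivity
    simp only [hρ]; linarith
  have hρlim : Tendsto ρ atTop (𝓝 1) := by
    simpa [hρ] using (tendsto_const_nhds (x := (1 : ℝ))).sub tendsto_one_div_add_atTop_nhds_zero_nat
  have : IsFiniteMeasure (μ.restrict (closedBall x r)) :=
    ⟨by simpa using measure_closedBall_lt_top⟩
  have hTIM : TendstoInMeasure (μ.restrict (closedBall x r))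
      (fun k y => |waveSlope (ρ k) (q y / p)|) atTop (fun _ => 1) := by
    refine tendstoInMeasure_of_tendsto_ae (fun k => ?_) ?_
    · have := continuous_waveSlope (hρ0 k) (hρ1 k)
      exact Continuous.aestronglyMeasurable (by fun_prop)
    · refine ae_restrict_of_ae ?_
      filter_upwards [ae_cos_comp_ne_zero μ hq hp0.ne'] with y hy
      exact (tendsto_abs_waveSlope hy).comp hρlim
  obtain ⟨k, hk⟩ := ((hTIM (ENNReal.ofReal (1 / 4)) (by simp)).eventually
    (gt_mem_nhds hκ2)).exists
  set H : ℝ → ℝ := fun t => τ * p * Real.arcsin (ρ k * Real.sin (t / p)) with hH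
  have hHd : ∀ t, HasDerivAt H (τ * waveSlope (ρ k) (t / p)) t := by
    intro t
    have h1 : HasDerivAt (fun t : ℝ => t / p) (1 / p) t := (hasDerivAt_id t).div_const p
    convert! ((hasDerivAt_arcsin_mul_sin (hρ0 k) (hρ1 k) (t / p)).comp t h1).const_mul (τ * p)
      using 1
    field_simp
  have hHC : ContDiff ℝ 1 H :=
    contDiff_const.mul ((contDiff_arcsin_mul_sin (hρ0 k) (hρ1 k)).comp (contDiff_id.div_const p))
  have hHb : ∀ t, |H t| ≤ 2 * τ * p := by
    intro t
    have h1 : |Real.arcsin (ρ k * Real.sin (t / p))| ≤ 2 := by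
      refine (abs_le.2 ⟨?_, Real.arcsin_le_pi_div_two _⟩ : _ ≤ Real.pi / 2).trans
        (by linarith [Real.pi_le_four])
      exact Real.neg_pi_div_two_le_arcsin _
    simp only [hH]
    rw [abs_mul, abs_of_pos (by positivity : 0 < τ * p)]
    nlinarith [mul_pos hτ hp0]
  set P : X → ℝ := fun y => χ y * H (q y) with hP
  have hPC : ContDiff ℝ 1 P := hχ.mul (hHC.comp q.contDiff)
  have hPd : ∀ y, fderiv ℝ P y =
      χ y • ((τ * waveSlope (ρ k) (q y / p)) • q) + H (q y) • fderiv ℝ χ y := by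
    intro y
    exact (((hχ.differentiable one_ne_zero) y).hasFDerivAt.mul
      ((hHd (q y)).comp_hasFDerivAt y q.hasFDerivAt)).fderiv
  have herr : ∀ y, ‖fderiv ℝ P y - (χ y * (τ * waveSlope (ρ k) (q y / p))) • q‖ ≤ σ := by
    intro y
    rw [hPd, smul_smul, add_sub_cancel_left, norm_smul, Real.norm_eq_abs]
    have := mul_le_mul (hHb (q y)) (hM y) (norm_nonneg _) (by positivity)
    nlinarith [mul_pos hτ hp0]
  refine ⟨P, hPC, fun y hy => ?_, fun y => ?_, fun y => ⟨_, ?_, herr y⟩, ?_⟩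
  · have hts : tsupport P ⊆ closedBall x r := by
      refine (tsupport_mul_subset_left (f := fun y => χ y) (g := fun y => H (q y))).trans ?_
      rw [χ.tsupport_eq]
    exact ⟨image_eq_zero_of_notMem_tsupport fun h => hy (hts h),
      image_eq_zero_of_notMem_tsupport fun h => hy (hts (tsupport_fderiv_subset ℝ h))⟩
  · simp only [hP]
    rw [abs_mul, abs_of_nonneg χ.nonneg]
    have h1 : χ y * |H (q y)| ≤ 1 * (2 * τ * p) :=
      mul_le_mul χ.le_one (hHb _) (abs_nonneg _) zero_le_one
    nlinarith [mul_pos hτ hp0]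
  · rw [abs_mul, abs_mul, abs_of_nonneg χ.nonneg, abs_of_pos hτ]
    have h1 := abs_waveSlope_le_one (hρ0 k) (hρ1 k) (q y / p)
    have h2 : τ * |waveSlope (ρ k) (q y / p)| ≤ τ := mul_le_of_le_one_right hτ.le h1
    exact (mul_le_of_le_one_left (by positivity) χ.le_one).trans h2
  · have hsub : {y ∈ closedBall x r |
        ¬ ∃ c : ℝ, 3 / 4 * τ ≤ |c| ∧ ‖fderiv ℝ P y - c • q‖ ≤ σ} ⊆
        (closedBall x r \ closedBall x rin) ∪ ({y | ENNReal.ofReal (1 / 4) ≤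
          edist |waveSlope (ρ k) (q y / p)| 1} ∩ closedBall x r) := by
      rintro y ⟨hy, hbad⟩
      by_cases hyin : y ∈ closedBall x rin
      · right
        refine ⟨?_, hy⟩
        by_contra hcon
        refine hbad ⟨_, ?_, herr y⟩
        rw [mem_ofPred_eq, edist_dist, not_le, ENNReal.ofReal_lt_ofReal_iff (by norm_num),
          Real.dist_eq] at hcon
        have h1 := (abs_lt.1 hcon).1
        rw [χ.one_of_mem_closedBall hyin, one_mul, abs_mul, abs_of_pos hτ]
        nlinarith
      · exact Or.inl ⟨hy, hyin⟩
    calc _ ≤ _ := measure_mono hsub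
      _ ≤ _ := measure_union_le _ _
      _ ≤ κ / 2 + κ / 2 := by
        refine add_le_add hμ ?_
        rw [← Measure.restrict_apply₀']
        · exact hk.le
        · exact measurableSet_closedBall.nullMeasurableSet
      _ = κ := ENNReal.add_halves κ

end Oscillation

lemma exists_unit_orthogonal {E : Type*} [NormedAddCommGroup E] [InnerProductSpace ℝ E]
    [FiniteDimensional ℝ E] (hE : 2 ≤ Module.finrank ℝ E) (v : E) :
    ∃ e : E, ‖e‖ = 1 ∧ inner ℝ v e = 0 := by
  have hne : (Submodule.span ℝ {v})ᗮ ≠ ⊥ := by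
    rw [Ne, Submodule.orthogonal_eq_bot_iff]
    intro h
    have h1 : Module.finrank ℝ (Submodule.span ℝ {v}) ≤ 1 := by
      simpa using finrank_span_le_card (R := ℝ) ({v} : Set E)
    rw [h, finrank_top] at h1
    omega
  obtain ⟨w, hw, hw0⟩ := Submodule.exists_mem_ne_zero_of_ne_bot hne
  refine ⟨(‖w‖⁻¹ : ℝ) • w, norm_smul_inv_norm (𝕜 := ℝ) hw0, ?_⟩
  rw [real_inner_smul_right, Submodule.mem_orthogonal_singleton_iff_inner_right.1 hw, mul_zero]

lemma exists_finset_measure_diff_le {X ι : Type*} [MeasurableSpace X] (μ : Measure X)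
    {K : Set X} (hK : MeasurableSet K) (hKμ : μ K ≠ ⊤) {t : Set ι} (ht : t.Countable)
    {B : ι → Set X} (hB : ∀ i, MeasurableSet (B i)) (h0 : μ (K \ ⋃ i ∈ t, B i) = 0)
    {κ : ENNReal} (hκ : 0 < κ) :
    ∃ F : Finset ι, ↑F ⊆ t ∧ μ (K \ ⋃ i ∈ F, B i) ≤ κ := by
  classical
  have : Countable t := ht.to_subtype
  have hlim := tendsto_measure_iInter_atTop (μ := μ)
    (s := fun F : Finset t => K \ ⋃ i ∈ F, B i)
    (fun F => (hK.diff (F.measurableSet_biUnion fun i _ => hB i)).nullMeasurableSet)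
    (fun F G hFG => sdiff_subset_sdiff_right (biUnion_subset_biUnion_left hFG))
    ⟨∅, ne_top_of_le_ne_top hKμ (measure_mono sdiff_subset)⟩
  have hInter : (⋂ F : Finset t, K \ ⋃ i ∈ F, B i) = K \ ⋃ i ∈ t, B i := by
    ext x
    simp only [mem_iInter, Set.mem_sdiff, mem_iUnion, not_exists]
    constructor
    · intro h
      exact ⟨(h ∅).1, fun i hi hx => (h {⟨i, hi⟩}).2 ⟨i, hi⟩ (by simp) hx⟩
    · exact fun h F => ⟨h.1, fun i _ hx => h.2 i i.2 hx⟩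
  rw [hInter, h0] at hlim
  obtain ⟨F, hF⟩ := (hlim.eventually (gt_mem_nhds hκ)).exists
  refine ⟨F.image Subtype.val, by simp, ?_⟩
  rw [Finset.set_biUnion_finset_image]
  exact hF.le

section Perturbation

variable {X : Type*} [NormedAddCommGroup X] [NormedSpace ℝ X]
  {E : Type*} [NormedAddCommGroup E] [InnerProductSpace ℝ E]

/-- A derivative increment `D` at a point where the current derivative is `a`: it keeps the
derivative in the open unit ball, is small, and is almost orthogonal to `v`. -/
def IsAdmissibleIncrement (Φ : (X →L[ℝ] ℝ) ≃L[ℝ] E) (τ κ : ℝ) (a : X →L[ℝ] ℝ) (v : E)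
    (D : X →L[ℝ] ℝ) : Prop :=
  ‖a + D‖ < 1 ∧ ‖Φ D‖ ≤ 2 * τ ∧ |inner ℝ v (Φ D)| ≤ κ

lemma isAdmissibleIncrement_zero (Φ : (X →L[ℝ] ℝ) ≃L[ℝ] E) {τ κ : ℝ} (hτ : 0 ≤ τ) (hκ : 0 ≤ κ)
    {a : X →L[ℝ] ℝ} (ha : ‖a‖ < 1) (v : E) : IsAdmissibleIncrement Φ τ κ a v 0 := by
  refine ⟨by simpa using ha, by simpa using hτ, by simpa using hκ⟩

variable [FiniteDimensional ℝ X] [MeasurableSpace X] [BorelSpace X] (μ : Measure X)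
  [μ.IsAddHaarMeasure] [FiniteDimensional ℝ E]

lemma exists_perturbation_closedBall (hE : 2 ≤ Module.finrank ℝ E)
    (Φ : (X →L[ℝ] ℝ) ≃L[ℝ] E) {C : ℝ} (hC : 0 < C) (hC1 : ∀ q, ‖q‖ ≤ C * ‖Φ q‖)
    (hC2 : ∀ q, ‖Φ q‖ ≤ C * ‖q‖) {a : X → X →L[ℝ] ℝ} {V : X → E} {x : X} {r τ σ κ : ℝ}
    (hr : 0 < r) (hτ : 0 < τ) (hσ : 0 < σ) (hκ : 0 < κ)
    (ha1 : ∀ y ∈ closedBall x r, ‖a y‖ < 1)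
    (ha : ∀ y ∈ closedBall x r, ‖a y - a x‖ ≤ C * τ / 2)
    (hV : ∀ y ∈ closedBall x r, ‖V y - V x‖ ≤ κ / (2 * τ)) {κ' : ENNReal} (hκ' : 0 < κ') :
    ∃ P : X → ℝ, ContDiff ℝ 1 P ∧ (∀ y ∉ closedBall x r, P y = 0 ∧ fderiv ℝ P y = 0) ∧
      (∀ y, |P y| ≤ σ) ∧
      (∀ y ∈ closedBall x r, IsAdmissibleIncrement Φ τ κ (a y) (V y) (fderiv ℝ P y)) ∧
      μ {y ∈ closedBall x r |
        ¬ (τ / 2 ≤ ‖Φ (fderiv ℝ P y)‖ ∨ 1 - 4 * C * τ ≤ ‖a y‖)} ≤ κ' := by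
  have hCτ : 0 < C * τ := mul_pos hC hτ
  by_cases hact : 1 - 3 * C * τ ≤ ‖a x‖
  · refine ⟨fun _ => 0, contDiff_const, by simp, by simp [hσ.le], fun y hy => ?_, ?_⟩
    · simpa using isAdmissibleIncrement_zero Φ hτ.le hκ.le (ha1 y hy) (V y)
    · refine (measure_mono (fun y hy => ?_ : _ ⊆ (∅ : Set X))).trans (by simp)
      refine (hy.2 (Or.inr ?_)).elim
      have h1 := ha y hy.1
      have h2 := norm_sub_norm_le (a x) (a y)
      rw [norm_sub_rev] at h2
      linarith
  · push Not at hact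
    obtain ⟨e, he, hve⟩ := exists_unit_orthogonal hE (V x)
    set q := Φ.symm e with hq
    have hΦq : Φ q = e := Φ.apply_symm_apply e
    have hq0 : q ≠ 0 := by
      rintro h
      rw [h, map_zero] at hΦq
      rw [← hΦq, norm_zero] at he
      exact zero_ne_one he
    have hqC : ‖q‖ ≤ C := by simpa [hΦq, he] using hC1 q
    set M : ℝ := ‖V x‖ + κ / (2 * τ) with hM
    have hM0 : 0 < M := by positivity
    set s : ℝ := min (min σ (τ / (4 * C))) (min (C * τ) (κ / (2 * (M * C)))) with hs
    have hs0 : 0 < s := by simp only [hs, lt_min_iff]; refine ⟨⟨hσ, ?_⟩, hCτ, ?_⟩ <;> positivity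
    have hs1 : s ≤ σ := (min_le_left _ _).trans (min_le_left _ _)
    have hs2 : C * s ≤ τ / 4 := by
      have : s ≤ τ / (4 * C) := (min_le_left _ _).trans (min_le_right _ _)
      rw [le_div_iff₀ (by positivity)] at this
      linarith
    have hs3 : s ≤ C * τ := (min_le_right _ _).trans (min_le_left _ _)
    have hs4 : M * (C * s) ≤ κ / 2 := by
      have : s ≤ κ / (2 * (M * C)) := (min_le_right _ _).trans (min_le_right _ _)
      rw [le_div_iff₀ (by positivity)] at this
      linarith
    obtain ⟨P, hP1, hP2, hP3, hP4, hP5⟩ := exists_oscillation μ hq0 x hr hτ hs0 hκ'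
    have hΦerr : ∀ (y : X) (c : ℝ), ‖fderiv ℝ P y - c • q‖ ≤ s → ‖Φ (fderiv ℝ P y) - c • e‖ ≤ C * s := by
      intro y c h
      rw [← hΦq, ← map_smul, ← map_sub]
      exact (hC2 _).trans (mul_le_mul_of_nonneg_left h hC.le)
    refine ⟨P, hP1, hP2, fun y => (hP3 y).trans hs1, fun y hy => ?_, (measure_mono ?_).trans hP5⟩
    · obtain ⟨c, hc, hPc⟩ := hP4 y
      have hΦc := hΦerr y c hPc
      refine ⟨?_, ?_, ?_⟩
      · have h1 : a y + fderiv ℝ P y = a x + (a y - a x) + (c • q + (fderiv ℝ P y - c • q)) := by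
          abel
        have h2 : ‖c • q‖ ≤ C * τ := by
          rw [norm_smul, Real.norm_eq_abs, mul_comm C]
          exact mul_le_mul hc hqC (norm_nonneg _) hτ.le
        rw [h1]
        have h3 := norm_add_le (a x + (a y - a x)) (c • q + (fderiv ℝ P y - c • q))
        have h4 := norm_add_le (a x) (a y - a x)
        have h5 := norm_add_le (c • q) (fderiv ℝ P y - c • q)
        have h6 := ha y hy
        linarith
      · have h1 := norm_sub_norm_le (Φ (fderiv ℝ P y)) (c • e)
        rw [norm_smul, he, mul_one, Real.norm_eq_abs] at h1
        linarith
      · have h1 : inner ℝ (V y) (Φ (fderiv ℝ P y)) =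
            inner ℝ (V y - V x) (c • e) + inner ℝ (V y) (Φ (fderiv ℝ P y) - c • e) := by
          rw [inner_sub_left, inner_sub_right, real_inner_smul_right _ _ c,
            real_inner_smul_right _ _ c, hve]
          ring
        have h2 : |inner ℝ (V y - V x) (c • e)| ≤ κ / (2 * τ) * τ := by
          refine (abs_real_inner_le_norm _ _).trans ?_
          rw [norm_smul, he, mul_one, Real.norm_eq_abs]
          exact mul_le_mul (hV y hy) hc (abs_nonneg _) (by positivity)
        have h3 : |inner ℝ (V y) (Φ (fderiv ℝ P y) - c • e)| ≤ M * (C * s) := by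
          refine (abs_real_inner_le_norm _ _).trans ?_
          refine mul_le_mul ?_ hΦc (norm_nonneg _) hM0.le
          have h4 := norm_add_le (V x) (V y - V x)
          rw [add_sub_cancel] at h4
          linarith [hV y hy]
        have h5 : κ / (2 * τ) * τ = κ / 2 := by field_simp
        rw [h1]
        have h6 := abs_add_le (inner ℝ (V y - V x) (c • e))
          (inner ℝ (V y) (Φ (fderiv ℝ P y) - c • e))
        linarith
    · rintro y ⟨hy, hbad⟩
      refine ⟨hy, ?_⟩
      rintro ⟨c, hc, hPc⟩
      refine hbad (Or.inl ?_)
      have hΦc := hΦerr y c hPc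
      have h1 := norm_sub_norm_le (c • e) (Φ (fderiv ℝ P y))
      rw [norm_smul, he, mul_one, Real.norm_eq_abs, norm_sub_rev] at h1
      linarith

/-- A small compactly supported perturbation with admissible derivative increments, which moves
the derivative by a definite amount at most points of `K` where it is not almost of norm one. -/
lemma exists_perturbation (hE : 2 ≤ Module.finrank ℝ E)
    (Φ : (X →L[ℝ] ℝ) ≃L[ℝ] E) {C : ℝ} (hC : 0 < C) (hC1 : ∀ q, ‖q‖ ≤ C * ‖Φ q‖)
    (hC2 : ∀ q, ‖Φ q‖ ≤ C * ‖q‖) {Ω K : Set X} (hΩ : IsOpen Ω) (hK : IsCompact K) (hKΩ : K ⊆ Ω)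
    {a : X → X →L[ℝ] ℝ} {V : X → E} (ha : ContinuousOn a Ω) (hV : ContinuousOn V Ω)
    (ha1 : ∀ y ∈ Ω, ‖a y‖ < 1) {τ σ κ : ℝ} (hτ : 0 < τ) (hσ : 0 < σ) (hκ : 0 < κ) :
    ∃ P : X → ℝ, ContDiff ℝ 1 P ∧ (∀ y ∉ Ω, P y = 0) ∧ (∀ y, |P y| ≤ σ) ∧
      (∀ y, ‖Φ (fderiv ℝ P y)‖ ≤ 2 * τ) ∧
      (∀ y ∈ Ω, IsAdmissibleIncrement Φ τ κ (a y) (V y) (fderiv ℝ P y)) ∧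
      μ {y ∈ K | ¬ (τ / 2 ≤ ‖Φ (fderiv ℝ P y)‖ ∨ 1 - 4 * C * τ ≤ ‖a y‖)} ≤ ENNReal.ofReal κ := by
  have hrad : ∀ x ∈ K, ∃ R > 0, ∀ y, dist y x < R → y ∈ Ω ∧ ‖a y - a x‖ ≤ C * τ / 2 ∧
      ‖V y - V x‖ ≤ κ / (2 * τ) := by
    intro x hx
    have hxΩ := hΩ.mem_nhds (hKΩ hx)
    have h1 := (ha.continuousAt hxΩ).eventually (ball_mem_nhds (a x) (by positivity :
      0 < C * τ / 2))
    have h2 := (hV.continuousAt hxΩ).eventually (ball_mem_nhds (V x) (by positivity :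
      0 < κ / (2 * τ)))
    obtain ⟨R, hR, h⟩ := Metric.eventually_nhds_iff.1 ((eventually_mem_set.2 hxΩ).and (h1.and h2))
    refine ⟨R, hR, fun y hy => ⟨(h hy).1, ?_, ?_⟩⟩
    · rw [← dist_eq_norm]; exact (h hy).2.1.le
    · rw [← dist_eq_norm]; exact (h hy).2.2.le
  choose! R hR0 hR using hrad
  obtain ⟨t, r, htc, htK, htr, ht0, htd⟩ := Besicovitch.exists_disjoint_closedBall_covering_ae μ
    (fun _ => univ) K (fun x _ δ hδ => ⟨δ / 2, trivial, half_pos hδ, half_lt_self hδ⟩) R hR0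
  have hκ0 : 0 < ENNReal.ofReal κ / 2 := ENNReal.half_pos (by simpa using hκ)
  obtain ⟨F, hFt, hF⟩ := exists_finset_measure_diff_le μ hK.measurableSet hK.measure_ne_top htc
    (fun x => measurableSet_closedBall (x := x) (ε := r x)) ht0 hκ0
  have hcard : (0 : ENNReal) < ENNReal.ofReal κ / 2 / (F.card + 1) :=
    ENNReal.div_pos hκ0.ne' (by simp)
  have hFr : ∀ x ∈ F, 0 < r x ∧ ∀ y ∈ closedBall x (r x), y ∈ Ω ∧ ‖a y - a x‖ ≤ C * τ / 2 ∧
      ‖V y - V x‖ ≤ κ / (2 * τ) := fun x hx =>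
    ⟨(htr x (hFt hx)).2.1, fun y hy => hR x (htK (hFt hx)) y
      ((mem_closedBall.1 hy).trans_lt (htr x (hFt hx)).2.2)⟩
  have hball : ∀ x ∈ F, ∃ P : X → ℝ, ContDiff ℝ 1 P ∧
      (∀ y ∉ closedBall x (r x), P y = 0 ∧ fderiv ℝ P y = 0) ∧ (∀ y, |P y| ≤ σ) ∧
      (∀ y ∈ closedBall x (r x), IsAdmissibleIncrement Φ τ κ (a y) (V y) (fderiv ℝ P y)) ∧
      μ {y ∈ closedBall x (r x) | ¬ (τ / 2 ≤ ‖Φ (fderiv ℝ P y)‖ ∨ 1 - 4 * C * τ ≤ ‖a y‖)} ≤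
        ENNReal.ofReal κ / 2 / (F.card + 1) := fun x hx =>
    exists_perturbation_closedBall μ hE Φ hC hC1 hC2 (hFr x hx).1 hτ hσ hκ
      (fun y hy => ha1 y ((hFr x hx).2 y hy).1) (fun y hy => ((hFr x hx).2 y hy).2.1)
      (fun y hy => ((hFr x hx).2 y hy).2.2) hcard
  choose! P hPC hP0 hPσ hPadm hPμ using hball
  set Q : X → ℝ := fun y => ∑ x ∈ F, P x y with hQ
  have hQd : ∀ y, fderiv ℝ Q y = ∑ x ∈ F, fderiv ℝ (P x) y := fun y =>
    fderiv_fun_sum fun x hx => (hPC x hx).differentiable one_ne_zero y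
  have hout : ∀ y, (∀ x ∈ F, y ∉ closedBall x (r x)) → Q y = 0 ∧ fderiv ℝ Q y = 0 := by
    intro y hy
    rw [hQd]
    exact ⟨Finset.sum_eq_zero fun x hx => (hP0 x hx y (hy x hx)).1,
      Finset.sum_eq_zero fun x hx => (hP0 x hx y (hy x hx)).2⟩
  have hin : ∀ x ∈ F, ∀ y ∈ closedBall x (r x), Q y = P x y ∧ fderiv ℝ Q y = fderiv ℝ (P x) y := by
    intro x hx y hy
    have hne : ∀ z ∈ F, z ≠ x → y ∉ closedBall z (r z) := fun z hz hzx hyz =>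
      Set.disjoint_left.1 (htd (hFt hz) (hFt hx) hzx) hyz hy
    rw [hQd]
    exact ⟨Finset.sum_eq_single_of_mem x hx fun z hz hzx => (hP0 z hz y (hne z hz hzx)).1,
      Finset.sum_eq_single_of_mem x hx fun z hz hzx => (hP0 z hz y (hne z hz hzx)).2⟩
  have hcases : ∀ y, (∃ x ∈ F, y ∈ closedBall x (r x)) ∨ ∀ x ∈ F, y ∉ closedBall x (r x) := by
    intro y
    by_cases h : ∃ x ∈ F, y ∈ closedBall x (r x)
    · exact Or.inl h
    · exact Or.inr fun x hx hy => h ⟨x, hx, hy⟩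
  refine ⟨Q, ContDiff.sum fun x hx => hPC x hx, fun y hy => ?_, fun y => ?_, fun y => ?_,
    fun y hy => ?_, ?_⟩
  · exact (hout y fun x hx hyx => hy ((hFr x hx).2 y hyx).1).1
  · rcases hcases y with ⟨x, hx, hyx⟩ | h
    · rw [(hin x hx y hyx).1]; exact hPσ x hx y
    · rw [(hout y h).1, abs_zero]; exact hσ.le
  · rcases hcases y with ⟨x, hx, hyx⟩ | h
    · rw [(hin x hx y hyx).2]; exact (hPadm x hx y hyx).2.1
    · rw [(hout y h).2, map_zero, norm_zero]; positivity
  · rcases hcases y with ⟨x, hx, hyx⟩ | h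
    · rw [(hin x hx y hyx).2]; exact hPadm x hx y hyx
    · rw [(hout y h).2]; exact isAdmissibleIncrement_zero Φ hτ.le hκ.le (ha1 y hy) _
  · have hsub : {y ∈ K | ¬ (τ / 2 ≤ ‖Φ (fderiv ℝ Q y)‖ ∨ 1 - 4 * C * τ ≤ ‖a y‖)} ⊆
        (K \ ⋃ x ∈ F, closedBall x (r x)) ∪ ⋃ x ∈ F, {y ∈ closedBall x (r x) |
          ¬ (τ / 2 ≤ ‖Φ (fderiv ℝ (P x) y)‖ ∨ 1 - 4 * C * τ ≤ ‖a y‖)} := by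
      rintro y ⟨hy, hbad⟩
      rcases hcases y with ⟨x, hx, hyx⟩ | h
      · rw [(hin x hx y hyx).2] at hbad
        exact Or.inr (mem_iUnion₂.2 ⟨x, hx, hyx, hbad⟩)
      · exact Or.inl ⟨hy, by simpa using h⟩
    calc _ ≤ _ := measure_mono hsub
      _ ≤ _ := measure_union_le _ _
      _ ≤ ENNReal.ofReal κ / 2 + ENNReal.ofReal κ / 2 := by
        refine add_le_add hF ((measure_biUnion_finset_le _ _).trans ?_)
        refine (Finset.sum_le_sum hPμ).trans ?_
        rw [Finset.sum_const, nsmul_eq_mul]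
        refine (mul_le_mul_left (le_self_add (b := (1 : ENNReal))) _).trans ?_
        exact ENNReal.mul_div_le
      _ = ENNReal.ofReal κ := ENNReal.add_halves _

end Perturbation

/-- A `C¹` function which is positive exactly on an open set and which is small in `C¹`, with
a bound depending on the distance to the origin. -/
lemma exists_contDiff_pos_iff_mem {X : Type*} [NormedAddCommGroup X] [NormedSpace ℝ X]
    [FiniteDimensional ℝ X] {Ω : Set X} (hΩ : IsOpen Ω) {m : ℝ → ℝ}
    (hm : AntitoneOn m (Ici 0)) (hm0 : ∀ t ∈ Ici (0 : ℝ), 0 < m t) :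
    ∃ r : X → ℝ, ContDiff ℝ 1 r ∧ (∀ x, 0 ≤ r x) ∧ (∀ x, 0 < r x ↔ x ∈ Ω) ∧
      (∀ x, r x ≤ m ‖x‖) ∧ ∀ x, ‖fderiv ℝ r x‖ ≤ m ‖x‖ := by
  have hf : ∀ n : ℕ, ∃ f : X → ℝ, f.support = Ω ∩ ball 0 n ∧ ContDiff ℝ 1 f ∧
      Set.range f ⊆ Set.Icc 0 1 := fun n => (hΩ.inter isOpen_ball).exists_contDiff_support_eq
  choose f hfs hfC hf01 using hf
  have htsup : ∀ n : ℕ, tsupport (f n) ⊆ closedBall 0 n := fun n =>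
    closure_minimal (by rw [hfs]; exact inter_subset_right.trans ball_subset_closedBall)
      isClosed_closedBall
  have hB : ∀ n, ∃ B : ℝ, ∀ x, ‖fderiv ℝ (f n) x‖ ≤ B := fun n =>
    ((HasCompactSupport.of_support_subset_isCompact (isCompact_closedBall (0 : X) n)
      (subset_closure.trans (htsup n))).fderiv (𝕜 := ℝ)).exists_bound_of_continuous
      ((hfC n).continuous_fderiv one_ne_zero)
  choose B hB using hB
  set c : ℕ → ℝ := fun n => (1 / 2) ^ n / 2 * m n / (|B n| + 1) with hc
  have hc0 : ∀ n, 0 < c n := fun n => by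
    have := hm0 n (mem_Ici.2 n.cast_nonneg)
    have := abs_nonneg (B n)
    positivity
  have hcB : ∀ n, c n * (|B n| + 1) = (1 / 2) ^ n / 2 * m n := fun n => by
    have := abs_nonneg (B n)
    simp only [hc]
    field_simp
  have hmn : ∀ n, ∀ x ∈ tsupport (f n), m n ≤ m ‖x‖ := fun n x hx =>
    hm (norm_nonneg x) (mem_Ici.2 n.cast_nonneg) (by simpa using htsup n hx)
  have hf1 : ∀ n x, ‖c n * f n x‖ ≤ (1 / 2) ^ n / 2 * m ‖x‖ := by
    intro n x
    have hmx := hm0 ‖x‖ (norm_nonneg x)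
    by_cases hx : x ∈ tsupport (f n)
    · have h1 := hf01 n (mem_range_self x)
      rw [Real.norm_eq_abs, abs_mul, abs_of_pos (hc0 n), abs_of_nonneg h1.1]
      calc c n * f n x ≤ c n * (|B n| + 1) :=
            mul_le_mul_of_nonneg_left (h1.2.trans (by linarith [abs_nonneg (B n)])) (hc0 n).le
        _ ≤ _ := by rw [hcB]; exact mul_le_mul_of_nonneg_left (hmn n x hx) (by positivity)
    · rw [image_eq_zero_of_notMem_tsupport hx, mul_zero, norm_zero]
      positivity
  have hfd : ∀ n x, fderiv ℝ (fun y => c n * f n y) x = c n • fderiv ℝ (f n) x := fun n x =>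
    fderiv_const_mul ((hfC n).differentiable one_ne_zero x) _
  have hf2 : ∀ n x, ‖fderiv ℝ (fun y => c n * f n y) x‖ ≤ (1 / 2) ^ n / 2 * m ‖x‖ := by
    intro n x
    have hmx := hm0 ‖x‖ (norm_nonneg x)
    rw [hfd]
    by_cases hx : x ∈ tsupport (f n)
    · rw [norm_smul, Real.norm_eq_abs, abs_of_pos (hc0 n)]
      calc c n * ‖fderiv ℝ (f n) x‖ ≤ c n * (|B n| + 1) :=
            mul_le_mul_of_nonneg_left ((hB n x).trans (by linarith [le_abs_self (B n)])) (hc0 n).le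
        _ ≤ _ := by rw [hcB]; exact mul_le_mul_of_nonneg_left (hmn n x hx) (by positivity)
    · rw [image_eq_zero_of_notMem_tsupport fun h => hx (tsupport_fderiv_subset ℝ h), smul_zero,
        norm_zero]
      positivity
  have hsum : ∀ b : ℝ, HasSum (fun n : ℕ => (1 / 2 : ℝ) ^ n / 2 * b) b := fun b => by
    simpa using (hasSum_geometric_two.div_const 2).mul_right b
  have hm_le : ∀ x : X, m ‖x‖ ≤ m 0 := fun x => hm (mem_Ici.2 le_rfl) (norm_nonneg x) (norm_nonneg x)
  have hf2' : ∀ n x, ‖fderiv ℝ (fun y => c n * f n y) x‖ ≤ (1 / 2) ^ n / 2 * m 0 := fun n x =>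
    (hf2 n x).trans (mul_le_mul_of_nonneg_left (hm_le x) (by positivity))
  have hdiff : ∀ n, Differentiable ℝ (fun y => c n * f n y) := fun n =>
    ((hfC n).differentiable one_ne_zero).const_mul _
  have hs1 : ∀ x, Summable fun n => c n * f n x := fun x =>
    Summable.of_norm_bounded (hsum _).summable fun n => hf1 n x
  have hder : ∀ x, HasFDerivAt (fun y => ∑' n, c n * f n y)
      (∑' n, fderiv ℝ (fun y => c n * f n y) x) x := fun x =>
    hasFDerivAt_tsum (hsum _).summable (fun n x => (hdiff n x).hasFDerivAt) hf2' (hs1 0) x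
  have hnn : ∀ x n, 0 ≤ c n * f n x := fun x n =>
    mul_nonneg (hc0 n).le (hf01 n (mem_range_self x)).1
  refine ⟨fun x => ∑' n, c n * f n x, ?_, fun x => tsum_nonneg (hnn x), fun x => ⟨fun h => ?_,
    fun hx => ?_⟩, fun x => ?_, fun x => ?_⟩
  · rw [contDiff_one_iff_fderiv]
    refine ⟨fun x => (hder x).differentiableAt, ?_⟩
    rw [show fderiv ℝ (fun y => ∑' n, c n * f n y) =
      fun x => ∑' n, fderiv ℝ (fun y => c n * f n y) x from funext fun x => (hder x).fderiv]
    refine continuous_tsum (fun n => ?_) (hsum _).summable hf2'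
    exact (contDiff_const.mul (hfC n)).continuous_fderiv one_ne_zero
  · by_contra hx
    refine h.ne' ?_
    have : ∀ n, f n x = 0 := fun n => by
      by_contra h
      exact hx ((hfs n).subset h).1
    simp [this]
  · obtain ⟨n, hn⟩ := exists_nat_gt ‖x‖
    refine (hs1 x).tsum_pos (hnn x) n (mul_pos (hc0 n) ?_)
    refine lt_of_le_of_ne (hf01 n (mem_range_self x)).1 (Ne.symm ?_)
    exact (hfs n).symm.subset ⟨hx, by simpa using hn⟩
  · exact (le_abs_self _).trans (tsum_of_norm_bounded (hsum _) fun n => hf1 n x)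
  · rw [(hder x).fderiv]
    exact tsum_of_norm_bounded (hsum _) fun n => hf2 n x

section Mollification

variable {X : Type*} [NormedAddCommGroup X] [NormedSpace ℝ X] [FiniteDimensional ℝ X]
  [MeasurableSpace X] [BorelSpace X] (μ : Measure X) [μ.IsAddHaarMeasure]

lemma abs_integral_normed_mul_sub_le (φ : ContDiffBump (0 : X)) {F G : X → ℝ} (hF : Continuous F)
    (hG : Continuous G) {δ : ℝ} (hFG : ∀ y ∈ ball (0 : X) φ.rOut, |F y - G y| ≤ δ) :
    |∫ y, φ.normed μ y * F y ∂μ - ∫ y, φ.normed μ y * G y ∂μ| ≤ δ := by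
  have hsm_int : ∀ {H : X → ℝ}, Continuous H → Integrable (fun y => φ.normed μ y * H y) μ :=
    fun hH => (φ.continuous_normed.mul hH).integrable_of_hasCompactSupport
      (φ.hasCompactSupport_normed.mul_right)
  rw [← integral_sub (hsm_int hF) (hsm_int hG), ← Real.norm_eq_abs]
  have h1 : ∫ y, φ.normed μ y * δ ∂μ = δ := by
    rw [integral_mul_const, φ.integral_normed, one_mul]
  refine (norm_integral_le_of_norm_le (hsm_int continuous_const) (ae_of_all _ fun y => ?_)).trans h1.le
  rw [← mul_sub, norm_mul, Real.norm_eq_abs, Real.norm_eq_abs, abs_of_nonneg (φ.nonneg_normed y)]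
  by_cases hy : y ∈ ball (0 : X) φ.rOut
  · exact mul_le_mul_of_nonneg_left (hFG y hy) (φ.nonneg_normed y)
  · have : φ.normed μ y = 0 := by
      rw [← φ.support_normed_eq (μ := μ)] at hy
      exact Function.notMem_support.1 hy
    rw [this, zero_mul, zero_mul]

lemma contDiffOn_integral_normed_mul (φ : ContDiffBump (0 : X)) {Ω : Set X} (hΩ : IsOpen Ω)
    {v r : X → ℝ} (hv : Continuous v) (hr : ContDiff ℝ 1 r) (hr0 : ∀ x ∈ Ω, 0 < r x)
    (hr1 : ∀ x ∈ Ω, r x ≤ 1) :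
    ContDiffOn ℝ 1 (fun x => ∫ y, φ.normed μ y * v (x - r x • y) ∂μ) Ω := by
  set g : X → X → ℝ := fun x z =>
    (r x ^ Module.finrank ℝ X)⁻¹ * φ.normed μ ((r x)⁻¹ • z) with hg
  have hconv : ContDiffOn ℝ ((1 : ℕ∞) : WithTop ℕ∞)
      (fun x => (convolution v (g x) (ContinuousLinearMap.mul ℝ ℝ) μ) x) Ω := by
    refine contDiffOn_convolution_right_with_param_comp (ContinuousLinearMap.mul ℝ ℝ)
      contDiffOn_id hΩ (isCompact_closedBall (0 : X) φ.rOut) ?_ hv.locallyIntegrable ?_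
    · intro x z hx hz
      have : (r x)⁻¹ • z ∉ Function.support (φ.normed μ) := by
        rw [φ.support_normed_eq, mem_ball_zero_iff, norm_smul, norm_inv, Real.norm_eq_abs,
          abs_of_pos (hr0 x hx), not_lt]
        rw [mem_closedBall_zero_iff, not_le] at hz
        exact hz.le.trans (le_mul_of_one_le_left (norm_nonneg z)
          ((one_le_inv₀ (hr0 x hx)).2 (hr1 x hx)))
      simp only [hg]
      rw [Function.notMem_support.1 this, mul_zero]
    · have h1 : ContDiffOn ℝ 1 (fun p : X × X => r p.1) (Ω ×ˢ univ) :=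
        (hr.comp contDiff_fst).contDiffOn
      have h2 : ∀ p ∈ Ω ×ˢ (univ : Set X), r p.1 ≠ 0 := fun p hp => (hr0 _ hp.1).ne'
      refine ((h1.pow _).inv fun p hp => pow_ne_zero _ (h2 p hp)).mul ?_
      exact φ.contDiff_normed.comp_contDiffOn ((h1.inv h2).smul contDiff_snd.contDiffOn)
  refine hconv.congr fun x hx => ?_
  rw [convolution_eq_swap]
  have h := Measure.integral_comp_inv_smul_of_nonneg μ
    (fun y => φ.normed μ y * v (x - r x • y)) (hr0 x hx).le
  have hpow : r x ^ Module.finrank ℝ X ≠ 0 := pow_ne_zero _ (hr0 x hx).ne'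
  rw [(eq_inv_smul_iff₀ hpow).2 h.symm, smul_eq_mul, ← integral_const_mul]
  refine integral_congr_ae (ae_of_all _ fun z => ?_)
  simp only [hg, ContinuousLinearMap.mul_apply', smul_inv_smul₀ (hr0 x hx).ne']
  ring

/-- Mollification with a variable radius of a function which is locally strictly
`1`-Lipschitz. -/
lemma exists_contDiffOn_approx {Ω : Set X} (hΩ : IsOpen Ω) {v : X → ℝ} {β : ℝ → ℝ}
    (hβ : AntitoneOn β (Ici 0)) (hβ0 : ∀ t ∈ Ici (0 : ℝ), 0 < β t) (hβ1 : ∀ t ∈ Ici (0 : ℝ), β t ≤ 1)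
    (hv : ∀ R, 0 ≤ R → ∀ x ∈ closedBall (0 : X) R, ∀ y ∈ closedBall (0 : X) R,
      |v x - v y| ≤ (1 - β R) * ‖x - y‖) {η : ℝ} (hη : 0 < η) :
    ∃ u : X → ℝ, Continuous u ∧ (∀ x ∉ Ω, u x = v x) ∧ ContDiffOn ℝ 1 u Ω ∧
      (∀ x ∈ Ω, ‖fderiv ℝ u x‖ < 1) ∧ ∀ x, |u x - v x| ≤ η := by
  obtain ⟨μ, hμ⟩ : ∃ μ : Measure X, μ.IsAddHaarMeasure := ⟨Measure.addHaar, inferInstance⟩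
  have hv1 : ∀ x y, |v x - v y| ≤ ‖x - y‖ := fun x y => by
    have h0 : 0 ≤ max ‖x‖ ‖y‖ := (norm_nonneg x).trans (le_max_left _ _)
    refine (hv _ h0 x (by simp) y (by simp)).trans ?_
    nlinarith [hβ0 _ h0, norm_nonneg (x - y)]
  have hvc : Continuous v := by
    refine (LipschitzWith.of_dist_le_mul (K := 1) fun x y => ?_).continuous
    rw [Real.dist_eq, dist_eq_norm, NNReal.coe_one, one_mul]
    exact hv1 x y
  obtain ⟨r, hrC, hr0, hrΩ, hrm, hrd⟩ := exists_contDiff_pos_iff_mem hΩ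
    (m := fun t => min (min (1 / 2) η) (β (t + 2)))
    (fun s hs t ht hst => min_le_min le_rfl (hβ (mem_Ici.2 (by linarith [mem_Ici.1 hs]))
      (mem_Ici.2 (by linarith [mem_Ici.1 ht])) (by linarith)))
    (fun t ht => lt_min (lt_min (by norm_num) hη) (hβ0 _ (mem_Ici.2 (by linarith [mem_Ici.1 ht]))))
  have hr2 : ∀ x, r x ≤ 1 / 2 := fun x =>
    (hrm x).trans ((min_le_left _ _).trans (min_le_left _ _))
  have hrη : ∀ x, r x ≤ η := fun x => (hrm x).trans ((min_le_left _ _).trans (min_le_right _ _))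
  let φ : ContDiffBump (0 : X) := ⟨1 / 2, 1, by norm_num, by norm_num⟩
  set u : X → ℝ := fun x => ∫ y, φ.normed μ y * v (x - r x • y) ∂μ with hu
  have hcont : ∀ x, Continuous fun y : X => v (x - r x • y) := fun x => by fun_prop
  have hconst : ∀ c : ℝ, ∫ y, φ.normed μ y * c ∂μ = c := fun c => by
    rw [integral_mul_const, φ.integral_normed, one_mul]
  have hsub : ∀ x x' y, y ∈ ball (0 : X) φ.rOut → ‖x - r x • y - (x' - r x' • y)‖ ≤
      ‖x - x'‖ + |r x - r x'| := by
    intro x x' y hy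
    have hy1 : ‖y‖ ≤ 1 := (mem_ball_zero_iff.1 hy).le
    have h1 : x - r x • y - (x' - r x' • y) = (x - x') - (r x - r x') • y := by
      rw [sub_smul]; abel
    rw [h1]
    refine (norm_sub_le _ _).trans (add_le_add_right ?_ _)
    rw [norm_smul, Real.norm_eq_abs]
    exact mul_le_of_le_one_right (abs_nonneg _) hy1
  refine ⟨u, ?_, fun x hx => ?_, ?_, fun x hx => ?_, fun x => ?_⟩
  · rw [continuous_iff_continuousAt]
    intro x
    have h1 : ∀ z, |u z - u x| ≤ ‖z - x‖ + |r z - r x| := fun z =>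
      abs_integral_normed_mul_sub_le μ φ (hcont z) (hcont x)
        fun y hy => (hv1 _ _).trans (hsub z x y hy)
    have h2 : Tendsto (fun z => ‖z - x‖ + |r z - r x|) (𝓝 x) (𝓝 0) := by
      have h3 : Continuous fun z => ‖z - x‖ + |r z - r x| := by
        have := hrC.continuous
        fun_prop
      simpa using h3.tendsto x
    rw [ContinuousAt, tendsto_iff_dist_tendsto_zero]
    exact squeeze_zero (fun _ => dist_nonneg) (fun z => (Real.dist_eq _ _).trans_le (h1 z)) h2
  · have h1 : r x = 0 := le_antisymm (not_lt.1 fun h => hx ((hrΩ x).1 h)) (hr0 x)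
    simp only [hu, h1, zero_smul, sub_zero, hconst]
  · exact contDiffOn_integral_normed_mul μ φ hΩ hvc hrC (fun x hx => (hrΩ x).2 hx)
      fun x _ => (hr2 x).trans (by norm_num)
  · set R := ‖x‖ + 3 / 2 with hR
    have hR0 : 0 ≤ R := by positivity
    have hrlip : ∀ y ∈ ball x (1 / 2), ∀ y' ∈ ball x (1 / 2), |r y - r y'| ≤ β R * ‖y - y'‖ := by
      intro y hy y' hy'
      have := (convex_ball x (1 / 2)).norm_image_sub_le_of_norm_fderiv_le (𝕜 := ℝ) (f := r)
        (C := β R) (fun z _ => hrC.differentiable one_ne_zero z) (fun z hz => ?_) hy' hy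
      · simpa using this
      · refine (hrd z).trans ((min_le_right _ _).trans (hβ hR0 ?_ ?_))
        · exact mem_Ici.2 (by positivity)
        · have h1 := norm_sub_norm_le x z
          rw [mem_ball', dist_eq_norm] at hz
          linarith
    have hin : ∀ y ∈ ball x (1 / 2), ∀ z ∈ ball (0 : X) φ.rOut,
        y - r y • z ∈ closedBall (0 : X) R := by
      intro y hy z hz
      have hz1 : ‖z‖ ≤ 1 := (mem_ball_zero_iff.1 hz).le
      rw [mem_closedBall_zero_iff]
      have h1 := norm_sub_le y (r y • z)
      have h2 := norm_sub_norm_le y x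
      rw [mem_ball, dist_eq_norm] at hy
      rw [norm_smul, Real.norm_eq_abs, abs_of_nonneg (hr0 y)] at h1
      have h3 : r y * ‖z‖ ≤ 1 / 2 * 1 := mul_le_mul (hr2 y) hz1 (norm_nonneg z) (by norm_num)
      linarith
    have hβR0 := hβ0 R hR0
    have hβR1 := hβ1 R hR0
    have hulip : ∀ y ∈ ball x (1 / 2), ∀ y' ∈ ball x (1 / 2),
        |u y - u y'| ≤ (1 - β R ^ 2) * ‖y - y'‖ := by
      intro y hy y' hy'
      refine abs_integral_normed_mul_sub_le μ φ (hcont y) (hcont y') fun z hz => ?_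
      have h1 := hv R hR0 _ (hin y hy z hz) _ (hin y' hy' z hz)
      refine h1.trans ?_
      have h2 := (hsub y y' z hz).trans (add_le_add_right (hrlip y hy y' hy') _)
      refine (mul_le_mul_of_nonneg_left h2 (by linarith)).trans (le_of_eq ?_)
      ring
    have hnn : 0 ≤ 1 - β R ^ 2 := by nlinarith
    have hlip : LipschitzOnWith (Real.toNNReal (1 - β R ^ 2)) u (ball x (1 / 2)) :=
      LipschitzOnWith.of_dist_le_mul fun y hy y' hy' => by
        rw [Real.dist_eq, dist_eq_norm, Real.coe_toNNReal _ hnn]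
        exact hulip y hy y' hy'
    have := norm_fderiv_le_of_lipschitzOn ℝ (ball_mem_nhds x (by norm_num)) hlip
    rw [Real.coe_toNNReal _ hnn] at this
    nlinarith
  · have h1 := abs_integral_normed_mul_sub_le μ φ (hcont x) (continuous_const (y := v x))
      (δ := η) fun y hy => ?_
    · rwa [hconst] at h1
    · refine (hv1 _ _).trans ?_
      have hy1 : ‖y‖ ≤ 1 := (mem_ball_zero_iff.1 hy).le
      rw [sub_sub_cancel_left, norm_neg, norm_smul, Real.norm_eq_abs, abs_of_nonneg (hr0 x)]
      exact (mul_le_of_le_one_right (hr0 x) hy1).trans (hrη x)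

end Mollification

lemma exists_arctan_sub_eq_mul {s s' S : ℝ} (hs : |s| ≤ S) (hs' : |s'| ≤ S) :
    ∃ t, 1 / (1 + S ^ 2) ≤ t ∧ t ≤ 1 ∧ Real.arctan s - Real.arctan s' = t * (s - s') := by
  wlog h : s' < s generalizing s s'
  · rcases (not_lt.1 h).eq_or_lt with rfl | h
    · refine ⟨1, ?_, le_rfl, by simp⟩
      rw [div_le_one (by positivity)]
      nlinarith [sq_nonneg S]
    · obtain ⟨t, h1, h2, h3⟩ := this hs' hs h
      exact ⟨t, h1, h2, by linarith⟩
  obtain ⟨ξ, hξ, hξd⟩ := exists_hasDerivAt_eq_slope Real.arctan (fun x => 1 / (1 + x ^ 2)) h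
    Real.continuous_arctan.continuousOn fun x _ => Real.hasDerivAt_arctan x
  have hξS : ξ ^ 2 ≤ S ^ 2 := sq_le_sq.2 (by
    rw [abs_of_nonneg ((abs_nonneg s).trans hs)]
    exact abs_le.2 ⟨by linarith [(abs_le.1 hs').1, hξ.1], by linarith [(abs_le.1 hs).2, hξ.2]⟩)
  refine ⟨1 / (1 + ξ ^ 2), ?_, ?_, ?_⟩
  · exact one_div_le_one_div_of_le (by positivity) (by linarith)
  · rw [div_le_one (by positivity)]
    nlinarith [sq_nonneg ξ]
  · rw [hξd, div_mul_cancel₀ _ (by linarith)]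

lemma exists_start {X : Type*} [NormedAddCommGroup X] [NormedSpace ℝ X] [FiniteDimensional ℝ X]
    [MeasurableSpace X] [BorelSpace X] {Ω : Set X} (hΩ : IsOpen Ω) {u₀ : X → ℝ}
    (hu₀ : IsLipschitzWithOn 1 u₀ (closure Ω)) (hlt : lipOn u₀ (frontier Ω) < 1)
    {ε : ℝ} (hε : 0 < ε) :
    ∃ u v : X → ℝ, (∀ x y, |v x - v y| ≤ ‖x - y‖) ∧ Continuous u ∧ (∀ x ∉ Ω, u x = v x) ∧
      ContDiffOn ℝ 1 u Ω ∧ (∀ x ∈ Ω, ‖fderiv ℝ u x‖ < 1) ∧ (∀ x ∈ frontier Ω, u x = u₀ x) ∧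
      ∀ x ∈ closure Ω, |u₀ x - u x| ≤ ε / 2 := by
  have hne : {L : ℝ | 0 < L ∧ ∀ x ∈ frontier Ω, ∀ y ∈ frontier Ω,
      |u₀ x - u₀ y| ≤ L * dist x y}.Nonempty := ⟨1, one_pos, fun x hx y hy =>
    hu₀ x (frontier_subset_closure hx) y (frontier_subset_closure hy)⟩
  obtain ⟨L, ⟨hL0, hL⟩, hL1⟩ := exists_lt_of_csInf_lt hne hlt
  obtain ⟨U, hU, hUeq⟩ := (LipschitzOnWith.of_dist_le_mul (K := 1) fun x hx y hy => by
    simpa [Real.dist_eq] using hu₀ x hx y hy : LipschitzOnWith 1 u₀ (closure Ω)).extend_real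
  obtain ⟨g, hg, hgeq⟩ := (LipschitzOnWith.of_dist_le_mul (K := L.toNNReal) fun x hx y hy => by
    simpa [Real.dist_eq, hL0.le] using hL x hx y hy :
      LipschitzOnWith L.toNNReal u₀ (frontier Ω)).extend_real
  have hU1 : ∀ x y, |U x - U y| ≤ ‖x - y‖ := fun x y => by
    simpa [Real.dist_eq, dist_eq_norm] using hU.dist_le_mul x y
  have hg1 : ∀ x y, |g x - g y| ≤ L * ‖x - y‖ := fun x y => by
    simpa [Real.dist_eq, dist_eq_norm, hL0.le] using hg.dist_le_mul x y
  set c := min 1 (ε / 8) with hc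
  have hc0 : 0 < c := lt_min one_pos (by linarith)
  have hc1 : c ≤ 1 := min_le_left _ _
  have hcε : c ≤ ε / 8 := min_le_right _ _
  set v : X → ℝ := fun x => U x + c * Real.arctan (g x - U x) with hv
  set β : ℝ → ℝ := fun R => c * (1 - L) * (1 / (1 + (|g 0 - U 0| + 2 * R) ^ 2)) with hβ
  have hL1' : 0 < 1 - L := sub_pos.2 hL1
  have hβ0 : ∀ R, 0 < β R := fun R => by positivity
  have hβ1 : ∀ R, β R ≤ 1 := fun R => by
    have h1 : 1 / (1 + (|g 0 - U 0| + 2 * R) ^ 2) ≤ 1 := by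
      rw [div_le_one (by positivity)]
      nlinarith [sq_nonneg (|g 0 - U 0| + 2 * R)]
    have h2 : c * (1 - L) ≤ 1 := by nlinarith
    have h3 : 0 < c * (1 - L) := by positivity
    exact mul_le_one₀ h2 (by positivity) h1
  have hβanti : AntitoneOn β (Ici 0) := fun s hs t ht hst => by
    refine mul_le_mul_of_nonneg_left ?_ (by positivity)
    have := mem_Ici.1 hs
    exact one_div_le_one_div_of_le (by positivity) (by gcongr)
  have hdiff : ∀ R, 0 ≤ R → ∀ x ∈ closedBall (0 : X) R,
      |g x - U x| ≤ |g 0 - U 0| + 2 * R := by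
    intro R hR x hx
    rw [mem_closedBall_zero_iff] at hx
    have h1 := hU1 x 0
    have h2 := hg1 x 0
    rw [sub_zero] at h1 h2
    have h3 : L * ‖x‖ ≤ ‖x‖ := mul_le_of_le_one_left (norm_nonneg x) hL1.le
    have h4 : g x - U x = (g 0 - U 0) + (g x - g 0) - (U x - U 0) := by ring
    rw [h4]
    have h5 := abs_sub ((g 0 - U 0) + (g x - g 0)) (U x - U 0)
    have h6 := abs_add_le (g 0 - U 0) (g x - g 0)
    linarith
  have hvR : ∀ R, 0 ≤ R → ∀ x ∈ closedBall (0 : X) R, ∀ y ∈ closedBall (0 : X) R,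
      |v x - v y| ≤ (1 - β R) * ‖x - y‖ := by
    intro R hR x hx y hy
    obtain ⟨t, ht0, ht1, ht⟩ := exists_arctan_sub_eq_mul (hdiff R hR x hx) (hdiff R hR y hy)
    have ht0' : 0 ≤ t := le_trans (by positivity) ht0
    have hct1 : c * t ≤ 1 := mul_le_one₀ hc1 ht0' ht1
    have h1 : v x - v y = (1 - c * t) * (U x - U y) + (c * t) * (g x - g y) := by
      simp only [hv]
      linear_combination c * ht
    have h2 := abs_add_le ((1 - c * t) * (U x - U y)) ((c * t) * (g x - g y))
    rw [abs_mul, abs_mul, abs_of_nonneg (sub_nonneg.2 hct1),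
      abs_of_nonneg (mul_nonneg hc0.le ht0')] at h2
    rw [h1]
    refine h2.trans ?_
    have h3 := mul_le_mul_of_nonneg_left (hU1 x y) (sub_nonneg.2 hct1)
    have h4 := mul_le_mul_of_nonneg_left (hg1 x y) (mul_nonneg hc0.le ht0')
    have h5 : β R ≤ c * (1 - L) * t := mul_le_mul_of_nonneg_left ht0 (by positivity)
    have h6 := mul_le_mul_of_nonneg_right h5 (norm_nonneg (x - y))
    linarith
  obtain ⟨u, huc, huv, huC, hud, huη⟩ := exists_contDiffOn_approx hΩ hβanti (fun t _ => hβ0 t)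
    (fun t _ => hβ1 t) hvR (by positivity : 0 < ε / 4)
  refine ⟨u, v, fun x y => ?_, huc, huv, huC, hud, fun x hx => ?_, fun x hx => ?_⟩
  · refine (hvR (max ‖x‖ ‖y‖) ((norm_nonneg x).trans (le_max_left _ _)) x (by simp) y
      (by simp)).trans ?_
    exact mul_le_of_le_one_left (norm_nonneg _) (by linarith [hβ0 (max ‖x‖ ‖y‖)])
  · have hxΩ : x ∉ Ω := by
      rw [hΩ.frontier_eq] at hx
      exact hx.2
    rw [huv x hxΩ]
    simp only [hv]
    rw [← hgeq hx, ← hUeq (frontier_subset_closure hx), hgeq hx, sub_self]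
    simp
  · have h1 : |Real.arctan (g x - U x)| ≤ 2 := by
      have h2 := Real.arctan_lt_pi_div_two (g x - U x)
      have h3 := Real.neg_pi_div_two_lt_arctan (g x - U x)
      have h4 := Real.pi_le_four
      exact abs_le.2 ⟨by linarith, by linarith⟩
    have h2 : |u₀ x - v x| ≤ ε / 4 := by
      simp only [hv]
      rw [hUeq hx, sub_add_cancel_left, abs_neg, abs_mul, abs_of_pos hc0]
      nlinarith [abs_nonneg (Real.arctan (g x - U x))]
    have h3 := abs_sub_le (u₀ x) (v x) (u x)
    rw [abs_sub_comm (v x)] at h3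
    linarith [huη x]

lemma exists_seq_of_forall_step {S : Type*} {I : S → Prop} {R : ℕ → S → S → Prop}
    (h : ∀ n s, I s → ∃ s', I s' ∧ R n s s') {s₀ : S} (h₀ : I s₀) :
    ∃ s : ℕ → S, s 0 = s₀ ∧ (∀ n, I (s n)) ∧ ∀ n, R n (s n) (s (n + 1)) := by
  choose! f hf using h
  refine ⟨fun n => Nat.rec s₀ (fun n s => f n s) n, rfl, ?_⟩
  have hI : ∀ n, I (Nat.rec s₀ (fun n s => f n s) n : S) := fun n => by
    induction n with
    | zero => exact h₀
    | succ n ih => exact (hf n _ ih).1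
  exact ⟨hI, fun n => (hf n _ (hI n)).2⟩

section Iteration

variable {X : Type*} [NormedAddCommGroup X] [NormedSpace ℝ X] [FiniteDimensional ℝ X]

lemma IsCompact.exists_radius_norm_sub_le {F : Type*} [NormedAddCommGroup F] {Ω K : Set X}
    (hΩ : IsOpen Ω) (hK : IsCompact K) (hKΩ : K ⊆ Ω) {f : X → F} (hf : ContinuousOn f Ω) {κ : ℝ}
    (hκ : 0 < κ) :
    ∃ r > 0, ∀ x ∈ K, ∀ y ∈ closedBall x r, y ∈ Ω ∧ ‖f y - f x‖ ≤ κ := by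
  obtain ⟨δ, hδ, hδΩ⟩ := hK.exists_cthickening_subset_open hΩ hKΩ
  have huc := hK.cthickening (r := δ).uniformContinuousOn_of_continuous (hf.mono hδΩ)
  obtain ⟨r, hr, h⟩ := Metric.uniformContinuousOn_iff_le.1 huc κ hκ
  refine ⟨min r δ, lt_min hr hδ, fun x hx y hy => ?_⟩
  have hyd : dist y x ≤ min r δ := hy
  have hyK : y ∈ cthickening δ K :=
    mem_cthickening_of_dist_le y x δ K hx (hyd.trans (min_le_right _ _))
  refine ⟨hδΩ hyK, ?_⟩
  rw [← dist_eq_norm]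
  exact h y hyK x (self_subset_cthickening K hx) (hyd.trans (min_le_left _ _))

variable [MeasurableSpace X] [BorelSpace X] (μ : Measure X) [μ.IsAddHaarMeasure]

lemma exists_next {E : Type*} [NormedAddCommGroup E] [InnerProductSpace ℝ E]
    [FiniteDimensional ℝ E] (hE : 2 ≤ Module.finrank ℝ E) (Φ : (X →L[ℝ] ℝ) ≃L[ℝ] E)
    {C : ℝ} (hC : 0 < C) (hC1 : ∀ q, ‖q‖ ≤ C * ‖Φ q‖) (hC2 : ∀ q, ‖Φ q‖ ≤ C * ‖q‖)
    {Ω K : Set X} (hΩ : IsOpen Ω) (hK : IsCompact K) (hKΩ : K ⊆ Ω) {u : X → ℝ}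
    (hu : ContDiffOn ℝ 1 u Ω) (hu1 : ∀ x ∈ Ω, ‖fderiv ℝ u x‖ < 1) {V : X → E}
    (hV : ContinuousOn V Ω) {r τ κ : ℝ} (hr : 0 < r) (hτ : 0 < τ) (hκ : 0 < κ) :
    ∃ (w : X → ℝ) (r' : ℝ), 0 < r' ∧ r' ≤ r / 2 ∧ ContDiffOn ℝ 1 w Ω ∧
      (∀ x ∈ Ω, ‖fderiv ℝ w x‖ < 1) ∧ Differentiable ℝ (w - u) ∧ (∀ y ∉ Ω, w y = u y) ∧
      (∀ y, |w y - u y| ≤ κ * r') ∧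
      (∀ x ∈ K, ∀ y ∈ closedBall x r', y ∈ Ω ∧ ‖fderiv ℝ u y - fderiv ℝ u x‖ ≤ κ) ∧
      (∀ y, ‖fderiv ℝ (w - u) y‖ ≤ 2 * C * τ) ∧
      (∀ y ∈ Ω, -κ ≤ inner ℝ (V y) (Φ (fderiv ℝ w y) - Φ (fderiv ℝ u y))) ∧
      μ {y ∈ K | ¬ (τ / (2 * C) ≤ ‖fderiv ℝ w y - fderiv ℝ u y‖ ∨
        1 - 4 * C * τ ≤ ‖fderiv ℝ u y‖)} ≤ ENNReal.ofReal κ := by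
  have hfu : ContinuousOn (fderiv ℝ u) Ω := hu.continuousOn_fderiv_of_isOpen hΩ le_rfl
  obtain ⟨r₁, hr₁, hr₁K⟩ := hK.exists_radius_norm_sub_le hΩ hKΩ hfu hκ
  set r' := min (r / 2) r₁ with hr'
  have hr'0 : 0 < r' := lt_min (half_pos hr) hr₁
  obtain ⟨P, hPC, hP0, hPσ, hPd, hPadm, hPμ⟩ := exists_perturbation μ hE Φ hC hC1 hC2 hΩ hK hKΩ
    hfu hV hu1 hτ (mul_pos hκ hr'0) hκ
  have hsub : u + P - u = P := add_sub_cancel_left u P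
  have hder : ∀ y ∈ Ω, fderiv ℝ (u + P) y = fderiv ℝ u y + fderiv ℝ P y := fun y hy =>
    fderiv_add ((hu.contDiffAt (hΩ.mem_nhds hy)).differentiableAt one_ne_zero)
      (hPC.differentiable one_ne_zero y)
  refine ⟨u + P, r', hr'0, min_le_left _ _, hu.add hPC.contDiffOn, fun x hx => ?_, ?_,
    fun y hy => by simp [hP0 y hy], fun y => by simpa using hPσ y, fun x hx y hy => ?_,
    fun y => ?_, fun y hy => ?_, ?_⟩
  · rw [hder x hx]
    exact (hPadm x hx).1
  · rw [hsub]
    exact hPC.differentiable one_ne_zero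
  · exact hr₁K x hx y (closedBall_subset_closedBall (min_le_right _ _) hy)
  · rw [hsub]
    have := mul_le_mul_of_nonneg_left (hPd y) hC.le
    linarith [hC1 (fderiv ℝ P y)]
  · rw [hder y hy, map_add, add_sub_cancel_left]
    exact (abs_le.1 (hPadm y hy).2.2).1
  · refine (measure_mono ?_).trans hPμ
    rintro y ⟨hy, hbad⟩
    refine ⟨hy, fun h => hbad (h.imp_left fun h => ?_)⟩
    rw [hder y (hKΩ hy), add_sub_cancel_left, div_le_iff₀ (by positivity)]
    linarith [hC2 (fderiv ℝ P y)]

/-- The approximating sequence: the derivatives converge pointwise on `Ω`, and they keep moving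
on most of `K n` unless their norm is close to one. -/
lemma exists_approximating_seq (hdim : 2 ≤ Module.finrank ℝ X) {Ω : Set X} (hΩ : IsOpen Ω)
    {K : ℕ → Set X} (hK : ∀ n, IsCompact (K n)) (hKΩ : ∀ n, K n ⊆ Ω) {u : X → ℝ}
    (hu : ContDiffOn ℝ 1 u Ω) (hu1 : ∀ x ∈ Ω, ‖fderiv ℝ u x‖ < 1) {τ : ℕ → ℝ} (hτ : ∀ n, 0 < τ n)
    {δ : ℝ} (hδ : 0 < δ) :
    ∃ (M c : ℝ) (U : ℕ → X → ℝ) (ρ : ℕ → ℝ), 0 < c ∧ U 0 = u ∧ (∀ n, 0 < ρ n) ∧ ρ 0 ≤ δ ∧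
      (∀ n, ρ (n + 1) ≤ ρ n / 2) ∧ (∀ n, ∀ x ∈ Ω, DifferentiableAt ℝ (U n) x) ∧
      (∀ n, ∀ x ∈ Ω, ‖fderiv ℝ (U n) x‖ < 1) ∧
      (∀ n, Differentiable ℝ (U (n + 1) - U n)) ∧
      (∀ n, ∀ y ∉ Ω, U (n + 1) y = U n y) ∧
      (∀ n y, |U (n + 1) y - U n y| ≤ (1 / 2) ^ n * ρ n) ∧
      (∀ n, ∀ x ∈ K n, ∀ y ∈ closedBall x (ρ n), y ∈ Ω ∧
        ‖fderiv ℝ (U n) y - fderiv ℝ (U n) x‖ ≤ (1 / 2) ^ n) ∧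
      (∀ n y, ‖fderiv ℝ (U (n + 1) - U n) y‖ ≤ M * τ n) ∧
      (∀ x ∈ Ω, Summable (fun n => ‖fderiv ℝ (U (n + 1)) x - fderiv ℝ (U n) x‖ ^ 2) ∧
        CauchySeq fun n => fderiv ℝ (U n) x) ∧
      ∀ n, μ {y ∈ K n | ¬ (c * τ n ≤ ‖fderiv ℝ (U (n + 1)) y - fderiv ℝ (U n) y‖ ∨
        1 - M * τ n ≤ ‖fderiv ℝ (U n) y‖)} ≤ ENNReal.ofReal ((1 / 2) ^ n) := by
  set d := Module.finrank ℝ (X →L[ℝ] ℝ) with hd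
  have hdX : d = Module.finrank ℝ X := by
    rw [hd, ← (LinearMap.toContinuousLinearMap (𝕜 := ℝ) (E := X) (F' := ℝ)).finrank_eq]
    exact Subspace.dual_finrank_eq
  let E := EuclideanSpace ℝ (Fin d)
  have hE : Module.finrank ℝ E = d := by simp [E]
  let Φ : (X →L[ℝ] ℝ) ≃L[ℝ] E := ContinuousLinearEquiv.ofFinrankEq hE.symm
  set C : ℝ := max 1 (max ‖(Φ : (X →L[ℝ] ℝ) →L[ℝ] E)‖ ‖(Φ.symm : E →L[ℝ] (X →L[ℝ] ℝ))‖) with hC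
  have hC0 : 0 < C := lt_of_lt_of_le one_pos (le_max_left _ _)
  have hC2 : ∀ q, ‖Φ q‖ ≤ C * ‖q‖ := fun q =>
    ((Φ : (X →L[ℝ] ℝ) →L[ℝ] E).le_opNorm q).trans (mul_le_mul_of_nonneg_right
      ((le_max_left _ _).trans (le_max_right _ _)) (norm_nonneg q))
  have hC1 : ∀ q, ‖q‖ ≤ C * ‖Φ q‖ := fun q => by
    have h := (Φ.symm : E →L[ℝ] (X →L[ℝ] ℝ)).le_opNorm (Φ q)
    rw [ContinuousLinearEquiv.coe_coe, Φ.symm_apply_apply] at h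
    exact h.trans (mul_le_mul_of_nonneg_right ((le_max_right _ _).trans (le_max_right _ _))
      (norm_nonneg _))
  let upd : ℕ → (X → ℝ) → (ℕ → X → E) → ℕ → X → E := fun n w b i x =>
    if i ≤ n then playStep (1 / ((i : ℝ) + 1)) (b i x) (Φ (fderiv ℝ w x)) else 0
  let V : ℕ → (X → ℝ) → (ℕ → X → E) → X → E := fun n w b x =>
    Φ (fderiv ℝ w x) + ∑ i ∈ Finset.range (n + 1), (1 / 2 : ℝ) ^ i • upd n w b i x
  have hupd : ∀ n w b, ContDiffOn ℝ 1 w Ω → (∀ i, ContinuousOn (b i) Ω) →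
      ∀ i, ContinuousOn (upd n w b i) Ω := by
    intro n w b hw hb i
    by_cases hi : i ≤ n
    · simp only [upd, hi, if_true]
      exact (hb i).playStep (by positivity)
        (Φ.continuous.comp_continuousOn (hw.continuousOn_fderiv_of_isOpen hΩ le_rfl))
    · simp only [upd, hi, if_false]
      exact continuousOn_const
  have hVc : ∀ n w b, ContDiffOn ℝ 1 w Ω → (∀ i, ContinuousOn (b i) Ω) →
      ContinuousOn (V n w b) Ω := fun n w b hw hb =>
    (Φ.continuous.comp_continuousOn (hw.continuousOn_fderiv_of_isOpen hΩ le_rfl)).add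
      (continuousOn_finsetSum _ fun i _ => continuousOn_const.fun_smul (hupd n w b hw hb i))
  obtain ⟨s, hs0, hsI, hsR⟩ := exists_seq_of_forall_step (S := (X → ℝ) × (ℕ → X → E) × ℝ)
    (I := fun s => ContDiffOn ℝ 1 s.1 Ω ∧ (∀ x ∈ Ω, ‖fderiv ℝ s.1 x‖ < 1) ∧
      (∀ i, ContinuousOn (s.2.1 i) Ω) ∧ 0 < s.2.2)
    (R := fun n s s' => s'.2.1 = upd n s.1 s.2.1 ∧ s'.2.2 ≤ s.2.2 / 2 ∧
      Differentiable ℝ (s'.1 - s.1) ∧ (∀ y ∉ Ω, s'.1 y = s.1 y) ∧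
      (∀ y, |s'.1 y - s.1 y| ≤ (1 / 2) ^ n * s'.2.2) ∧
      (∀ x ∈ K n, ∀ y ∈ closedBall x s'.2.2, y ∈ Ω ∧
        ‖fderiv ℝ s.1 y - fderiv ℝ s.1 x‖ ≤ (1 / 2) ^ n) ∧
      (∀ y, ‖fderiv ℝ (s'.1 - s.1) y‖ ≤ 2 * C * τ n) ∧
      (∀ y ∈ Ω, -(1 / 2) ^ n ≤
        inner ℝ (V n s.1 s.2.1 y) (Φ (fderiv ℝ s'.1 y) - Φ (fderiv ℝ s.1 y))) ∧
      μ {y ∈ K n | ¬ (τ n / (2 * C) ≤ ‖fderiv ℝ s'.1 y - fderiv ℝ s.1 y‖ ∨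
        1 - 4 * C * τ n ≤ ‖fderiv ℝ s.1 y‖)} ≤ ENNReal.ofReal ((1 / 2) ^ n))
    (s₀ := (u, 0, δ))
    (fun n s hs => by
      obtain ⟨w, r', hr'0, hr', hw, hw1, h⟩ := exists_next μ (hE.trans hdX ▸ hdim) Φ hC0 hC1 hC2
        hΩ (hK n) (hKΩ n) hs.1 hs.2.1 (hVc n s.1 s.2.1 hs.1 hs.2.2.1) hs.2.2.2 (hτ n)
        (by positivity : (0 : ℝ) < (1 / 2) ^ n)
      exact ⟨(w, upd n s.1 s.2.1, r'), ⟨hw, hw1, hupd n s.1 s.2.1 hs.1 hs.2.2.1, hr'0⟩,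
        rfl, hr', h⟩)
    ⟨hu, hu1, fun i => continuousOn_const, hδ⟩
  have hs0' : (s 0).1 = u ∧ (s 0).2.1 = 0 ∧ (s 0).2.2 = δ := by simp [hs0]
  refine ⟨4 * C, 1 / (2 * C), fun n => (s n).1, fun n => (s (n + 1)).2.2, by positivity, hs0'.1,
    fun n => (hsI (n + 1)).2.2.2, ?_, fun n => (hsR (n + 1)).2.1, fun n x hx => ?_,
    fun n => (hsI n).2.1, fun n => (hsR n).2.2.1, fun n => (hsR n).2.2.2.1,
    fun n => (hsR n).2.2.2.2.1, fun n => (hsR n).2.2.2.2.2.1, fun n y => ?_, fun x hx => ?_,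
    fun n => ?_⟩
  · have := (hsR 0).2.1
    rw [hs0'.2.2] at this
    linarith
  · exact ((hsI n).1.contDiffAt (hΩ.mem_nhds hx)).differentiableAt one_ne_zero
  · have := (hsR n).2.2.2.2.2.2.1 y
    have := mul_pos hC0 (hτ n)
    linarith
  · have hplay := cauchySeq_of_play (a := fun n => Φ (fderiv ℝ (s n).1 x))
      (b := fun n i => (s n).2.1 i x) (C := C) (fun n => ?_) (fun i => ?_) (fun n i => ?_)
      (fun n => ?_)
    · constructor
      · refine Summable.of_nonneg_of_le (fun n => sq_nonneg _) (fun n => ?_)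
          (hplay.1.mul_left (C ^ 2))
        rw [← mul_pow, ← map_sub]
        exact pow_le_pow_left₀ (norm_nonneg _) (hC1 _) 2
      · have := (Φ.symm : E →L[ℝ] (X →L[ℝ] ℝ)).uniformContinuous.comp_cauchySeq hplay.2
        simpa [Function.comp_def] using this
    · exact (hC2 _).trans (mul_le_of_le_one_right hC0.le ((hsI n).2.1 x hx).le)
    · simp [hs0'.2.1]
    · exact congrFun (congrFun (hsR n).1 i) x
    · have h := (hsR n).2.2.2.2.2.2.2.1 x hx
      simp only [(hsR n).1]
      exact h
  · refine (measure_mono ?_).trans (hsR n).2.2.2.2.2.2.2.2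
    rintro y ⟨hy, hbad⟩
    refine ⟨hy, fun h => hbad (h.imp_left fun h => ?_)⟩
    rwa [one_div_mul_eq_div]

end Iteration

lemma exists_limit_of_abs_sub_le {X : Type*} {U : ℕ → X → ℝ} {ρ : ℕ → ℝ} (hρ0 : ∀ n, 0 < ρ n)
    (hρ : ∀ n, ρ (n + 1) ≤ ρ n / 2)
    (hU : ∀ n y, |U (n + 1) y - U n y| ≤ (1 / 2) ^ n * ρ n) :
    ∃ w : X → ℝ, ∀ n y, |w y - U n y| ≤ 2 * (1 / 2) ^ n * ρ n := by
  have hanti : Antitone ρ := antitone_nat_of_succ_le fun n => by linarith [hρ n, hρ0 n]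
  have hgeo : ∀ m y k, dist (U (m + k) y) (U (m + (k + 1)) y) ≤
      (1 / 2) ^ m * ρ m * (1 / 2) ^ k := by
    intro m y k
    rw [dist_comm, Real.dist_eq, ← add_assoc]
    refine (hU _ y).trans ?_
    have h1 : ρ (m + k) ≤ ρ m := hanti (Nat.le_add_right m k)
    calc (1 / 2 : ℝ) ^ (m + k) * ρ (m + k) ≤ (1 / 2) ^ (m + k) * ρ m := by gcongr
      _ = _ := by rw [pow_add]; ring
  have hlim : ∀ y, ∃ l, Tendsto (fun n => U n y) atTop (𝓝 l) := fun y =>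
    cauchySeq_tendsto_of_complete
      (cauchySeq_of_le_geometric (1 / 2) ((1 / 2) ^ 0 * ρ 0) (by norm_num) fun n => by
        simpa using hgeo 0 y n)
  choose w hw using hlim
  refine ⟨w, fun n y => ?_⟩
  have h1 : Tendsto (fun k => U (n + k) y) atTop (𝓝 (w y)) := by
    simpa only [add_comm n] using (tendsto_add_atTop_iff_nat n).2 (hw y)
  have h2 := dist_le_of_le_geometric_of_tendsto₀ _ _ (by norm_num) (hgeo n y) h1
  rw [dist_comm, Real.dist_eq] at h2
  refine h2.trans (le_of_eq ?_)
  ring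

section Limit

variable {X : Type*} [NormedAddCommGroup X] [NormedSpace ℝ X]

/-- Differentiability of a limit: the `n`-th approximation controls the increments of the limit
at scales between `ρ (n + 1)` and `ρ n`. -/
lemma hasFDerivAt_of_approximating_seq {U : ℕ → X → ℝ} {w : X → ℝ} {ρ e : ℕ → ℝ} {x : X}
    {A : X →L[ℝ] ℝ} (hρ0 : ∀ n, 0 < ρ n) (hρ : ∀ n, ρ (n + 1) ≤ ρ n / 2)
    (hw : ∀ n y, |w y - U n y| ≤ 2 * (1 / 2) ^ n * ρ n)
    (hdiff : ∀ n, Differentiable ℝ (U (n + 1) - U n))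
    (he : Tendsto e atTop (𝓝 0)) (hdiff_le : ∀ n y, ‖fderiv ℝ (U (n + 1) - U n) y‖ ≤ e n)
    (hosc : ∀ᶠ n in atTop, ∀ y ∈ closedBall x (ρ n), DifferentiableAt ℝ (U n) y ∧
      ‖fderiv ℝ (U n) y - fderiv ℝ (U n) x‖ ≤ (1 / 2) ^ n)
    (hA : Tendsto (fun n => fderiv ℝ (U n) x) atTop (𝓝 A)) : HasFDerivAt w A x := by
  have hpow : Tendsto (fun n : ℕ => (1 / 2 : ℝ) ^ n) atTop (𝓝 0) :=
    tendsto_pow_atTop_nhds_zero_of_lt_one (by norm_num) (by norm_num)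
  have herr : Tendsto (fun n => 3 * (1 / 2 : ℝ) ^ n + e n + ‖fderiv ℝ (U n) x - A‖) atTop (𝓝 0) := by
    simpa using ((hpow.const_mul 3).add he).add (tendsto_iff_norm_sub_tendsto_zero.1 hA)
  have hρgeo : ∀ n, ρ n ≤ ρ 0 * (1 / 2) ^ n := fun n => by
    induction n with
    | zero => simp
    | succ n ih => rw [pow_succ]; linarith [hρ n]
  have hρlim : Tendsto ρ atTop (𝓝 0) :=
    squeeze_zero (fun n => (hρ0 n).le) hρgeo (by simpa using hpow.const_mul (ρ 0))
  rw [hasFDerivAt_iff_isLittleO, Asymptotics.isLittleO_iff]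
  intro c hc
  obtain ⟨N, hN⟩ := eventually_atTop.1 ((herr.eventually (gt_mem_nhds hc)).and hosc)
  filter_upwards [closedBall_mem_nhds x (hρ0 N)] with y hy
  rcases eq_or_ne y x with rfl | hyx
  · simp
  have hyx0 : 0 < ‖y - x‖ := norm_pos_iff.2 (sub_ne_zero.2 hyx)
  have hex : ∃ m, ρ m < ‖y - x‖ := (hρlim.eventually (gt_mem_nhds hyx0)).exists
  have hanti : Antitone ρ := antitone_nat_of_succ_le fun n => by linarith [hρ n, hρ0 n]
  rw [mem_closedBall, dist_eq_norm] at hy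
  classical
  obtain ⟨n, hn⟩ : ∃ n, Nat.find hex = n + 1 := Nat.exists_eq_succ_of_ne_zero fun h => by
    have := Nat.find_spec hex
    rw [h] at this
    linarith [hanti (Nat.zero_le N)]
  have hn1 : ρ (n + 1) < ‖y - x‖ := hn ▸ Nat.find_spec hex
  have hn0 : ‖y - x‖ ≤ ρ n := not_lt.1 (Nat.find_min hex (by omega))
  have hNn : N ≤ n := by
    by_contra! h
    linarith [hanti (Nat.succ_le_of_lt h)]
  obtain ⟨herrn, hoscn⟩ := hN n hNn
  have hyb : y ∈ closedBall x (ρ n) := by rwa [mem_closedBall, dist_eq_norm]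
  have h1 := (convex_closedBall x (ρ n)).norm_image_sub_le_of_norm_fderiv_le' (𝕜 := ℝ)
    (fun z hz => (hoscn z hz).1) (fun z hz => (hoscn z hz).2)
    (mem_closedBall_self (hρ0 n).le) hyb
  have h2 := (convex_univ (𝕜 := ℝ)).norm_image_sub_le_of_norm_fderiv_le (𝕜 := ℝ) (x := x) (y := y)
    (fun z _ => hdiff n z) (fun z _ => hdiff_le n z) (mem_univ _) (mem_univ _)
  have h3 := hw (n + 1) y
  have h4 := hw (n + 1) x
  have h5 := (fderiv ℝ (U n) x - A).le_opNorm (y - x)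
  have h6 : (1 / 2 : ℝ) ^ (n + 1) * ρ (n + 1) ≤ (1 / 2) ^ n * ‖y - x‖ / 2 := by
    rw [pow_succ]
    have := mul_le_mul_of_nonneg_left hn1.le (by positivity : (0 : ℝ) ≤ (1 / 2) ^ n)
    linarith
  have h7 : w y - w x - A (y - x) = (U n y - U n x - fderiv ℝ (U n) x (y - x)) +
      ((U (n + 1) - U n) y - (U (n + 1) - U n) x) + (w y - U (n + 1) y) - (w x - U (n + 1) x) +
      (fderiv ℝ (U n) x - A) (y - x) := by
    simp only [Pi.sub_apply, _root_.sub_apply]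
    ring
  rw [Real.norm_eq_abs, abs_le] at h1 h2 h5
  rw [abs_le] at h3 h4
  have h8 := mul_le_mul_of_nonneg_right herrn.le hyx0.le
  rw [h7, Real.norm_eq_abs, abs_le]
  constructor <;> linarith

lemma abs_sub_le_of_norm_fderiv_le_one {w : X → ℝ} (hw : Continuous w) {x z : X} {a b : ℝ}
    (hab : a ≤ b) (hd : ∀ t ∈ Ioo a b, DifferentiableAt ℝ w (x + t • z) ∧
      ‖fderiv ℝ w (x + t • z)‖ ≤ 1) : |w (x + b • z) - w (x + a • z)| ≤ (b - a) * ‖z‖ := by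
  rcases hab.eq_or_lt with rfl | hab
  · simp
  obtain ⟨t, ht, hslope⟩ := exists_hasDerivAt_eq_slope (fun t : ℝ => w (x + t • z))
    (fun t => fderiv ℝ w (x + t • z) z) hab (by fun_prop) fun t ht => by
      have h1 : HasDerivAt (fun t : ℝ => x + t • z) z t := by
        simpa using ((hasDerivAt_id t).smul_const z).const_add x
      exact (hd t ht).1.hasFDerivAt.comp_hasDerivAt t h1
  have h2 := (fderiv ℝ w (x + t • z)).le_of_opNorm_le (hd t ht).2 z
  rw [eq_div_iff (by linarith)] at hslope
  rw [← hslope, abs_mul, abs_of_pos (by linarith : 0 < b - a), mul_comm]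
  rw [Real.norm_eq_abs, one_mul] at h2
  exact mul_le_mul_of_nonneg_left h2 (by linarith)

lemma abs_sub_le_norm_of_eqOn_compl {Ω : Set X} (hΩ : IsOpen Ω) {w v : X → ℝ} (hw : Continuous w)
    (hv : ∀ x y, |v x - v y| ≤ ‖x - y‖) (hwv : ∀ x ∉ Ω, w x = v x)
    (hd : ∀ x ∈ Ω, DifferentiableAt ℝ w x ∧ ‖fderiv ℝ w x‖ ≤ 1) (x y : X) :
    |w x - w y| ≤ ‖x - y‖ := by
  set z := y - x with hz
  set S := {t ∈ Icc (0 : ℝ) 1 | x + t • z ∉ Ω} with hS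
  have hSc : IsCompact S := isCompact_Icc.inter_right
    (hΩ.isClosed_compl.preimage (by fun_prop : Continuous fun t : ℝ => x + t • z))
  have hend : x + (1 : ℝ) • z = y := by simp [hz]
  rw [abs_sub_comm, norm_sub_rev, ← hz]
  rcases S.eq_empty_or_nonempty with hSe | hSne
  · have := abs_sub_le_of_norm_fderiv_le_one hw (x := x) (z := z) zero_le_one fun t ht => hd _ (by
      by_contra h
      exact hSe.subset ⟨Ioo_subset_Icc_self ht, h⟩)
    rwa [hend, zero_smul, add_zero, sub_zero, one_mul] at this
  · obtain ⟨⟨ht0, ht0Ω⟩, hmin⟩ := hSc.isLeast_sInf hSne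
    obtain ⟨⟨ht1, ht1Ω⟩, hmax⟩ := hSc.isGreatest_sSup hSne
    set t₀ := sInf S
    set t₁ := sSup S
    have h01 : t₀ ≤ t₁ := hmin ⟨ht1, ht1Ω⟩
    have h1 := abs_sub_le_of_norm_fderiv_le_one hw (x := x) (z := z) ht0.1 fun t ht => hd _ (by
      by_contra h
      linarith [hmin ⟨⟨ht.1.le, ht.2.le.trans ht0.2⟩, h⟩, ht.2])
    have h2 := abs_sub_le_of_norm_fderiv_le_one hw (x := x) (z := z) ht1.2 fun t ht => hd _ (by
      by_contra h
      linarith [hmax ⟨⟨ht1.1.trans ht.1.le, ht.2.le⟩, h⟩, ht.1])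
    have h3 := hv (x + t₁ • z) (x + t₀ • z)
    rw [← hwv _ ht0Ω, ← hwv _ ht1Ω, add_sub_add_left_eq_sub, ← sub_smul, norm_smul,
      Real.norm_eq_abs, abs_of_nonneg (sub_nonneg.2 h01)] at h3
    rw [hend] at h2
    rw [zero_smul, add_zero] at h1
    rw [abs_le] at h1 h2 h3 ⊢
    constructor <;> linarith

end Limit

lemma one_le_norm_limit_of_eventually {E : Type*} [NormedAddCommGroup E] {a : ℕ → E} {A : E}
    {M c : ℝ} {τ : ℕ → ℝ} (hc : 0 < c) (hτ0 : Tendsto τ atTop (𝓝 0)) (hτ : ∀ n, 0 < τ n)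
    (hτs : ¬ Summable fun n => τ n ^ 2) (ha : Tendsto a atTop (𝓝 A))
    (hs : Summable fun n => ‖a (n + 1) - a n‖ ^ 2)
    (h : ∀ᶠ n in atTop, c * τ n ≤ ‖a (n + 1) - a n‖ ∨ 1 - M * τ n ≤ ‖a n‖) : 1 ≤ ‖A‖ := by
  by_contra! hA
  have h1 : Tendsto (fun n => ‖a n‖ + M * τ n) atTop (𝓝 ‖A‖) := by
    simpa using ha.norm.add (hτ0.const_mul M)
  refine hτs ?_
  have h2 : Summable fun n => (c * τ n) ^ 2 := by
    refine hs.of_norm_bounded_eventually_nat ?_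
    filter_upwards [h, h1.eventually (gt_mem_nhds hA)] with n hn hn1
    have h3 : c * τ n ≤ ‖a (n + 1) - a n‖ := hn.resolve_right fun h4 => by linarith
    rw [Real.norm_eq_abs, abs_of_nonneg (sq_nonneg _)]
    exact pow_le_pow_left₀ (mul_pos hc (hτ n)).le h3 2
  simp only [mul_pow] at h2
  exact (summable_mul_left_iff (pow_ne_zero 2 hc.ne')).1 h2

lemma exists_exhaustion_isCompact {X : Type*} [PseudoMetricSpace X] [ProperSpace X] [Nonempty X]
    {Ω : Set X} (hΩ : IsOpen Ω) :
    ∃ K : ℕ → Set X, (∀ n, IsCompact (K n)) ∧ (∀ n, K n ⊆ Ω) ∧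
      ∀ x ∈ Ω, ∀ᶠ n in atTop, x ∈ K n := by
  obtain ⟨F, hFc, hFΩ, hFU, hFm⟩ := hΩ.exists_iUnion_isClosed
  obtain ⟨x₀⟩ := ‹Nonempty X›
  refine ⟨fun n => F n ∩ closedBall x₀ n,
    fun n => (isCompact_closedBall _ _).inter_left (hFc n),
    fun n => inter_subset_left.trans (hFΩ n), fun x hx => ?_⟩
  obtain ⟨m, hm⟩ := mem_iUnion.1 (hFU.symm.subset hx)
  filter_upwards [eventually_ge_atTop m,
    tendsto_natCast_atTop_atTop.eventually_ge_atTop (dist x x₀)] with n hn hn'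
  exact ⟨hFm hn hm, hn'⟩

/-- Approximation by almost classical solutions of the Eikonal equation: on an open subset
of a finite dimensional normed space of dimension ≥ 2, every 1-Lipschitz function `u₀` on the
closure with `lip(u₀, ∂Ω) < 1` can be uniformly approximated by differentiable 1-Lipschitz
functions `w` with `‖Dw‖_* = 1` a.e. on `Ω`, coinciding with `u₀` on `∂Ω`. -/
theorem stmt_5 {X : Type*} [NormedAddCommGroup X] [NormedSpace ℝ X] [FiniteDimensional ℝ X]
    [MeasurableSpace X] [BorelSpace X] (μ : Measure X) [μ.IsAddHaarMeasure]
    (hdim : 2 ≤ Module.finrank ℝ X)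
    (Ω : Set X) (hΩ : IsOpen Ω) (u₀ : X → ℝ)
    (hu₀ : IsLipschitzWithOn 1 u₀ (closure Ω))
    (hlt : lipOn u₀ (frontier Ω) < 1)
    (ε : ℝ) (hε : 0 < ε) :
    ∃ w : X → ℝ,
      IsLipschitzWithOn 1 w (closure Ω) ∧
      (∀ x ∈ Ω, DifferentiableAt ℝ w x) ∧
      (∀ᵐ x ∂(μ.restrict Ω), ‖fderiv ℝ w x‖ = 1) ∧
      (∀ x ∈ frontier Ω, w x = u₀ x) ∧
      (∀ x ∈ closure Ω, |u₀ x - w x| ≤ ε) := by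
  have : ProperSpace X := FiniteDimensional.proper_real X
  obtain ⟨u, v, hv, hu, huv, huC, hu1, huf, huε⟩ := exists_start hΩ hu₀ hlt hε
  obtain ⟨K, hK, hKΩ, hKev⟩ := exists_exhaustion_isCompact hΩ
  set τ : ℕ → ℝ := fun n => 1 / √(n + 1) with hτdef
  have hτ : ∀ n, 0 < τ n := fun n => by positivity
  have hτ0 : Tendsto τ atTop (𝓝 0) := by
    have := (tendsto_one_div_add_atTop_nhds_zero_nat (𝕜 := ℝ)).sqrt
    simpa [hτdef] using this
  have hτs : ¬ Summable fun n => τ n ^ 2 := by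
    intro h
    refine Real.not_summable_one_div_natCast ((summable_nat_add_iff 1).1 (h.congr fun n => ?_))
    rw [hτdef, div_pow, Real.sq_sqrt (by positivity), one_pow, Nat.cast_add_one]
  obtain ⟨M, c, U, ρ, hc, hU0, hρ0, hρδ, hρ, hUd, hU1, hUdiff, hUout, hUle, hosc, hUM, hsum,
    hμ⟩ := exists_approximating_seq μ hdim hΩ hK hKΩ huC hu1 hτ (by positivity : 0 < ε / 4)
  obtain ⟨w, hw⟩ := exists_limit_of_abs_sub_le hρ0 hρ hUle
  have hρanti : Antitone ρ := antitone_nat_of_succ_le fun n => by linarith [hρ n, hρ0 n]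
  have hbound : Tendsto (fun n : ℕ => 2 * (1 / 2 : ℝ) ^ n * ρ 0) atTop (𝓝 0) := by
    simpa using ((tendsto_pow_atTop_nhds_zero_of_lt_one (by norm_num : (0 : ℝ) ≤ 1 / 2)
      (by norm_num)).const_mul 2).mul_const (ρ 0)
  have hw' : ∀ n y, |w y - U n y| ≤ 2 * (1 / 2) ^ n * ρ 0 := fun n y =>
    (hw n y).trans (mul_le_mul_of_nonneg_left (hρanti (Nat.zero_le n)) (by positivity))
  have hUc : ∀ n, Continuous (U n) := fun n => by
    induction n with
    | zero => rwa [hU0]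
    | succ n ih => simpa using (hUdiff n).continuous.add ih
  have hwc : Continuous w := by
    refine TendstoUniformly.continuous (F := U) (p := atTop)
      (Metric.tendstoUniformly_iff.2 fun η hη => ?_) (Frequently.of_forall hUc)
    filter_upwards [hbound.eventually (gt_mem_nhds hη)] with n hn y
    exact (hw' n y).trans_lt hn
  have hUu : ∀ n, ∀ y ∉ Ω, U n y = u y := fun n y hy => by
    induction n with
    | zero => rw [hU0]
    | succ n ih => rw [hUout n y hy, ih]
  have hwu : ∀ y ∉ Ω, w y = u y := fun y hy => by
    refine sub_eq_zero.1 (abs_nonpos_iff.1 (ge_of_tendsto' hbound fun n => ?_))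
    rw [← hUu n y hy]
    exact hw' n y
  have hderiv : ∀ x ∈ Ω, Tendsto (fun n => fderiv ℝ (U n) x) atTop (𝓝 (fderiv ℝ w x)) ∧
      DifferentiableAt ℝ w x := fun x hx => by
    obtain ⟨A, hA⟩ := cauchySeq_tendsto_of_complete (hsum x hx).2
    have hd : HasFDerivAt w A x := by
      refine hasFDerivAt_of_approximating_seq hρ0 hρ hw hUdiff
        (by simpa using hτ0.const_mul M) hUM ?_ hA
      filter_upwards [hKev x hx] with n hn y hy
      exact ⟨hUd n y (hosc n x hn y hy).1, (hosc n x hn y hy).2⟩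
    exact ⟨hd.fderiv ▸ hA, hd.differentiableAt⟩
  have hle : ∀ x ∈ Ω, ‖fderiv ℝ w x‖ ≤ 1 := fun x hx =>
    le_of_tendsto' (hderiv x hx).1.norm fun n => (hU1 n x hx).le
  refine ⟨w, fun x _ y _ => ?_, fun x hx => (hderiv x hx).2, ?_, fun x hx => ?_, fun x hx => ?_⟩
  · rw [one_mul, dist_eq_norm]
    exact abs_sub_le_norm_of_eqOn_compl hΩ hwc hv (fun z hz => (hwu z hz).trans (huv z hz))
      (fun z hz => ⟨(hderiv z hz).2, hle z hz⟩) x y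
  · have hfin : ∑' n, μ {y ∈ K n | ¬ (c * τ n ≤ ‖fderiv ℝ (U (n + 1)) y - fderiv ℝ (U n) y‖ ∨
        1 - M * τ n ≤ ‖fderiv ℝ (U n) y‖)} ≠ ⊤ := by
      refine ne_top_of_le_ne_top ?_ (ENNReal.tsum_le_tsum hμ)
      exact summable_geometric_two.tsum_ofReal_ne_top
    filter_upwards [ae_restrict_of_ae (ae_eventually_notMem hfin),
      ae_restrict_mem hΩ.measurableSet] with x hx hxΩ
    refine le_antisymm (hle x hxΩ) ?_
    refine one_le_norm_limit_of_eventually (M := M) hc hτ0 hτ hτs (hderiv x hxΩ).1 (hsum x hxΩ).1 ?_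
    filter_upwards [hx, hKev x hxΩ] with n hn hnK
    by_contra h
    exact hn ⟨hnK, h⟩
  · have hxΩ : x ∉ Ω := (hΩ.frontier_eq ▸ hx).2
    rw [hwu x hxΩ, huf x hx]
  · have h1 := huε x hx
    have h2 := hw 0 x
    rw [hU0, pow_zero, mul_one] at h2
    rw [abs_le] at h1 h2 ⊢
    constructor <;> linarith
end

section
/- Let k ∈ ℕ ∪ {∞} and let X be a Banach space with the property that for every Lipschitz function f : X → ℝ and every η > 0 there exists a function g : X → ℝ of class C^k on X such that |f − g| ≤ η on X and lip(g, B(x₀,r)) ≤ lip(f, B(x₀, r+η)) + η for every closed ball B(x₀,r) ⊂ X. Let Ω ⊂ X be open, let u : Ω → ℝ be Lipschitz, and let ε : Ω → (0,+∞) be continuous. Then there exists v : Ω → ℝ of class C^k on Ω such that (1) |u(x) − v(x)| ≤ ε(x) for all x ∈ Ω, and (2) ‖Dv(x)‖_* ≤ lip(u, B(x, ε(x)) ∩ Ω) + ε(x) for all x ∈ Ω. -/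
open Metric Set MeasureTheory

theorem lipOn_le_of_subset {X : Type*} [PseudoMetricSpace X] {f g : X → ℝ} {s t : Set X}
    {K : ℝ} (hst : s ⊆ t) (hfg : EqOn f g s) (hg : IsLipschitzWithOn K g t) :
    lipOn f s ≤ lipOn g t := by
  refine csInf_le_csInf ⟨0, fun L hL => hL.1.le⟩
    ⟨max K 1, lt_of_lt_of_le one_pos (le_max_right _ _), fun x hx y hy =>
      (hg x hx y hy).trans (by gcongr; exact le_max_left _ _)⟩ ?_
  rintro L ⟨hL, h⟩
  refine ⟨hL, fun x hx y hy => ?_⟩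
  rw [hfg hx, hfg hy]
  exact h x (hst hx) y (hst hy)

theorem lipOn_le {X : Type*} [PseudoMetricSpace X] {f : X → ℝ} {s : Set X} {K : ℝ}
    (hK : 0 < K) (hf : IsLipschitzWithOn K f s) : lipOn f s ≤ K :=
  csInf_le ⟨0, fun _ hL => hL.1.le⟩ ⟨hK, hf⟩

theorem norm_fderiv_le_lipOn {X : Type*} [NormedAddCommGroup X] [NormedSpace ℝ X]
    {g : X → ℝ} {x : X} {s : Set X} {K : ℝ} (hs : s ∈ nhds x)
    (hg : IsLipschitzWithOn K g s) : ‖fderiv ℝ g x‖ ≤ lipOn g s := by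
  refine le_csInf ⟨max K 1, lt_of_lt_of_le one_pos (le_max_right _ _), fun y hy z hz =>
      (hg y hy z hz).trans (by gcongr; exact le_max_left _ _)⟩ ?_
  rintro L ⟨hL, h⟩
  lift L to NNReal using hL.le
  refine norm_fderiv_le_of_lipschitzOn ℝ hs (C := L) (LipschitzOnWith.of_dist_le_mul ?_)
  intro y hy z hz
  rw [Real.dist_eq]
  exact h y hy z hz

theorem exists_deriv_smoothTransition_bound :
    ∃ C : ℝ, 0 ≤ C ∧ ∀ t, |deriv Real.smoothTransition t| ≤ C := by
  have hcont : Continuous (deriv Real.smoothTransition) :=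
    (Real.smoothTransition.contDiff (n := 1)).continuous_deriv le_rfl
  obtain ⟨C, hC⟩ := isCompact_Icc.exists_bound_of_continuousOn
    (s := Icc (0 : ℝ) 1) hcont.continuousOn
  have hC0 : 0 ≤ C := (norm_nonneg _).trans (hC 0 (by simp))
  refine ⟨C, hC0, fun t => ?_⟩
  rcases lt_or_ge t 0 with ht | ht
  · have : Real.smoothTransition =ᶠ[nhds t] fun _ => 0 := by
      filter_upwards [Iio_mem_nhds ht] with y hy
      exact Real.smoothTransition.zero_of_nonpos (le_of_lt hy)
    rw [this.deriv_eq]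
    simpa using hC0
  rcases lt_or_ge 1 t with ht' | ht'
  · have : Real.smoothTransition =ᶠ[nhds t] fun _ => 1 := by
      filter_upwards [Ioi_mem_nhds ht'] with y hy
      exact Real.smoothTransition.one_of_one_le (le_of_lt hy)
    rw [this.deriv_eq]
    simpa using hC0
  · exact hC t ⟨ht, ht'⟩

/-- A `1`-Lipschitz function that is positive on the open set `Ω`, bounded there by `ε`, and
bounded by the distance to the complement of `Ω`. -/
theorem exists_lipschitz_radius {X : Type*} [PseudoMetricSpace X] {Ω : Set X} (hΩ : IsOpen Ω)
    {ε : X → ℝ} (hεpos : ∀ x ∈ Ω, 0 < ε x) (hεcont : ContinuousOn ε Ω) :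
    ∃ δ : X → ℝ, IsLipschitzWithOn 1 δ univ ∧ (∀ x ∈ Ω, 0 < δ x ∧ δ x ≤ ε x) ∧
      ∀ x y, dist y x < δ x → y ∈ Ω := by
  let H : Set (X × ℝ) := {p | p.1 ∈ Ω ∧ |p.2| < ε p.1}
  have hH : IsOpen H := by
    have h1 : ContinuousOn (fun p : X × ℝ => ε p.1 - |p.2|) (Ω ×ˢ univ) :=
      (hεcont.comp continuousOn_fst fun p hp => hp.1).sub (by fun_prop)
    have h2 := h1.isOpen_inter_preimage (hΩ.prod isOpen_univ) (isOpen_Ioi (a := (0 : ℝ)))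
    convert h2 using 1
    ext p
    simp [H]
  have hmem : ∀ x, (x, ε x) ∈ Hᶜ := fun x hx => (le_abs_self (ε x)).not_gt hx.2
  refine ⟨fun x => infDist (x, (0 : ℝ)) Hᶜ, ?_, ?_, ?_⟩
  · intro x _ y _
    have := (lipschitz_infDist_pt Hᶜ).dist_le_mul (x, (0 : ℝ)) (y, (0 : ℝ))
    simpa [Real.dist_eq, Prod.dist_eq] using this
  · intro x hx
    constructor
    · rw [← hH.isClosed_compl.notMem_iff_infDist_pos ⟨_, hmem x⟩]
      exact fun h => h ⟨hx, by simpa using hεpos x hx⟩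
    · refine (infDist_le_dist_of_mem (hmem x)).trans ?_
      simp [Prod.dist_eq, Real.dist_eq, abs_of_pos (hεpos x hx), (hεpos x hx).le]
  · intro x y hxy
    by_contra hy
    have hyc : (y, (0 : ℝ)) ∈ Hᶜ := fun h => hy h.1
    have := infDist_le_dist_of_mem (x := (x, (0 : ℝ))) hyc
    rw [Prod.dist_eq, dist_comm x y] at this
    simp only [dist_self, dist_nonneg, sup_of_le_left] at this
    linarith

/-- Every Lipschitz function is uniformly approximated by `C^k` functions whose Lipschitz constants
on balls do not exceed those of the function by much. -/
def HasLipApprox (k : ℕ∞) (X : Type*) [NormedAddCommGroup X] [NormedSpace ℝ X] : Prop :=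
  ∀ f : X → ℝ, (∃ K : ℝ, IsLipschitzWithOn K f Set.univ) → ∀ η : ℝ, 0 < η →
    ∃ g : X → ℝ, ContDiff ℝ k g ∧ (∀ x : X, |f x - g x| ≤ η) ∧
      ∀ (x₀ : X) (r : ℝ), 0 < r →
        lipOn g (closedBall x₀ r) ≤ lipOn f (closedBall x₀ (r + η)) + η

section

variable {k : ℕ∞} {X : Type*} [NormedAddCommGroup X] [NormedSpace ℝ X]

theorem HasLipApprox.exists_fderiv_le (hX : HasLipApprox k X) (hk : 1 ≤ k) {f : X → ℝ} {K : ℝ}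
    (hf : IsLipschitzWithOn K f univ) {η : ℝ} (hη : 0 < η) :
    ∃ g : X → ℝ, ContDiff ℝ k g ∧ (∀ x : X, |f x - g x| ≤ η) ∧
      ∀ x, ‖fderiv ℝ g x‖ ≤ lipOn f (closedBall x (2 * η)) + η := by
  obtain ⟨g, hgk, hfg, hlip⟩ := hX f ⟨K, hf⟩ η hη
  refine ⟨g, hgk, hfg, fun x => ?_⟩
  have hg1 : ContDiffAt ℝ 1 g x := (hgk.of_le (by exact_mod_cast hk)).contDiffAt
  obtain ⟨C, t, ht, hC⟩ := hg1.exists_lipschitzOnWith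
  obtain ⟨r, hr, hrt⟩ := nhds_basis_closedBall.mem_iff.1 ht
  have hm : 0 < min r η := lt_min hr hη
  have hgC : IsLipschitzWithOn C g (closedBall x (min r η)) := fun y hy z hz => by
    rw [← Real.dist_eq]
    exact hC.dist_le_mul y (hrt (closedBall_subset_closedBall (min_le_left _ _) hy)) z
      (hrt (closedBall_subset_closedBall (min_le_left _ _) hz))
  calc ‖fderiv ℝ g x‖ ≤ lipOn g (closedBall x (min r η)) :=
        norm_fderiv_le_lipOn (closedBall_mem_nhds x hm) hgC
    _ ≤ lipOn f (closedBall x (min r η + η)) + η := hlip x _ hm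
    _ ≤ lipOn f (closedBall x (2 * η)) + η := by
        gcongr
        refine lipOn_le_of_subset (closedBall_subset_closedBall ?_) (fun _ _ => rfl)
          (K := K) fun y _ z _ => hf y trivial z trivial
        linarith [min_le_right r η]

/-- Smooth cutoffs adapted to the level sets of a `1`-Lipschitz function, at every scale `s`, with
derivatives of order `1 / s`. -/
theorem HasLipApprox.exists_cutoff (hX : HasLipApprox k X) (hk : 1 ≤ k) {δ : X → ℝ}
    (hδ : IsLipschitzWithOn 1 δ univ) :
    ∃ M : ℝ, 0 ≤ M ∧ ∀ s : ℝ, 0 < s → s ≤ 1 → ∃ ψ : X → ℝ, ContDiff ℝ k ψ ∧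
      (∀ x, 0 ≤ ψ x ∧ ψ x ≤ 1) ∧ (∀ x, 4 * s ≤ δ x → ψ x = 1) ∧ (∀ x, δ x ≤ s → ψ x = 0) ∧
      ∀ x, ‖fderiv ℝ ψ x‖ ≤ M / s := by
  obtain ⟨C, hC0, hC⟩ := exists_deriv_smoothTransition_bound
  refine ⟨2 * C, by positivity, fun s hs hs1 => ?_⟩
  obtain ⟨h, hhk, hδh, hh⟩ := hX.exists_fderiv_le hk hδ hs
  have hh2 : ∀ x, ‖fderiv ℝ h x‖ ≤ 2 := fun x => by
    have := lipOn_le one_pos (s := closedBall x (2 * s)) (f := δ)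
      fun y _ z _ => hδ y trivial z trivial
    linarith [hh x]
  have hk0 : (k : WithTop ℕ∞) ≠ 0 := by
    have : k ≠ 0 := (zero_lt_one.trans_le hk).ne'
    exact_mod_cast this
  refine ⟨fun x => Real.smoothTransition (s⁻¹ * (h x - 2 * s)),
    Real.smoothTransition.contDiff.comp (contDiff_const.mul (hhk.sub contDiff_const)),
    fun x => ⟨Real.smoothTransition.nonneg _, Real.smoothTransition.le_one _⟩,
    fun x hx => Real.smoothTransition.one_of_one_le ?_,
    fun x hx => Real.smoothTransition.zero_of_nonpos ?_, fun x => ?_⟩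
  · have := (abs_le.1 (hδh x)).2
    rw [inv_mul_eq_div, le_div_iff₀ hs]
    linarith
  · have := (abs_le.1 (hδh x)).1
    exact mul_nonpos_of_nonneg_of_nonpos (inv_nonneg.2 hs.le) (by linarith)
  · have h1 : HasFDerivAt (fun x => s⁻¹ * (h x - 2 * s)) (s⁻¹ • fderiv ℝ h x) x :=
      (((hhk.differentiable hk0) x).hasFDerivAt.sub_const _).const_mul _
    have h2 : HasDerivAt Real.smoothTransition
        (deriv Real.smoothTransition (s⁻¹ * (h x - 2 * s))) (s⁻¹ * (h x - 2 * s)) :=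
      ((Real.smoothTransition.contDiff (n := 1)).differentiable one_ne_zero _).hasDerivAt
    have h3 := h2.comp_hasFDerivAt x h1
    have h4 := h3.fderiv
    simp only [Function.comp_def] at h4
    rw [h4, norm_smul, norm_smul, Real.norm_eq_abs, norm_inv, Real.norm_of_nonneg hs.le]
    calc _ ≤ C * (s⁻¹ * 2) := by
          gcongr
          · exact hC _
          · exact hh2 x
      _ = 2 * C / s := by ring

end

/-- Telescoping: if the weights `ψ j` vanish for `j < n` and equal `1` for `j > n`, only `g n` and
`g (n + 1)` contribute to the glued value. -/
theorem glue_eq {ψ g : ℕ → ℝ} {n : ℕ} (h0 : ∀ j < n, ψ j = 0) (h1 : ∀ j, n < j → ψ j = 1) :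
    g 0 + ∑' j, (1 - ψ j) * (g (j + 1) - g j) = g (n + 1) + ψ n * (g n - g (n + 1)) := by
  rw [tsum_eq_sum (s := Finset.range (n + 1)) fun j hj => by
    rw [h1 j (by simpa using hj)]; ring, Finset.sum_range_succ,
    Finset.sum_congr rfl fun j hj => by
      rw [h0 j (Finset.mem_range.1 hj), sub_zero, one_mul], Finset.sum_range_sub]
  ring

theorem norm_fderiv_add_mul_sub_le {X : Type*} [NormedAddCommGroup X] [NormedSpace ℝ X]
    {a b ψ : X → ℝ} {x : X} {A B : ℝ} (ha : DifferentiableAt ℝ a x)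
    (hb : DifferentiableAt ℝ b x) (hψ : DifferentiableAt ℝ ψ x) (h0 : 0 ≤ ψ x) (h1 : ψ x ≤ 1)
    (haA : ‖fderiv ℝ a x‖ ≤ A) (hbA : ‖fderiv ℝ b x‖ ≤ A)
    (hB : ‖fderiv ℝ ψ x‖ * |a x - b x| ≤ B) :
    ‖fderiv ℝ (fun y => b y + ψ y * (a y - b y)) x‖ ≤ A + B := by
  have h := hb.hasFDerivAt.add (hψ.hasFDerivAt.mul (ha.hasFDerivAt.sub hb.hasFDerivAt))
  have h' : fderiv ℝ (fun y => b y + ψ y * (a y - b y)) x = ψ x • fderiv ℝ a x +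
      (1 - ψ x) • fderiv ℝ b x + (a x - b x) • fderiv ℝ ψ x := by
    refine h.fderiv.trans ?_
    simp only [Pi.sub_apply]
    module
  rw [h']
  refine (norm_add₃_le).trans ?_
  rw [norm_smul, norm_smul, norm_smul, Real.norm_of_nonneg h0,
    Real.norm_of_nonneg (sub_nonneg.2 h1), Real.norm_eq_abs]
  have e1 := mul_le_mul_of_nonneg_left haA h0
  have e2 := mul_le_mul_of_nonneg_left hbA (sub_nonneg.2 h1)
  linarith

/-- Claim 1: `C^0`-fine approximation of a Lipschitz function on an open set `Ω` of a suitable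
Banach space by `C^k` functions whose derivative is controlled by local Lipschitz constants. -/
theorem stmt_8 (k : ℕ∞) (hk : 1 ≤ k)
    {X : Type*} [NormedAddCommGroup X] [NormedSpace ℝ X] [CompleteSpace X]
    (hX : ∀ f : X → ℝ, (∃ K : ℝ, IsLipschitzWithOn K f Set.univ) → ∀ η : ℝ, 0 < η →
      ∃ g : X → ℝ, ContDiff ℝ k g ∧ (∀ x : X, |f x - g x| ≤ η) ∧
        ∀ (x₀ : X) (r : ℝ), 0 < r →
          lipOn g (closedBall x₀ r) ≤ lipOn f (closedBall x₀ (r + η)) + η)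
    (Ω : Set X) (hΩ : IsOpen Ω) (u : X → ℝ)
    (hu : ∃ K : ℝ, IsLipschitzWithOn K u Ω)
    (ε : X → ℝ) (hεpos : ∀ x ∈ Ω, 0 < ε x) (hεcont : ContinuousOn ε Ω) :
    ∃ v : X → ℝ,
      ContDiffOn ℝ k v Ω ∧
      (∀ x ∈ Ω, |u x - v x| ≤ ε x) ∧
      (∀ x ∈ Ω, ‖fderiv ℝ v x‖ ≤ lipOn u (closedBall x (ε x) ∩ Ω) + ε x) := by
  obtain ⟨K, hK⟩ := hu
  have hext : ∃ U : X → ℝ, IsLipschitzWithOn |K| U univ ∧ EqOn u U Ω := by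
    have : LipschitzOnWith K.nnabs u Ω := LipschitzOnWith.of_dist_le_mul fun x hx y hy => by
      rw [Real.dist_eq]
      refine (hK x hx y hy).trans ?_
      gcongr
      simpa using le_abs_self K
    obtain ⟨U, hU, hUu⟩ := this.extend_real
    refine ⟨U, fun x _ y _ => ?_, hUu⟩
    simpa [Real.dist_eq] using hU.dist_le_mul x y
  obtain ⟨U, hU, hUu⟩ := hext
  obtain ⟨δ, hδ, hδε, hδΩ⟩ := exists_lipschitz_radius hΩ hεpos hεcont
  have hδcont : Continuous δ :=
    (LipschitzWith.of_dist_le_mul (K := 1) fun x y => by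
      simpa [Real.dist_eq] using hδ x trivial y trivial).continuous
  obtain ⟨M, hM, hcut⟩ := HasLipApprox.exists_cutoff hX hk hδ
  let s : ℕ → ℝ := fun n => (1 / 8) ^ n
  have hs : ∀ n, 0 < s n := fun n => by positivity
  have hs1 : ∀ n, s n ≤ 1 := fun n => pow_le_one₀ (by norm_num) (by norm_num)
  have hsucc : ∀ n, s (n + 1) = s n / 8 := fun n => by simp only [s, pow_succ]; ring
  have hsanti : Antitone s := antitone_nat_of_succ_le fun n => by
    rw [hsucc]; linarith [hs n]
  let η : ℕ → ℝ := fun n => s n ^ 2 / (16 * (1 + M))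
  have hη : ∀ n, 0 < η n := fun n => by have := hs n; positivity
  have hηanti : ∀ n, η (n + 1) ≤ η n := fun n => by
    have := (hs (n + 1)).le
    simp only [η]
    gcongr
    exact hsanti n.le_succ
  have hηM : ∀ n, η n * (1 + M) ≤ s n / 16 := fun n => by
    have h1 : η n * (1 + M) = s n * s n / 16 := by simp only [η]; field_simp
    nlinarith [hs n, hs1 n]
  have hηs : ∀ n, η n ≤ s n / 16 := fun n => by nlinarith [hη n, hηM n]
  choose ψ hψk hψ01 hψ1 hψ0 hψM using fun n => hcut (s n) (hs n) (hs1 n)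
  choose g hgk hgU hgD using fun n => HasLipApprox.exists_fderiv_le hX hk hU (hη n)
  have hk0 : (k : WithTop ℕ∞) ≠ 0 := by
    have : k ≠ 0 := (zero_lt_one.trans_le hk).ne'
    exact_mod_cast this
  let v : X → ℝ := fun x => g 0 x + ∑' j, (1 - ψ j x) * (g (j + 1) x - g j x)
  have hloc : ∀ x ∈ Ω, ∃ n, s n / 2 < δ x ∧
      v =ᶠ[nhds x] fun y => g (n + 1) y + ψ n y * (g n y - g (n + 1) y) := by
    intro x hx
    have hex : ∃ n, s n / 2 < δ x := by
      obtain ⟨n, hn⟩ := exists_pow_lt_of_lt_one (hδε x hx).1 (by norm_num : (1 / 8 : ℝ) < 1)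
      exact ⟨n, by have := hs n; simp only [s] at this ⊢; linarith⟩
    classical
    let n := Nat.find hex
    have hn : s n / 2 < δ x := Nat.find_spec hex
    have hlow : ∀ᶠ y in nhds x, s n / 2 < δ y := hδcont.continuousAt.eventually_const_lt hn
    have hupp : ∀ᶠ y in nhds x, ∀ j < n, δ y < s j := by
      refine (Filter.eventually_all_finite (Set.finite_lt_nat n)).2 fun j hj => ?_
      refine hδcont.continuousAt.eventually_lt_const ?_
      have := not_lt.1 (Nat.find_min hex hj)
      linarith [hs j]
    refine ⟨n, hn, ?_⟩
    filter_upwards [hlow, hupp] with y hy1 hy2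
    refine glue_eq (ψ := fun j => ψ j y) (g := fun j => g j y)
      (fun j hj => hψ0 j y (hy2 j hj).le) fun j hj => hψ1 j y ?_
    have := hsanti (Nat.succ_le_of_lt hj)
    rw [Nat.succ_eq_add_one, hsucc] at this
    linarith
  refine ⟨v, fun x hx => ?_, fun x hx => ?_, fun x hx => ?_⟩
  · obtain ⟨n, -, hv⟩ := hloc x hx
    refine (ContDiffAt.congr_of_eventuallyEq ?_ hv).contDiffWithinAt
    exact ((hgk (n + 1)).add ((hψk n).mul ((hgk n).sub (hgk (n + 1))))).contDiffAt
  · obtain ⟨n, hn, hv⟩ := hloc x hx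
    have h1 := abs_le.1 (hgU n x)
    have h2 := abs_le.1 (hgU (n + 1) x)
    have h01 := hψ01 n x
    have h3 := hηanti n
    have h4 : η n ≤ ε x := by linarith [hηs n, hs n, (hδε x hx).2]
    rw [hv.eq_of_nhds, hUu hx, abs_le]
    constructor <;> nlinarith
  · obtain ⟨n, hn, hv⟩ := hloc x hx
    have hD : ∀ m, η m ≤ η n →
        ‖fderiv ℝ (g m) x‖ ≤ lipOn u (closedBall x (ε x) ∩ Ω) + η n := fun m hm => by
      refine (hgD m x).trans (add_le_add ?_ hm)
      have hball : closedBall x (2 * η m) ⊆ closedBall x (ε x) ∩ Ω := fun y hy => by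
        have hyx : dist y x < δ x := by
          have := mem_closedBall.1 hy
          linarith [hηs n, hs n]
        exact ⟨mem_closedBall.2 (hyx.le.trans (hδε x hx).2), hδΩ x y hyx⟩
      exact lipOn_le_of_subset hball (fun y hy => (hUu (hball hy).2).symm)
        (K := K) fun y hy z hz => hK y hy.2 z hz.2
    have hdiff : ‖fderiv ℝ (ψ n) x‖ * |g n x - g (n + 1) x| ≤ s n / 8 := by
      have h1 : |g n x - g (n + 1) x| ≤ 2 * η n := by
        have h1 := abs_le.1 (hgU n x)
        have h2 := abs_le.1 (hgU (n + 1) x)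
        have h3 := hηanti n
        rw [abs_le]
        constructor <;> linarith
      have hsn := hs n
      calc _ ≤ M / s n * (2 * η n) := by
            gcongr
            exact hψM n x
        _ = s n / 8 * (M / (1 + M)) := by simp only [η]; field_simp; ring
        _ ≤ s n / 8 * 1 := by
            gcongr
            rw [div_le_one (by positivity)]
            linarith
        _ = s n / 8 := mul_one _
    rw [hv.fderiv_eq]
    have := norm_fderiv_add_mul_sub_le ((hgk n).differentiable hk0 x)
      ((hgk (n + 1)).differentiable hk0 x) ((hψk n).differentiable hk0 x)
      (hψ01 n x).1 (hψ01 n x).2 (hD n le_rfl) (hD (n + 1) (hηanti n)) hdiff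
    linarith [hηs n, hs n, (hδε x hx).2]
end

section
/- Let X be a separable Hilbert space, let f : X → ℝ be a K-Lipschitz function and let ε > 0. Then there exists a function g : X → ℝ of class C^∞ such that |g − f| ≤ ε on X and lip(g, B(x₀,r)) ≤ lip(f, B(x₀, r+ε)) + ε for every closed ball B(x₀,r) ⊂ X. -/
open Metric Set MeasureTheory

open scoped NNReal Topology

theorem LipschitzWith.abs_sub_apply_sub_le {X : Type*} [NormedAddCommGroup X] {K : ℝ≥0}
    {h : X → ℝ} {δ : ℝ} (hh : LipschitzWith K h) (x v : X) (hv : ‖v‖ ≤ δ) :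
    |h (x - v) - h x| ≤ K * δ := by
  have h1 := hh.dist_le_mul (x - v) x
  rw [Real.dist_eq, dist_eq_norm, sub_sub_cancel_left, norm_neg] at h1
  exact h1.trans (by gcongr)

section Averaging

variable {X : Type*} [NormedAddCommGroup X] [MeasurableSpace X]

/-- The average of the translates `x ↦ h (x - v)` with respect to `μ`. -/
noncomputable def translateAvg (μ : Measure X) (h : X → ℝ) (x : X) : ℝ :=
  ∫ v, h (x - v) ∂μ

variable [BorelSpace X] {K : ℝ≥0} {h h' : X → ℝ} {μ ν : Measure X}
  [IsProbabilityMeasure μ] [IsProbabilityMeasure ν] {δ δ' : ℝ}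

theorem LipschitzWith.integrable_translate (hh : LipschitzWith K h)
    (hμ : ∀ᵐ v ∂μ, ‖v‖ ≤ δ) (x : X) : Integrable (fun v => h (x - v)) μ := by
  refine Integrable.of_bound (C := |h x| + K * δ)
    (hh.continuous.comp (continuous_const.sub continuous_id)).aestronglyMeasurable ?_
  filter_upwards [hμ] with v hv
  have h1 := hh.abs_sub_apply_sub_le x v hv
  have h2 := abs_sub_abs_le_abs_sub (h (x - v)) (h x)
  rw [Real.norm_eq_abs]
  linarith

theorem abs_translateAvg_sub_le {C : ℝ} {x y : X} (hh : LipschitzWith K h)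
    (hh' : LipschitzWith K h') (hμ : ∀ᵐ v ∂μ, ‖v‖ ≤ δ)
    (hC : ∀ v, ‖v‖ ≤ δ → |h (x - v) - h' (y - v)| ≤ C) :
    |translateAvg μ h x - translateAvg μ h' y| ≤ C := by
  rw [translateAvg, translateAvg,
    ← integral_sub (hh.integrable_translate hμ x) (hh'.integrable_translate hμ y)]
  have := norm_integral_le_of_norm_le_const (μ := μ) (C := C)
    (f := fun v => h (x - v) - h' (y - v)) (hμ.mono fun v hv => hC v hv)
  simpa using this

theorem abs_translateAvg_sub_self_le (hh : LipschitzWith K h) (hμ : ∀ᵐ v ∂μ, ‖v‖ ≤ δ) (x : X) :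
    |translateAvg μ h x - h x| ≤ K * δ := by
  have h1 : h x = ∫ _, h x ∂μ := by simp
  rw [h1, translateAvg, ← integral_sub (hh.integrable_translate hμ x) (integrable_const _)]
  have := norm_integral_le_of_norm_le_const (μ := μ) (C := K * δ)
    (f := fun v => h (x - v) - h x) (hμ.mono fun v hv => hh.abs_sub_apply_sub_le x v hv)
  simpa using this

theorem LipschitzWith.translateAvg (hh : LipschitzWith K h) (hμ : ∀ᵐ v ∂μ, ‖v‖ ≤ δ) :
    LipschitzWith K (translateAvg μ h) :=
  LipschitzWith.of_dist_le_mul fun x y => abs_translateAvg_sub_le hh hh hμ fun v _ => by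
    simpa [Real.dist_eq] using hh.dist_le_mul (x - v) (y - v)

theorem translateAvg_comm [SecondCountableTopology X] (hh : LipschitzWith K h)
    (hμ : ∀ᵐ v ∂μ, ‖v‖ ≤ δ) (hν : ∀ᵐ v ∂ν, ‖v‖ ≤ δ') :
    _root_.translateAvg μ (_root_.translateAvg ν h)
      = _root_.translateAvg ν (_root_.translateAvg μ h) := by
  ext x
  unfold _root_.translateAvg
  rw [integral_integral_swap]
  · simp only [sub_right_comm]
  · refine Integrable.of_bound (C := |h x| + K * (δ + δ')) ?_ ?_
    · exact (hh.continuous.comp (by fun_prop :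
        Continuous fun p : X × X => x - p.1 - p.2)).aestronglyMeasurable
    · filter_upwards [Measure.quasiMeasurePreserving_fst.ae hμ,
        Measure.quasiMeasurePreserving_snd.ae hν] with p hp hp'
      have h1 := hh.abs_sub_apply_sub_le x (p.1 + p.2) ((norm_add_le _ _).trans (add_le_add hp hp'))
      have h2 := abs_sub_abs_le_abs_sub (h (x - (p.1 + p.2))) (h x)
      rw [Real.norm_eq_abs, Function.uncurry, sub_sub]
      linarith

/-- The iterated averages of `h` with respect to `μ 0, μ 1, …`. -/
noncomputable def iterTranslateAvg (μ : ℕ → Measure X) (h : X → ℝ) : ℕ → X → ℝ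
  | 0 => h
  | k + 1 => _root_.translateAvg (μ k) (iterTranslateAvg μ h k)

section Iterate

variable {μ : ℕ → Measure X} [∀ k, IsProbabilityMeasure (μ k)]

theorem LipschitzWith.iterTranslateAvg {d : ℕ → ℝ} (hh : LipschitzWith K h)
    (hμ : ∀ k, ∀ᵐ v ∂μ k, ‖v‖ ≤ d k) (k : ℕ) : LipschitzWith K (iterTranslateAvg μ h k) := by
  induction k with
  | zero => exact hh
  | succ k ih => exact ih.translateAvg (hμ k)

theorem abs_iterTranslateAvg_sub_le {d : ℕ → ℝ} (hh : LipschitzWith K h)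
    (hμ : ∀ k, ∀ᵐ v ∂μ k, ‖v‖ ≤ d k) {L r : ℝ} {x₀ : X} (k : ℕ)
    (hL : ∀ x ∈ closedBall x₀ (r + ∑ i ∈ Finset.range k, d i),
      ∀ y ∈ closedBall x₀ (r + ∑ i ∈ Finset.range k, d i), |h x - h y| ≤ L * dist x y) :
    ∀ x ∈ closedBall x₀ r, ∀ y ∈ closedBall x₀ r,
      |iterTranslateAvg μ h k x - iterTranslateAvg μ h k y| ≤ L * dist x y := by
  induction k generalizing r with
  | zero => simpa [iterTranslateAvg] using hL
  | succ k ih =>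
    intro x hx y hy
    have hk := hh.iterTranslateAvg hμ k
    refine abs_translateAvg_sub_le hk hk (hμ k) fun v hv => ?_
    have hmem : ∀ z ∈ closedBall x₀ r, z - v ∈ closedBall x₀ (r + d k) := by
      intro z hz
      rw [mem_closedBall, dist_eq_norm] at hz ⊢
      calc ‖z - v - x₀‖ = ‖(z - x₀) - v‖ := by congr 1; abel
        _ ≤ ‖z - x₀‖ + ‖v‖ := norm_sub_le _ _
        _ ≤ r + d k := add_le_add hz hv
    have := ih (r := r + d k) (by
      rw [add_assoc, add_comm (d k), ← Finset.sum_range_succ]; exact hL) _ (hmem x hx) _ (hmem y hy)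
    simpa using this

theorem exists_tendsto_iterTranslateAvg (hh : LipschitzWith K h)
    (hμ : ∀ k, ∀ᵐ v ∂μ k, ‖v‖ ≤ δ / 2 / 2 ^ k) :
    ∃ F : X → ℝ, (∀ x, Filter.Tendsto (fun k => iterTranslateAvg μ h k x) Filter.atTop (𝓝 (F x))) ∧
      ∀ x k, |iterTranslateAvg μ h k x - F x| ≤ K * δ / 2 ^ k := by
  have hd : ∀ x k, dist (iterTranslateAvg μ h k x) (iterTranslateAvg μ h (k + 1) x)
      ≤ K * δ / 2 / 2 ^ k := by
    intro x k
    rw [dist_comm, Real.dist_eq]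
    refine (abs_translateAvg_sub_self_le (hh.iterTranslateAvg hμ k) (hμ k) x).trans (le_of_eq ?_)
    ring
  choose F hF using fun x => cauchySeq_tendsto_of_complete (cauchySeq_of_le_geometric_two (hd x))
  exact ⟨F, hF, fun x k => dist_le_of_le_geometric_two_of_tendsto (hd x) (hF x) k⟩

/-- Every factor of an infinite composition of averages may be performed last. -/
theorem exists_eq_translateAvg_of_tendsto [SecondCountableTopology X]
    (hh : LipschitzWith K h) (hδ : 0 ≤ δ)
    (hμ : ∀ k, ∀ᵐ v ∂μ k, ‖v‖ ≤ δ / 2 / 2 ^ k) {F : X → ℝ}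
    (hF : ∀ x, Filter.Tendsto (fun k => iterTranslateAvg μ h k x) Filter.atTop (𝓝 (F x))) (n : ℕ) :
    ∃ H : X → ℝ, LipschitzWith K H ∧ F = _root_.translateAvg (μ n) H := by
  set μ' : ℕ → Measure X := fun k => μ (k + (n + 1)) with hμ'def
  set h₀ := iterTranslateAvg μ h n
  have hh₀ : LipschitzWith K h₀ := hh.iterTranslateAvg hμ n
  have hμ' : ∀ k, ∀ᵐ v ∂μ' k, ‖v‖ ≤ δ / 2 / 2 ^ k := by
    intro k
    filter_upwards [hμ (k + (n + 1))] with v hv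
    refine hv.trans ?_
    gcongr
    · norm_num
    · omega
  obtain ⟨H, hH, hHd⟩ := exists_tendsto_iterTranslateAvg hh₀ hμ'
  have hHl : LipschitzWith K H := LipschitzWith.of_dist_le_mul fun x y =>
    le_of_tendsto' ((hH x).dist (hH y)) fun k => (hh₀.iterTranslateAvg hμ' k).dist_le_mul x y
  have hcomm : ∀ k, iterTranslateAvg μ h (k + (n + 1))
      = _root_.translateAvg (μ n) (iterTranslateAvg μ' h₀ k) := by
    intro k
    induction k with
    | zero => rw [zero_add]; rfl
    | succ k ih =>
      rw [show k + 1 + (n + 1) = (k + (n + 1)) + 1 by ring]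
      change _root_.translateAvg (μ (k + (n + 1))) (iterTranslateAvg μ h (k + (n + 1))) = _
      rw [ih]
      exact translateAvg_comm (hh₀.iterTranslateAvg hμ' k) (hμ _) (hμ n)
  refine ⟨H, hHl, funext fun x => ?_⟩
  refine tendsto_nhds_unique ((Filter.tendsto_add_atTop_iff_nat (n + 1)).2 (hF x)) ?_
  simp only [hcomm]
  rw [tendsto_iff_dist_tendsto_zero]
  refine squeeze_zero (g := fun k : ℕ => K * δ / 2 ^ k) (fun _ => dist_nonneg) (fun k => ?_) ?_
  · exact abs_translateAvg_sub_le (hh₀.iterTranslateAvg hμ' k) hHl (hμ n) fun v _ => hHd _ k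
  · simpa [div_eq_mul_inv] using
      (tendsto_pow_atTop_nhds_zero_of_lt_one (r := (2 : ℝ)⁻¹) (by norm_num) (by norm_num)).const_mul
        (K * δ)

end Iterate

end Averaging

section SmoothMeasure

variable {X : Type*} [NormedAddCommGroup X] [InnerProductSpace ℝ X] [MeasurableSpace X]
  [BorelSpace X]

/-- A finite-dimensional subspace carries probability measures with arbitrarily small support which
regularize continuous functions along that subspace. -/
theorem exists_measure_contDiff_translateAvg (V : Submodule ℝ X) [FiniteDimensional ℝ V]
    {δ : ℝ} (hδ : 0 < δ) :
    ∃ μ : Measure X, IsProbabilityMeasure μ ∧ (∀ᵐ v ∂μ, ‖v‖ ≤ δ) ∧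
      ∀ h : X → ℝ, Continuous h → ContDiff ℝ (⊤ : ℕ∞) fun v : V => translateAvg μ h v := by
  let φ : ContDiffBump (0 : V) := ⟨δ / 2, δ, by positivity, by linarith⟩
  let w : V → ℝ≥0 := fun v => (φ.normed volume v).toNNReal
  have hw : Measurable w := φ.continuous_normed.measurable.real_toNNReal
  let m : Measure V := volume.withDensity fun v => w v
  have hcoe : Measurable ((↑) : V → X) := measurable_subtype_coe
  have hm : IsProbabilityMeasure m := by
    constructor
    rw [withDensity_apply _ MeasurableSet.univ, Measure.restrict_univ]
    change ∫⁻ v, ENNReal.ofReal (φ.normed volume v) = 1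
    rw [← ofReal_integral_eq_lintegral_ofReal φ.integrable_normed
      (Filter.Eventually.of_forall φ.nonneg_normed), φ.integral_normed, ENNReal.ofReal_one]
  refine ⟨m.map (↑), Measure.isProbabilityMeasure_map hcoe.aemeasurable, ?_, fun h hh => ?_⟩
  · rw [ae_map_iff hcoe.aemeasurable (measurableSet_le measurable_norm measurable_const)]
    rw [ae_withDensity_iff hw.coe_nnreal_ennreal]
    refine Filter.Eventually.of_forall fun v hv => ?_
    have h1 : v ∈ Function.support (φ.normed volume) := by
      intro h0
      simp [w, h0] at hv
    rw [φ.support_normed_eq, mem_ball_zero_iff] at h1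
    exact h1.le
  · have key : (fun v : V => translateAvg (m.map (↑)) h v)
        = MeasureTheory.convolution (φ.normed volume) (fun v : V => h v)
          (ContinuousLinearMap.lsmul ℝ ℝ) volume := by
      ext v
      have hmeas : Measurable fun u : X => h (v - u) :=
        (hh.comp (continuous_const.sub continuous_id)).measurable
      have hsm : AEStronglyMeasurable (fun u : X => h (v - u)) (m.map (↑)) :=
        (hmeas.stronglyMeasurable).aestronglyMeasurable
      rw [translateAvg, integral_map hcoe.aemeasurable hsm,
        integral_withDensity_eq_integral_smul hw]
      simp [MeasureTheory.convolution, w, NNReal.smul_def, φ.nonneg_normed]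
    rw [key]
    exact φ.hasCompactSupport_normed.contDiff_convolution_left _ φ.contDiff_normed
      (hh.comp continuous_subtype_val).locallyIntegrable

end SmoothMeasure

/-- A Lipschitz function can be approximated by one which is smooth along each member of a given
sequence of finite-dimensional subspaces, without increasing local Lipschitz constants. -/
theorem exists_approx_contDiff_on_subspaces {X : Type*} [NormedAddCommGroup X]
    [InnerProductSpace ℝ X] [SecondCountableTopology X] {K : ℝ≥0} {f : X → ℝ}
    (hf : LipschitzWith K f) {δ : ℝ} (hδ : 0 < δ) (V : ℕ → Submodule ℝ X)
    [∀ n, FiniteDimensional ℝ (V n)] :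
    ∃ F : X → ℝ, (∀ x, |F x - f x| ≤ K * δ) ∧
      (∀ (x₀ : X) (r L : ℝ),
        (∀ x ∈ closedBall x₀ (r + δ), ∀ y ∈ closedBall x₀ (r + δ), |f x - f y| ≤ L * dist x y) →
        ∀ x ∈ closedBall x₀ r, ∀ y ∈ closedBall x₀ r, |F x - F y| ≤ L * dist x y) ∧
      ∀ n, ContDiff ℝ (⊤ : ℕ∞) fun v : V n => F v := by
  borelize X
  choose μ hμp hμ hμs using fun n : ℕ =>
    exists_measure_contDiff_translateAvg (V n) (δ := δ / 2 / 2 ^ n) (by positivity)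
  obtain ⟨F, hF, hFd⟩ := exists_tendsto_iterTranslateAvg hf hμ
  refine ⟨F, fun x => ?_, fun x₀ r L hL x hx y hy => ?_, fun n => ?_⟩
  · simpa [iterTranslateAvg, abs_sub_comm] using hFd x 0
  · refine le_of_tendsto' ((hF x).sub (hF y)).abs fun k => ?_
    have hsum : ∑ i ∈ Finset.range k, δ / 2 / 2 ^ i ≤ δ := by
      exact ((summable_geometric_two' δ).sum_le_tsum _ fun _ _ => by positivity).trans_eq
        (tsum_geometric_two' δ)
    have hsub := closedBall_subset_closedBall (x := x₀) (add_le_add_right hsum r)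
    exact abs_iterTranslateAvg_sub_le hf hμ k
      (fun x hx y hy => hL x (hsub hx) y (hsub hy)) x hx y hy
  · obtain ⟨H, hH, rfl⟩ := exists_eq_translateAvg_of_tendsto hf hδ.le hμ hF n
    exact hμs n H hH.continuous

theorem Real.smoothTransition.exists_abs_deriv_le :
    ∃ C : ℝ, ∀ t, |deriv Real.smoothTransition t| ≤ C := by
  have hcont : Continuous (deriv Real.smoothTransition) :=
    (Real.smoothTransition.contDiff (n := 1)).continuous_deriv le_rfl
  obtain ⟨C, hC⟩ := isCompact_Icc.exists_bound_of_continuousOn (s := Icc (0 : ℝ) 1)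
    hcont.continuousOn
  have hC0 : 0 ≤ C := (norm_nonneg _).trans (hC 0 (by simp))
  refine ⟨C, fun t => ?_⟩
  rcases le_or_gt t 0 with ht | ht
  · have h0 : IsLocalMin Real.smoothTransition t := Filter.Eventually.of_forall fun y => by
      rw [Real.smoothTransition.zero_of_nonpos ht]; exact Real.smoothTransition.nonneg y
    simpa [h0.deriv_eq_zero] using hC0
  rcases le_or_gt 1 t with ht' | ht'
  · have h0 : IsLocalMax Real.smoothTransition t := Filter.Eventually.of_forall fun y => by
      rw [Real.smoothTransition.one_of_one_le ht']; exact Real.smoothTransition.le_one y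
    simpa [h0.deriv_eq_zero] using hC0
  · exact hC t ⟨ht.le, ht'.le⟩

/-- A slowly varying cut-off function: its derivative is controlled, in the scale-invariant sense
relevant for telescoping sums, by the increments of a function with small oscillation. -/
theorem exists_slow_cutoff {δ η : ℝ} (hδ : 0 < δ) (hη : 0 < η) :
    ∃ (χ Λ : ℝ → ℝ) (α : ℝ), 0 < α ∧ (∀ s, 0 ≤ s → ContDiffAt ℝ (⊤ : ℕ∞) χ s) ∧
      (∀ s, 0 ≤ χ s ∧ χ s ≤ 1) ∧ (∀ s, 0 ≤ s → s ≤ α → χ s = 0) ∧ (∀ s, δ ≤ s → χ s = 1) ∧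
      (∀ s, 0 ≤ s → 0 ≤ Λ s ∧ Λ s ≤ η) ∧
      ∀ s t, 0 ≤ t → t ≤ s → deriv χ s ^ 2 * s * (s - t) ≤ Λ s - Λ t := by
  obtain ⟨C, hC⟩ := Real.smoothTransition.exists_abs_deriv_le
  obtain ⟨κ, hκ, hκ1, hκη⟩ : ∃ κ : ℝ, 0 < κ ∧ κ ≤ 1 ∧ C ^ 2 * (2 * κ) ≤ η := by
    refine ⟨min 1 (η / (2 * (C ^ 2 + 1))), by positivity, min_le_left _ _, ?_⟩
    calc C ^ 2 * (2 * min 1 (η / (2 * (C ^ 2 + 1))))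
        ≤ (C ^ 2 + 1) * (2 * (η / (2 * (C ^ 2 + 1)))) := by
          gcongr
          · linarith
          · exact min_le_right _ _
      _ = η := by field_simp
  set M : ℝ := 1 + 1 / κ with hM
  have hM1 : 0 < M := by positivity
  have hexp : 0 < Real.exp M - 1 := by have := Real.add_one_lt_exp hM1.ne'; linarith
  set α : ℝ := δ / (Real.exp M - 1) with hα
  have hα0 : 0 < α := by positivity
  set u : ℝ → ℝ := fun s => Real.log (1 + s / α) with hu
  have hpos : ∀ s, 0 ≤ s → 0 < 1 + s / α := fun s hs => by positivity
  have humono : ∀ s t, 0 ≤ t → t ≤ s → u t ≤ u s := fun s t ht hts =>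
    Real.log_le_log (hpos t ht) (by gcongr)
  have huδ : u δ = M := by
    have : 1 + δ / α = Real.exp M := by rw [hα]; field_simp; ring
    rw [hu]; simp only [this, Real.log_exp]
  have hud : ∀ s, 0 ≤ s → HasDerivAt u (1 / (α + s)) s := by
    intro s hs
    have h1 : HasDerivAt (fun s : ℝ => 1 + s / α) (1 / α) s :=
      ((hasDerivAt_id s).div_const α).const_add 1
    convert h1.log (hpos s hs).ne' using 1
    field_simp
  have hχd : ∀ s, 0 ≤ s → deriv (fun s => Real.smoothTransition (κ * (u s - 1))) s
      = deriv Real.smoothTransition (κ * (u s - 1)) * (κ * (1 / (α + s))) := by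
    intro s hs
    have h1 : HasDerivAt (fun s => κ * (u s - 1)) (κ * (1 / (α + s))) s :=
      ((hud s hs).sub_const 1).const_mul κ
    have h2 : HasDerivAt Real.smoothTransition
        (deriv Real.smoothTransition (κ * (u s - 1))) (κ * (u s - 1)) :=
      ((Real.smoothTransition.contDiff (n := 1)).differentiable one_ne_zero _).hasDerivAt
    exact (h2.comp s h1).deriv
  refine ⟨fun s => Real.smoothTransition (κ * (u s - 1)),
    fun s => C ^ 2 * κ ^ 2 * min (u s) M, α, hα0, fun s hs => ?_,
    fun s => ⟨Real.smoothTransition.nonneg _, Real.smoothTransition.le_one _⟩,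
    fun s hs hs' => ?_, fun s hs => ?_, fun s hs => ?_, fun s t ht hts => ?_⟩
  · refine Real.smoothTransition.contDiffAt.comp s ?_
    refine contDiffAt_const.mul (ContDiffAt.sub ?_ contDiffAt_const)
    exact (contDiffAt_const.add (contDiffAt_id.div_const α)).log (hpos s hs).ne'
  · refine Real.smoothTransition.zero_of_nonpos ?_
    have h1 : u s ≤ s / α := by
      have := Real.log_le_sub_one_of_pos (hpos s hs)
      simp only [hu]; linarith
    have h2 : s / α ≤ 1 := (div_le_one hα0).2 hs'
    nlinarith
  · refine Real.smoothTransition.one_of_one_le ?_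
    have h1 := humono s δ hδ.le hs
    rw [huδ, hM] at h1
    calc (1 : ℝ) = κ * (1 / κ) := by field_simp
      _ ≤ κ * (u s - 1) := by gcongr; linarith
  · have h0 : 0 ≤ u s := by
      have := humono s 0 le_rfl hs
      simpa [hu] using this
    refine ⟨by positivity, ?_⟩
    calc C ^ 2 * κ ^ 2 * min (u s) M ≤ C ^ 2 * κ ^ 2 * M := by gcongr; exact min_le_right _ _
      _ = C ^ 2 * (κ * (κ + 1)) := by rw [hM]; field_simp
      _ ≤ C ^ 2 * (2 * κ) := mul_le_mul_of_nonneg_left (by nlinarith) (sq_nonneg C)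
      _ ≤ η := hκη
  · have hs : 0 ≤ s := ht.trans hts
    have hut := humono s t ht hts
    rw [hχd s hs]
    rcases le_or_gt M (u s) with hMs | hMs
    · have h1 : 1 ≤ κ * (u s - 1) := by
        calc (1 : ℝ) = κ * (1 / κ) := by field_simp
          _ ≤ κ * (u s - 1) := by gcongr; linarith
      have h0 : IsLocalMax Real.smoothTransition (κ * (u s - 1)) :=
        Filter.Eventually.of_forall fun y => by
          rw [Real.smoothTransition.one_of_one_le h1]; exact Real.smoothTransition.le_one y
      rw [h0.deriv_eq_zero]
      have : min (u t) M ≤ min (u s) M := min_le_min_right _ hut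
      have : C ^ 2 * κ ^ 2 * min (u t) M ≤ C ^ 2 * κ ^ 2 * min (u s) M := by gcongr
      simpa using this
    · simp only [min_eq_left hMs.le, min_eq_left (hut.trans hMs.le), ← mul_sub]
      have hlog : (s - t) / (α + s) ≤ u s - u t := by
        have h1 := Real.one_sub_inv_le_log_of_pos (div_pos (hpos s hs) (hpos t ht))
        rw [Real.log_div (hpos s hs).ne' (hpos t ht).ne'] at h1
        refine le_trans (le_of_eq ?_) h1
        have := (hpos s hs).ne'
        have := (hpos t ht).ne'
        have : α + s ≠ 0 := by positivity
        have : α + t ≠ 0 := by positivity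
        field_simp
        ring
      have hd : deriv Real.smoothTransition (κ * (u s - 1)) ^ 2 ≤ C ^ 2 :=
        sq_le_sq' (abs_le.1 (hC _)).1 (abs_le.1 (hC _)).2
      have hst : 0 ≤ s - t := sub_nonneg.2 hts
      have hαs : 0 < α + s := by positivity
      calc (deriv Real.smoothTransition (κ * (u s - 1)) * (κ * (1 / (α + s)))) ^ 2 * s * (s - t)
          = deriv Real.smoothTransition (κ * (u s - 1)) ^ 2 * κ ^ 2 *
              (s / (α + s) * ((s - t) / (α + s))) := by field_simp
        _ ≤ C ^ 2 * κ ^ 2 * (1 * ((s - t) / (α + s))) := by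
          gcongr
          exact (div_le_one hαs).2 (by linarith)
        _ ≤ C ^ 2 * κ ^ 2 * (u s - u t) := by rw [one_mul]; gcongr

section Projections

variable {X : Type*} [NormedAddCommGroup X] [InnerProductSpace ℝ X] {V : ℕ → Submodule ℝ X}
  [∀ n, FiniteDimensional ℝ (V n)]

/-- The squared norm of the component of `x` orthogonal to `V n`. -/
noncomputable def residualSq (V : ℕ → Submodule ℝ X) [∀ n, FiniteDimensional ℝ (V n)] (n : ℕ)
    (x : X) : ℝ :=
  ‖x - (V n).starProjection x‖ ^ 2

/-- The increment of the orthogonal projections onto `V n` and `V (n + 1)`. -/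
noncomputable def projIncr (V : ℕ → Submodule ℝ X) [∀ n, FiniteDimensional ℝ (V n)] (n : ℕ) :
    X →L[ℝ] X :=
  (V (n + 1)).starProjection - (V n).starProjection

theorem residualSq_nonneg (n : ℕ) (x : X) : 0 ≤ residualSq V n x := sq_nonneg _

theorem residualSq_le (n : ℕ) (x : X) : residualSq V n x ≤ ‖x‖ ^ 2 := by
  have h := norm_add_sq_eq_norm_sq_add_norm_sq_real
    ((V n).starProjection_inner_eq_zero x _ ((V n).starProjection_apply_mem x))
  rw [sub_add_cancel] at h
  rw [residualSq]
  nlinarith [norm_nonneg ((V n).starProjection x)]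

theorem projIncr_mem (hV : Monotone V) (n : ℕ) (x : X) : projIncr V n x ∈ V (n + 1) :=
  Submodule.sub_mem _ (Submodule.starProjection_apply_mem _ _)
    (hV n.le_succ (Submodule.starProjection_apply_mem _ _))

theorem inner_projIncr_eq_zero (hV : Monotone V) (n : ℕ) (x : X) {y : X} (hy : y ∈ V n) :
    inner ℝ y (projIncr V n x) = 0 := by
  have h1 := (V n).starProjection_inner_eq_zero x y hy
  have h2 := (V (n + 1)).starProjection_inner_eq_zero x y (hV n.le_succ hy)
  rw [real_inner_comm, projIncr, sub_apply,
    show (V (n + 1)).starProjection x - (V n).starProjection x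
      = (x - (V n).starProjection x) - (x - (V (n + 1)).starProjection x) by abel,
    inner_sub_left, h1, h2, sub_zero]

theorem residualSq_sub_succ (hV : Monotone V) (n : ℕ) (x : X) :
    ‖projIncr V n x‖ ^ 2 = residualSq V n x - residualSq V (n + 1) x := by
  have h := norm_add_sq_eq_norm_sq_add_norm_sq_real
    ((V (n + 1)).starProjection_inner_eq_zero x _ (projIncr_mem hV n x))
  have h2 : x - (V (n + 1)).starProjection x + projIncr V n x = x - (V n).starProjection x := by
    simp [projIncr]
  rw [h2] at h
  rw [residualSq, residualSq]
  linarith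

theorem residualSq_antitone (hV : Monotone V) (x : X) : Antitone fun n => residualSq V n x :=
  antitone_nat_of_succ_le fun n => by
    have := residualSq_sub_succ hV n x
    nlinarith [sq_nonneg ‖projIncr V n x‖]

theorem sum_smul_projIncr_mem (hV : Monotone V) (a : ℕ → ℝ) (x : X) (N : ℕ) :
    ∑ n ∈ Finset.range N, a n • projIncr V n x ∈ V N :=
  Submodule.sum_mem _ fun n hn => Submodule.smul_mem _ _
    (hV (Nat.succ_le_of_lt (Finset.mem_range.1 hn)) (projIncr_mem hV n x))

theorem norm_sum_smul_projIncr_sq (hV : Monotone V) (a : ℕ → ℝ) (x : X) (N : ℕ) :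
    ‖∑ n ∈ Finset.range N, a n • projIncr V n x‖ ^ 2
      = ∑ n ∈ Finset.range N, a n ^ 2 * (residualSq V n x - residualSq V (n + 1) x) := by
  induction N with
  | zero => simp
  | succ N ih =>
    have h := norm_add_sq_eq_norm_sq_add_norm_sq_real
      (x := ∑ n ∈ Finset.range N, a n • projIncr V n x) (y := a N • projIncr V N x) (by
        rw [inner_smul_right, inner_projIncr_eq_zero hV N x (sum_smul_projIncr_mem hV a x N),
          mul_zero])
    rw [Finset.sum_range_succ, Finset.sum_range_succ, ← ih, ← residualSq_sub_succ hV, sq, h,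
      norm_smul, Real.norm_eq_abs, ← sq_abs (a N)]
    ring

theorem hasFDerivAt_residualSq (n : ℕ) (x : X) :
    HasFDerivAt (residualSq V n) (2 • innerSL ℝ (x - (V n).starProjection x)) x := by
  have h := ((hasFDerivAt_id (𝕜 := ℝ) x).sub (V n).starProjection.hasFDerivAt).norm_sq
  refine h.congr_fderiv ?_
  ext y
  have := (V n).starProjection_inner_eq_zero x _ ((V n).starProjection_apply_mem y)
  rw [inner_sub_left] at this
  simp [this]

theorem contDiff_residualSq (n : ℕ) : ContDiff ℝ (⊤ : ℕ∞) (residualSq V n) :=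
  (contDiff_id.sub (V n).starProjection.contDiff).norm_sq ℝ

/-- A partially truncated expansion of `x` along the orthogonal increments of `V`. -/
noncomputable def truncation (V : ℕ → Submodule ℝ X) [∀ n, FiniteDimensional ℝ (V n)]
    (χ : ℝ → ℝ) (N : ℕ) (x : X) : X :=
  ∑ n ∈ Finset.range N, χ (residualSq V n x) • projIncr V n x

theorem contDiff_truncation {χ : ℝ → ℝ} (hχ : ∀ s, 0 ≤ s → ContDiffAt ℝ (⊤ : ℕ∞) χ s) (N : ℕ) :
    ContDiff ℝ (⊤ : ℕ∞) (truncation V χ N) :=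
  ContDiff.sum fun n _ => ContDiff.smul
    (contDiff_iff_contDiffAt.2 fun x =>
      (hχ _ (residualSq_nonneg n x)).comp x (contDiff_residualSq n).contDiffAt)
    (projIncr V n).contDiff

theorem fderiv_truncation_apply {χ : ℝ → ℝ} (hχ : ∀ s, 0 ≤ s → ContDiffAt ℝ (⊤ : ℕ∞) χ s)
    (N : ℕ) (x y : X) :
    fderiv ℝ (truncation V χ N) x y
      = ∑ n ∈ Finset.range N, χ (residualSq V n x) • projIncr V n y
        + ∑ n ∈ Finset.range N, (deriv χ (residualSq V n x) *
            (2 * inner ℝ (x - (V n).starProjection x) y)) • projIncr V n x := by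
  have h : ∀ n, HasFDerivAt (fun x => χ (residualSq V n x) • projIncr V n x) _ x := fun n =>
    HasFDerivAt.smul (((hχ _ (residualSq_nonneg n x)).differentiableAt (by simp)
      ).hasDerivAt.comp_hasFDerivAt x (hasFDerivAt_residualSq n x)) (projIncr V n).hasFDerivAt
  have h2 : HasFDerivAt (truncation V χ N) _ x := HasFDerivAt.fun_sum fun n _ => h n
  rw [h2.fderiv, sum_apply, ← Finset.sum_add_distrib]
  refine Finset.sum_congr rfl fun n _ => ?_
  simp [inner_sub_left]

theorem norm_fderiv_truncation_le (hV : Monotone V) {χ Λ : ℝ → ℝ} {η : ℝ} (hη : 0 ≤ η)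
    (hχ : ∀ s, 0 ≤ s → ContDiffAt ℝ (⊤ : ℕ∞) χ s) (hχ1 : ∀ s, 0 ≤ χ s ∧ χ s ≤ 1)
    (hΛ : ∀ s, 0 ≤ s → 0 ≤ Λ s ∧ Λ s ≤ (η / 2) ^ 2)
    (hχΛ : ∀ s t, 0 ≤ t → t ≤ s → deriv χ s ^ 2 * s * (s - t) ≤ Λ s - Λ t) (N : ℕ) (x : X) :
    ‖fderiv ℝ (truncation V χ N) x‖ ≤ 1 + η := by
  refine ContinuousLinearMap.opNorm_le_bound _ (by positivity) fun y => ?_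
  rw [fderiv_truncation_apply hχ, add_mul, one_mul]
  refine (norm_add_le _ _).trans (add_le_add ?_ ?_)
  · refine le_of_sq_le_sq ?_ (norm_nonneg y)
    rw [norm_sum_smul_projIncr_sq hV]
    calc ∑ n ∈ Finset.range N,
          χ (residualSq V n x) ^ 2 * (residualSq V n y - residualSq V (n + 1) y)
        ≤ ∑ n ∈ Finset.range N, (residualSq V n y - residualSq V (n + 1) y) := by
          refine Finset.sum_le_sum fun n _ => mul_le_of_le_one_left ?_ ?_
          · exact sub_nonneg.2 (residualSq_antitone hV y n.le_succ)
          · exact pow_le_one₀ (hχ1 _).1 (hχ1 _).2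
      _ = residualSq V 0 y - residualSq V N y := Finset.sum_range_sub' _ _
      _ ≤ ‖y‖ ^ 2 := by linarith [residualSq_le (V := V) 0 y, residualSq_nonneg (V := V) N y]
  · refine le_of_sq_le_sq ?_ (by positivity)
    rw [norm_sum_smul_projIncr_sq hV]
    calc ∑ n ∈ Finset.range N, (deriv χ (residualSq V n x) *
          (2 * inner ℝ (x - (V n).starProjection x) y)) ^ 2 *
            (residualSq V n x - residualSq V (n + 1) x)
        ≤ ∑ n ∈ Finset.range N, 4 * ‖y‖ ^ 2 *
            (Λ (residualSq V n x) - Λ (residualSq V (n + 1) x)) := by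
          refine Finset.sum_le_sum fun n _ => ?_
          have h1 := hχΛ _ _ (residualSq_nonneg (n + 1) x) (residualSq_antitone hV x n.le_succ)
          have h2 : 0 ≤ residualSq V n x - residualSq V (n + 1) x :=
            sub_nonneg.2 (residualSq_antitone hV x n.le_succ)
          have h3 : inner ℝ (x - (V n).starProjection x) y ^ 2 ≤ residualSq V n x * ‖y‖ ^ 2 := by
            rw [residualSq, ← mul_pow, ← sq_abs]
            gcongr
            exact abs_real_inner_le_norm _ _
          calc (deriv χ (residualSq V n x) *
                (2 * inner ℝ (x - (V n).starProjection x) y)) ^ 2 *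
                  (residualSq V n x - residualSq V (n + 1) x)
              = 4 * deriv χ (residualSq V n x) ^ 2 *
                inner ℝ (x - (V n).starProjection x) y ^ 2 *
                  (residualSq V n x - residualSq V (n + 1) x) := by ring
            _ ≤ 4 * deriv χ (residualSq V n x) ^ 2 * (residualSq V n x * ‖y‖ ^ 2) *
                  (residualSq V n x - residualSq V (n + 1) x) := by gcongr
            _ = 4 * ‖y‖ ^ 2 * (deriv χ (residualSq V n x) ^ 2 * residualSq V n x *
                  (residualSq V n x - residualSq V (n + 1) x)) := by ring
            _ ≤ _ := by gcongr
      _ = 4 * ‖y‖ ^ 2 * (Λ (residualSq V 0 x) - Λ (residualSq V N x)) := by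
          rw [← Finset.mul_sum, Finset.sum_range_sub' fun n => Λ (residualSq V n x)]
      _ ≤ 4 * ‖y‖ ^ 2 * (η / 2) ^ 2 := by
          gcongr
          linarith [(hΛ _ (residualSq_nonneg (V := V) 0 x)).2,
            (hΛ _ (residualSq_nonneg (V := V) N x)).1]
      _ = (η * ‖y‖) ^ 2 := by ring

theorem norm_truncation_sub_le (hV : Monotone V) (hV0 : V 0 = ⊥) {χ : ℝ → ℝ} {δ : ℝ} (hδ : 0 ≤ δ)
    (hχ1 : ∀ s, 0 ≤ χ s ∧ χ s ≤ 1) (hχδ : ∀ s, δ ^ 2 ≤ s → χ s = 1) {N : ℕ} {x : X}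
    (hN : residualSq V N x ≤ δ ^ 2) : ‖truncation V χ N x - x‖ ≤ δ := by
  refine le_of_sq_le_sq ?_ hδ
  have htel : ∑ n ∈ Finset.range N, projIncr V n x = (V N).starProjection x := by
    simp only [projIncr, sub_apply]
    rw [Finset.sum_range_sub fun n => (V n).starProjection x]
    have : (V 0).starProjection x = 0 := by
      exact (Submodule.mem_bot ℝ).1 (hV0.le ((V 0).starProjection_apply_mem x))
    rw [this, sub_zero]
  have hdec : x - truncation V χ N x = (x - (V N).starProjection x)
      + ∑ n ∈ Finset.range N, (1 - χ (residualSq V n x)) • projIncr V n x := by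
    simp only [sub_smul, one_smul, Finset.sum_sub_distrib, htel, truncation]
    abel
  have hpyth := norm_add_sq_eq_norm_sq_add_norm_sq_real
    ((V N).starProjection_inner_eq_zero x _
      (sum_smul_projIncr_mem hV (fun n => 1 - χ (residualSq V n x)) x N))
  rw [← hdec, ← sq, ← sq, ← sq, norm_sum_smul_projIncr_sq hV] at hpyth
  rw [norm_sub_rev, hpyth]
  have hsum : ∑ n ∈ Finset.range N, (1 - χ (residualSq V n x)) ^ 2 *
      (residualSq V n x - residualSq V (n + 1) x)
      ≤ ∑ n ∈ Finset.range N,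
        (min (residualSq V n x) (δ ^ 2) - min (residualSq V (n + 1) x) (δ ^ 2)) := by
    refine Finset.sum_le_sum fun n _ => ?_
    have hanti := residualSq_antitone hV x n.le_succ
    simp only at hanti
    rcases le_or_gt (δ ^ 2) (residualSq V n x) with h | h
    · rw [hχδ _ h, min_eq_right h]
      simp
    · rw [min_eq_left h.le, min_eq_left (hanti.trans h.le)]
      refine mul_le_of_le_one_left (sub_nonneg.2 hanti) (pow_le_one₀ ?_ ?_)
      · linarith [(hχ1 (residualSq V n x)).2]
      · linarith [(hχ1 (residualSq V n x)).1]
  rw [Finset.sum_range_sub' fun n => min (residualSq V n x) (δ ^ 2), min_eq_left hN] at hsum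
  have := min_le_right (residualSq V 0 x) (δ ^ 2)
  change residualSq V N x + _ ≤ _
  linarith

/-- The identity of a space exhausted by finite-dimensional subspaces can be approximated by smooth
maps with Lipschitz constant close to one and locally finite-dimensional range. -/
theorem exists_smooth_approx_id (hV : Monotone V) (hV0 : V 0 = ⊥)
    (hVd : ∀ x : X, ∀ ρ > 0, ∃ n, residualSq V n x < ρ) {δ : ℝ} (hδ : 0 < δ) {η : ℝ≥0}
    (hη : 0 < η) :
    ∃ ψ : X → X, (∀ x, ‖ψ x - x‖ ≤ δ) ∧ LipschitzWith (1 + η) ψ ∧ ContDiff ℝ (⊤ : ℕ∞) ψ ∧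
      ∀ x, ∃ N, ∀ᶠ y in 𝓝 x, ψ y ∈ V N := by
  obtain ⟨χ, Λ, α, hα, hχ, hχ1, hχ0, hχδ, hΛ, hχΛ⟩ :=
    exists_slow_cutoff (δ := δ ^ 2) (η := ((η : ℝ) / 2) ^ 2) (by positivity) (by positivity)
  have hαδ : α ≤ δ ^ 2 := by
    by_contra! h
    have h1 := hχ0 (δ ^ 2) (sq_nonneg δ) h.le
    rw [hχδ _ le_rfl] at h1
    exact one_ne_zero h1
  let ψ : X → X := fun x => ∑' n, χ (residualSq V n x) • projIncr V n x
  have hψ : ∀ x N, residualSq V N x < α → ψ x = truncation V χ N x := by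
    intro x N hN
    refine tsum_eq_sum fun n hn => ?_
    rw [hχ0 _ (residualSq_nonneg n x), zero_smul]
    exact (residualSq_antitone hV x (by simpa using hn)).trans hN.le
  have hloc : ∀ x, ∃ N, residualSq V N x < α ∧ ψ =ᶠ[𝓝 x] truncation V χ N := by
    intro x
    obtain ⟨N, hN⟩ := hVd x α hα
    refine ⟨N, hN, ?_⟩
    filter_upwards [(contDiff_residualSq (V := V) N).continuous.continuousAt.eventually_lt_const hN]
      with y hy using hψ y N hy
  have hsmooth : ContDiff ℝ (⊤ : ℕ∞) ψ := contDiff_iff_contDiffAt.2 fun x => by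
    obtain ⟨N, -, hN⟩ := hloc x
    exact (contDiff_truncation hχ N).contDiffAt.congr_of_eventuallyEq hN
  refine ⟨ψ, fun x => ?_, ?_, hsmooth, fun x => ?_⟩
  · obtain ⟨N, hN, -⟩ := hloc x
    rw [hψ x N hN]
    exact norm_truncation_sub_le hV hV0 hδ.le hχ1 hχδ (hN.le.trans hαδ)
  · refine lipschitzWith_of_nnnorm_fderiv_le (𝕜 := ℝ) (hsmooth.differentiable (by simp)) fun x => ?_
    obtain ⟨N, -, hN⟩ := hloc x
    rw [hN.fderiv_eq, ← NNReal.coe_le_coe]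
    simpa using norm_fderiv_truncation_le hV η.2 hχ hχ1 hΛ hχΛ N x
  · obtain ⟨N, -, hN⟩ := hloc x
    exact ⟨N, hN.mono fun y hy => hy ▸ sum_smul_projIncr_mem hV _ y N⟩

end Projections

/-- A separable inner product space is exhausted by finite-dimensional subspaces. -/
theorem exists_exhaustion_finiteDimensional (X : Type*) [NormedAddCommGroup X]
    [InnerProductSpace ℝ X] [TopologicalSpace.SeparableSpace X] :
    ∃ (V : ℕ → Submodule ℝ X) (_ : ∀ n, FiniteDimensional ℝ (V n)), Monotone V ∧ V 0 = ⊥ ∧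
      ∀ x : X, ∀ ρ > 0, ∃ n, residualSq V n x < ρ := by
  refine ⟨fun n => Submodule.span ℝ (TopologicalSpace.denseSeq X '' Iio n),
    fun n => FiniteDimensional.span_of_finite ℝ ((finite_Iio n).image _),
    fun m n hmn => Submodule.span_mono (image_mono (Iio_subset_Iio hmn)), by simp, fun x ρ hρ => ?_⟩
  obtain ⟨k, hk⟩ := (TopologicalSpace.denseRange_denseSeq X).exists_dist_lt x (Real.sqrt_pos.2 hρ)
  have := FiniteDimensional.span_of_finite ℝ
    ((finite_Iio (k + 1)).image (TopologicalSpace.denseSeq X))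
  refine ⟨k + 1, ?_⟩
  rw [residualSq, ← Real.lt_sqrt (norm_nonneg _), Submodule.starProjection_minimal]
  refine (ciInf_le ⟨0, ?_⟩ (⟨TopologicalSpace.denseSeq X k, Submodule.subset_span
    (mem_image_of_mem _ (mem_Iio.2 k.lt_succ_self))⟩ :
      Submodule.span ℝ (TopologicalSpace.denseSeq X '' Iio (k + 1)))).trans_lt ?_
  · rintro _ ⟨v, rfl⟩
    exact norm_nonneg _
  · rwa [← dist_eq_norm]

theorem bddBelow_lipOn_set {X : Type*} [PseudoMetricSpace X] (f : X → ℝ) (s : Set X) :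
    BddBelow {L : ℝ | 0 < L ∧ ∀ x ∈ s, ∀ y ∈ s, |f x - f y| ≤ L * dist x y} :=
  ⟨0, fun _ hL => hL.1.le⟩

/-- Lemma (separable Hilbert case): uniform approximation of a `K`-Lipschitz function by
`C^∞` functions almost preserving local Lipschitz constants on balls. -/
theorem stmt_12 {X : Type*} [NormedAddCommGroup X] [InnerProductSpace ℝ X] [CompleteSpace X]
    [TopologicalSpace.SeparableSpace X]
    (K : ℝ) (f : X → ℝ) (hf : IsLipschitzWithOn K f Set.univ) (ε : ℝ) (hε : 0 < ε) :
    ∃ g : X → ℝ,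
      ContDiff ℝ (⊤ : ℕ∞) g ∧
      (∀ x : X, |g x - f x| ≤ ε) ∧
      (∀ (x₀ : X) (r : ℝ), 0 < r →
        lipOn g (closedBall x₀ r) ≤ lipOn f (closedBall x₀ (r + ε)) + ε) := by
  have : SecondCountableTopology X := UniformSpace.secondCountable_of_separable X
  set C : ℝ≥0 := K.toNNReal + 1 with hC
  have hC1 : (1 : ℝ) ≤ C := by simp [hC]
  have hKC : K ≤ C := (Real.le_coe_toNNReal K).trans (by simp [hC])
  have hfC : LipschitzWith C f := LipschitzWith.of_dist_le_mul fun x y =>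
    (hf x (mem_univ x) y (mem_univ y)).trans (by gcongr)
  set δ : ℝ := ε / (2 * C) with hδdef
  have hC0 : (0 : ℝ) < C := by linarith
  have hδ : 0 < δ := by positivity
  have hCδ : C * δ = ε / 2 := by rw [hδdef]; field_simp
  have hδε : 2 * δ ≤ ε := by nlinarith
  obtain ⟨η, hη, hCη⟩ : ∃ η : ℝ≥0, 0 < η ∧ (η : ℝ) * C = ε :=
    ⟨ε.toNNReal / C, by positivity, by
      rw [NNReal.coe_div, Real.coe_toNNReal _ hε.le]; field_simp⟩
  obtain ⟨V, hVf, hV, hV0, hVd⟩ := exists_exhaustion_finiteDimensional X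
  obtain ⟨ψ, hψd, hψl, hψs, hψV⟩ := exists_smooth_approx_id hV hV0 hVd hδ hη
  obtain ⟨F, hFf, hFl, hFs⟩ := exists_approx_contDiff_on_subspaces hfC hδ V
  refine ⟨F ∘ ψ, contDiff_iff_contDiffAt.2 fun x => ?_, fun x => ?_, fun x₀ r hr => ?_⟩
  · obtain ⟨N, hN⟩ := hψV x
    have h1 : ContDiff ℝ (⊤ : ℕ∞) fun y => F ((V N).orthogonalProjectionOnto (ψ y)) :=
      (hFs N).comp ((V N).orthogonalProjectionOnto.contDiff.comp hψs)
    refine h1.contDiffAt.congr_of_eventuallyEq (hN.mono fun y hy => ?_)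
    beta_reduce
    rw [Function.comp_apply, ← Submodule.starProjection_apply,
      Submodule.starProjection_eq_self_iff.2 hy]
  · have h1 := hFf (ψ x)
    have h2 := hfC.dist_le_mul (ψ x) x
    rw [Real.dist_eq, dist_eq_norm] at h2
    have h3 : (C : ℝ) * ‖ψ x - x‖ ≤ C * δ := by gcongr; exact hψd x
    calc |F (ψ x) - f x| ≤ |F (ψ x) - f (ψ x)| + |f (ψ x) - f x| := abs_sub_le _ _ _
      _ ≤ ε := by linarith
  · have hne : (C : ℝ) ∈ {L : ℝ | 0 < L ∧ ∀ x ∈ closedBall x₀ (r + ε),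
        ∀ y ∈ closedBall x₀ (r + ε), |f x - f y| ≤ L * dist x y} :=
      ⟨hC0, fun x _ y _ => hfC.dist_le_mul x y⟩
    have hψmem : ∀ x ∈ closedBall x₀ r, ψ x ∈ closedBall x₀ (r + δ) := fun x hx => by
      have h1 := dist_triangle (ψ x) x x₀
      have h2 := hψd x
      rw [← dist_eq_norm] at h2
      rw [mem_closedBall] at hx ⊢
      linarith
    have hscale : ∀ L ∈ {L : ℝ | 0 < L ∧ ∀ x ∈ closedBall x₀ (r + ε),
        ∀ y ∈ closedBall x₀ (r + ε), |f x - f y| ≤ L * dist x y},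
        lipOn (F ∘ ψ) (closedBall x₀ r) / (1 + η) ≤ L := by
      rintro L ⟨hL, hfL⟩
      rw [div_le_iff₀ (by positivity)]
      refine csInf_le (bddBelow_lipOn_set _ _) ⟨by positivity, fun x hx y hy => ?_⟩
      have hsub : closedBall x₀ (r + δ + δ) ⊆ closedBall x₀ (r + ε) :=
        closedBall_subset_closedBall (by linarith)
      calc |F (ψ x) - F (ψ y)| ≤ L * dist (ψ x) (ψ y) :=
            hFl x₀ (r + δ) L (fun x hx y hy => hfL x (hsub hx) y (hsub hy)) _ (hψmem x hx) _
              (hψmem y hy)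
        _ ≤ L * ((1 + η) * dist x y) := by gcongr; simpa using hψl.dist_le_mul x y
        _ = L * (1 + η) * dist x y := by ring
    have h1 : lipOn (F ∘ ψ) (closedBall x₀ r) / (1 + η) ≤ lipOn f (closedBall x₀ (r + ε)) :=
      le_csInf ⟨C, hne⟩ hscale
    have h2 : lipOn f (closedBall x₀ (r + ε)) ≤ C := csInf_le (bddBelow_lipOn_set _ _) hne
    rw [div_le_iff₀ (by positivity)] at h1
    have h3 : lipOn f (closedBall x₀ (r + ε)) * η ≤ C * η := by gcongr
    linarith
end

section
/- Let Γ be an arbitrary set, let X = c₀(Γ) with its supremum norm, let f : X → ℝ be a Lipschitz function and let ε > 0. Then there exists a function g : X → ℝ of class C^∞ such that |f − g| ≤ ε on X and lip(g, B(x₀,r)) ≤ lip(f, B(x₀, r+ε)) for every closed ball B(x₀,r) ⊂ X. -/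
open Metric Set MeasureTheory

open scoped ZeroAtInfty

open scoped Topology Convolution

/-- Truncation of a real number to `[-a, a]`. -/
noncomputable def truncate (a t : ℝ) : ℝ := max (-a) (min a t)

/-- The soft thresholding function, which shrinks `t` towards `0` by at most `a`. -/
noncomputable def softThreshold (a t : ℝ) : ℝ := t - truncate a t

lemma abs_truncate_le {a : ℝ} (ha : 0 ≤ a) (t : ℝ) : |truncate a t| ≤ a := by
  unfold truncate
  grind

lemma truncate_of_abs_le {a t : ℝ} (h : |t| ≤ a) : truncate a t = t := by
  unfold truncate
  grind

lemma continuous_truncate (a : ℝ) : Continuous (truncate a) := by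
  unfold truncate
  fun_prop

lemma softThreshold_of_abs_le {a t : ℝ} (h : |t| ≤ a) : softThreshold a t = 0 := by
  rw [softThreshold, truncate_of_abs_le h, sub_self]

lemma abs_softThreshold_sub_self_le {a : ℝ} (ha : 0 ≤ a) (t : ℝ) :
    |softThreshold a t - t| ≤ a := by
  simpa [softThreshold] using abs_truncate_le ha t

lemma abs_softThreshold_sub_le {a : ℝ} (ha : 0 ≤ a) (s t : ℝ) :
    |softThreshold a s - softThreshold a t| ≤ |s - t| := by
  unfold softThreshold truncate
  grind

namespace ZeroAtInftyContinuousMap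

variable {Γ : Type*} [TopologicalSpace Γ]

lemma dist_le_iff {x y : C₀(Γ, ℝ)} {C : ℝ} (hC : 0 ≤ C) :
    dist x y ≤ C ↔ ∀ γ, |x γ - y γ| ≤ C := by
  rw [← dist_toBCF_eq_dist, BoundedContinuousFunction.dist_le hC]
  rfl

lemma abs_apply_sub_apply_le_dist (x y : C₀(Γ, ℝ)) (γ : Γ) : |x γ - y γ| ≤ dist x y :=
  (dist_le_iff dist_nonneg).1 le_rfl γ

/-- Evaluation at a point, as a continuous linear functional. -/
noncomputable def evalL (γ : Γ) : C₀(Γ, ℝ) →L[ℝ] ℝ :=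
  LinearMap.mkContinuous
    { toFun := fun x ↦ x γ
      map_add' := fun _ _ ↦ rfl
      map_smul' := fun _ _ ↦ rfl }
    1 fun x ↦ by simpa using abs_apply_sub_apply_le_dist x 0 γ

variable [DiscreteTopology Γ]

lemma finite_setOf_le_abs (x : C₀(Γ, ℝ)) {a : ℝ} (ha : 0 < a) : {γ | a ≤ |x γ|}.Finite := by
  have h := x.zero_at_infty'
  rw [Filter.cocompact_eq_cofinite] at h
  have h' := h.eventually (Metric.ball_mem_nhds 0 ha)
  rw [Filter.eventually_cofinite] at h'
  simpa using h'

/-- The function `x - ω`, with `ω` truncated at level `a / 2`, shrunk coordinatewise by `a`. -/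
noncomputable def noisyShrink {a : ℝ} (ha : 0 < a) (x : C₀(Γ, ℝ)) (ω : Γ → ℝ) : C₀(Γ, ℝ) where
  toFun γ := softThreshold a (x γ - truncate (a / 2) (ω γ))
  continuous_toFun := continuous_of_discreteTopology
  zero_at_infty' := by
    rw [Filter.cocompact_eq_cofinite]
    refine tendsto_const_nhds.congr' (Filter.eventually_cofinite.2
      ((finite_setOf_le_abs x (half_pos ha)).subset fun γ hγ ↦ ?_))
    contrapose! hγ
    simp only [mem_ofPred_eq, not_le, not_not] at hγ ⊢
    refine (softThreshold_of_abs_le ?_).symm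
    have := abs_truncate_le (half_pos ha).le (ω γ)
    grind

/-- Coordinatewise shrinking by `a` of a finitely supported vector. -/
noncomputable def finsetShrink (a : ℝ) (H : Finset Γ) (z : H → ℝ) : C₀(Γ, ℝ) where
  toFun := Function.extend Subtype.val (fun i ↦ softThreshold a (z i)) 0
  continuous_toFun := continuous_of_discreteTopology
  zero_at_infty' := by
    rw [Filter.cocompact_eq_cofinite]
    refine tendsto_const_nhds.congr' (Filter.eventually_cofinite.2
      (H.finite_toSet.subset fun γ hγ ↦ ?_))
    contrapose! hγ
    simp only [mem_ofPred_eq, not_not]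
    rw [Function.extend_apply']
    · rfl
    · rintro ⟨i, rfl⟩
      exact hγ i.2

lemma finsetShrink_apply_coe (a : ℝ) (H : Finset Γ) (z : H → ℝ) (i : H) :
    finsetShrink a H z i = softThreshold a (z i) :=
  Subtype.val_injective.extend_apply (fun i ↦ softThreshold a (z i)) 0 i

lemma finsetShrink_apply_of_notMem (a : ℝ) {H : Finset Γ} (z : H → ℝ) {γ : Γ} (hγ : γ ∉ H) :
    finsetShrink a H z γ = 0 := by
  refine Function.extend_apply' (fun i : H ↦ softThreshold a (z i)) (0 : Γ → ℝ) γ ?_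
  rintro ⟨i, rfl⟩
  exact hγ i.2

lemma continuous_finsetShrink {a : ℝ} (ha : 0 ≤ a) (H : Finset Γ) :
    Continuous (finsetShrink a H) := by
  refine (LipschitzWith.of_dist_le_mul (K := 1) fun z w ↦ ?_).continuous
  rw [NNReal.coe_one, one_mul, dist_le_iff dist_nonneg]
  intro γ
  by_cases hγ : γ ∈ H
  · lift γ to H using hγ
    rw [finsetShrink_apply_coe, finsetShrink_apply_coe]
    exact (abs_softThreshold_sub_le ha _ _).trans (dist_le_pi_dist z w γ)
  · simp [finsetShrink_apply_of_notMem a _ hγ]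

variable {a : ℝ} (ha : 0 < a)

lemma dist_noisyShrink_le (x y : C₀(Γ, ℝ)) (ω : Γ → ℝ) :
    dist (noisyShrink ha x ω) (noisyShrink ha y ω) ≤ dist x y := by
  rw [dist_le_iff dist_nonneg]
  intro γ
  refine (abs_softThreshold_sub_le ha.le _ _).trans ?_
  simpa using abs_apply_sub_apply_le_dist x y γ

lemma dist_noisyShrink_self_le (x : C₀(Γ, ℝ)) (ω : Γ → ℝ) :
    dist (noisyShrink ha x ω) x ≤ 2 * a := by
  rw [dist_le_iff (by positivity)]
  intro γ
  have h₁ := abs_softThreshold_sub_self_le ha.le (x γ - truncate (a / 2) (ω γ))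
  have h₂ := abs_truncate_le (half_pos ha).le (ω γ)
  change |softThreshold a (x γ - truncate (a / 2) (ω γ)) - x γ| ≤ 2 * a
  grind

lemma noisyShrink_eq_finsetShrink {x : C₀(Γ, ℝ)} {H : Finset Γ}
    (hx : ∀ γ ∉ H, |x γ| ≤ a / 2) (ω : Γ → ℝ) :
    noisyShrink ha x ω =
      finsetShrink a H (fun i ↦ x i - truncate (a / 2) (H.restrict ω i)) := by
  ext γ
  by_cases hγ : γ ∈ H
  · lift γ to H using hγ
    rw [finsetShrink_apply_coe]
    rfl
  · rw [finsetShrink_apply_of_notMem a _ hγ]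
    refine softThreshold_of_abs_le ?_
    have h₁ := abs_truncate_le (half_pos ha).le (ω γ)
    have h₂ := hx γ hγ
    grind

lemma exists_finset_eventually_abs_le (x : C₀(Γ, ℝ)) (ha : 0 < a) :
    ∃ H : Finset Γ, ∀ᶠ y in 𝓝 x, ∀ γ ∉ H, |y γ| ≤ a := by
  refine ⟨(finite_setOf_le_abs x (half_pos ha)).toFinset, ?_⟩
  filter_upwards [Metric.ball_mem_nhds x (half_pos ha)] with y hy γ hγ
  have h := abs_apply_sub_apply_le_dist y x γ
  rw [Metric.mem_ball] at hy
  simp only [Finite.mem_toFinset, mem_ofPred_eq, not_le] at hγ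
  grind

end ZeroAtInftyContinuousMap

lemma MeasureTheory.Measure.pi_withDensity_ofReal {ι : Type*} [Fintype ι] {θ : ℝ → ℝ}
    (hθ : Integrable θ) (hθ₀ : 0 ≤ θ) :
    Measure.pi (fun _ : ι ↦ (volume : Measure ℝ).withDensity fun t ↦ ENNReal.ofReal (θ t)) =
      volume.withDensity fun z : ι → ℝ ↦ ENNReal.ofReal (∏ i, θ (z i)) := by
  have : IsFiniteMeasure ((volume : Measure ℝ).withDensity fun t ↦ ENNReal.ofReal (θ t)) :=
    isFiniteMeasure_withDensity_ofReal hθ.2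
  refine Measure.pi_eq fun s hs ↦ ?_
  have hint : Integrable (fun z : ι → ℝ ↦ ∏ i, θ (z i)) :=
    Integrable.fintype_prod (f := fun _ ↦ θ) fun _ ↦ hθ
  rw [withDensity_apply _ (MeasurableSet.univ_pi hs),
    ← ofReal_integral_eq_lintegral_ofReal hint.integrableOn
      (.of_forall fun z ↦ Finset.prod_nonneg fun i _ ↦ hθ₀ (z i)),
    volume_pi, Measure.restrict_pi_pi, integral_fintype_prod_eq_prod (fun _ : ι ↦ θ),
    ENNReal.ofReal_prod_of_nonneg fun i _ ↦ integral_nonneg hθ₀]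
  refine Finset.prod_congr rfl fun i _ ↦ ?_
  rw [withDensity_apply _ (hs i), ofReal_integral_eq_lintegral_ofReal hθ.integrableOn
    (.of_forall hθ₀)]

/-- The probability measure on `ℝ` whose density is the normalization of a bump function. -/
noncomputable def ContDiffBump.toMeasure (b : ContDiffBump (0 : ℝ)) : Measure ℝ :=
  volume.withDensity fun t ↦ ENNReal.ofReal (b.normed volume t)

instance ContDiffBump.isProbabilityMeasure_toMeasure (b : ContDiffBump (0 : ℝ)) :
    IsProbabilityMeasure b.toMeasure where
  measure_univ := by
    rw [toMeasure, withDensity_apply _ .univ, Measure.restrict_univ,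
      ← ofReal_integral_eq_lintegral_ofReal b.integrable_normed (.of_forall b.nonneg_normed),
      b.integral_normed, ENNReal.ofReal_one]

lemma ContDiffBump.contDiff_integral_pi_toMeasure {ι : Type*} [Fintype ι]
    (b : ContDiffBump (0 : ℝ)) {h : (ι → ℝ) → ℝ} (hh : Continuous h) :
    ContDiff ℝ (⊤ : ℕ∞) fun z : ι → ℝ ↦
      ∫ t, h (fun i ↦ z i - truncate b.rOut (t i)) ∂Measure.pi fun _ : ι ↦ b.toMeasure := by
  let Θ (t : ι → ℝ) : ℝ := ∏ i, b.normed volume (t i)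
  have hΘ₀ (t : ι → ℝ) : 0 ≤ Θ t := Finset.prod_nonneg fun i _ ↦ b.nonneg_normed (t i)
  have hsupp (t : ι → ℝ) (ht : Θ t ≠ 0) (i : ι) : |t i| ≤ b.rOut := by
    have hi : t i ∈ Function.support (b.normed volume) :=
      fun h0 ↦ ht (Finset.prod_eq_zero (Finset.mem_univ i) h0)
    rw [b.support_normed_eq] at hi
    simpa using (Metric.mem_ball.1 hi).le
  have hcs : HasCompactSupport Θ :=
    HasCompactSupport.intro (isCompact_closedBall 0 b.rOut) fun t ht ↦ by
      by_contra h0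
      exact ht (mem_closedBall_zero_iff.2
        ((pi_norm_le_iff_of_nonneg b.rOut_pos.le).2 (hsupp t h0)))
  have hsm : ContDiff ℝ (⊤ : ℕ∞) Θ :=
    contDiff_prod fun i _ ↦ b.contDiff_normed.comp (contDiff_apply ℝ ℝ i)
  have hconv := hcs.contDiff_convolution_left (μ := volume) (ContinuousLinearMap.lsmul ℝ ℝ) hsm
    hh.locallyIntegrable
  convert hconv using 2 with z
  unfold ContDiffBump.toMeasure
  rw [Measure.pi_withDensity_ofReal b.integrable_normed b.nonneg_normed,
    integral_withDensity_eq_integral_toReal_smul hsm.continuous.measurable.ennreal_ofReal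
      (.of_forall fun _ ↦ ENNReal.ofReal_lt_top)]
  refine integral_congr_ae (.of_forall fun t ↦ ?_)
  simp only [ContinuousLinearMap.lsmul_apply]
  rw [ENNReal.toReal_ofReal (hΘ₀ t)]
  by_cases ht : Θ t = 0
  · simp [ht]
  · congr 2
    ext i
    rw [truncate_of_abs_le (hsupp t ht i)]
    rfl

namespace ZeroAtInftyContinuousMap

variable {Γ : Type*} [TopologicalSpace Γ] [DiscreteTopology Γ]

/-- The average of `f` over random perturbations of the coordinatewise shrinking of its argument. -/
noncomputable def shrinkAverage {a : ℝ} (ha : 0 < a) (b : ContDiffBump (0 : ℝ))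
    (f : C₀(Γ, ℝ) → ℝ) (x : C₀(Γ, ℝ)) : ℝ :=
  ∫ ω, f (noisyShrink ha x ω) ∂Measure.infinitePi fun _ : Γ ↦ b.toMeasure

variable {a : ℝ} (ha : 0 < a) {f : C₀(Γ, ℝ) → ℝ} (b : ContDiffBump (0 : ℝ))

lemma contDiff_shrinkAverage (hf : Continuous f) (hb : b.rOut = a / 2) :
    ContDiff ℝ (⊤ : ℕ∞) (shrinkAverage ha b f) := by
  rw [contDiff_iff_contDiffAt]
  intro x
  obtain ⟨H, hH⟩ := exists_finset_eventually_abs_le x (half_pos ha)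
  have hcont : Continuous (f ∘ finsetShrink a H) := hf.comp (continuous_finsetShrink ha.le H)
  have hsmooth := (b.contDiff_integral_pi_toMeasure hcont).comp
    (contDiff_pi' fun i : H ↦ (evalL (i : Γ)).contDiff)
  refine hsmooth.contDiffAt.congr_of_eventuallyEq ?_
  filter_upwards [hH] with y hy
  simp only [shrinkAverage, noisyShrink_eq_finsetShrink ha hy]
  rw [hb]
  refine integral_restrict_infinitePi (μ := fun _ : Γ ↦ b.toMeasure) (s := H)
    (f := fun t ↦ f (finsetShrink a H fun i ↦ y i - truncate (a / 2) (t i))) ?_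
  have := continuous_truncate (a / 2)
  exact (hcont.comp (g := f ∘ finsetShrink a H)
    (f := fun (t : H → ℝ) (i : H) ↦ y i - truncate (a / 2) (t i)) (by fun_prop)).aestronglyMeasurable

lemma integrable_comp_noisyShrink {K : ℝ} (hf : IsLipschitzWithOn K f univ) (hK : 0 ≤ K)
    (hfc : Continuous f) (x : C₀(Γ, ℝ)) :
    Integrable (fun ω ↦ f (noisyShrink ha x ω)) (Measure.infinitePi fun _ : Γ ↦ b.toMeasure) := by
  obtain ⟨H, hH⟩ := exists_finset_eventually_abs_le x (half_pos ha)
  refine Integrable.of_bound (C := |f x| + K * (2 * a)) ?_ (.of_forall fun ω ↦ ?_)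
  · simp only [noisyShrink_eq_finsetShrink ha hH.self_of_nhds]
    have hcont := hfc.comp (continuous_finsetShrink ha.le H)
    have := continuous_truncate (a / 2)
    exact ((hcont.comp (f := fun (t : H → ℝ) (i : H) ↦ x i - truncate (a / 2) (t i))
      (by fun_prop)).measurable.comp (Finset.measurable_restrict H)).aestronglyMeasurable
  · have h₁ := hf _ (mem_univ (noisyShrink ha x ω)) x (mem_univ x)
    have h₂ := mul_le_mul_of_nonneg_left (dist_noisyShrink_self_le ha x ω) hK
    rw [Real.norm_eq_abs]
    grind

end ZeroAtInftyContinuousMap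

open ZeroAtInftyContinuousMap

lemma IsLipschitzWithOn.mono {X : Type*} [PseudoMetricSpace X] {K L : ℝ} {f : X → ℝ} {s : Set X}
    (hf : IsLipschitzWithOn K f s) (h : K ≤ L) : IsLipschitzWithOn L f s := fun x hx y hy ↦
  (hf x hx y hy).trans (mul_le_mul_of_nonneg_right h dist_nonneg)

lemma IsLipschitzWithOn.continuous {X : Type*} [PseudoMetricSpace X] {K : ℝ} {f : X → ℝ}
    (hf : IsLipschitzWithOn K f univ) : Continuous f :=
  (LipschitzWith.of_dist_le' fun x y ↦ hf x (mem_univ x) y (mem_univ y)).continuous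

/-- Lemma (the space `c₀(Γ)`, realized as zero-at-infinity maps `C₀(Γ, ℝ)` on the discrete
space `Γ` with the sup norm): uniform approximation of a Lipschitz function by `C^∞`
functions preserving local Lipschitz constants on balls, up to enlarging the ball by `ε`. -/
theorem stmt_15 (Γ : Type*) [TopologicalSpace Γ] [DiscreteTopology Γ]
    (f : C₀(Γ, ℝ) → ℝ) (hf : ∃ K : ℝ, IsLipschitzWithOn K f Set.univ)
    (ε : ℝ) (hε : 0 < ε) :
    ∃ g : C₀(Γ, ℝ) → ℝ,
      ContDiff ℝ (⊤ : ℕ∞) g ∧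
      (∀ x, |f x - g x| ≤ ε) ∧
      (∀ (x₀ : C₀(Γ, ℝ)) (r : ℝ), 0 < r →
        lipOn g (closedBall x₀ r) ≤ lipOn f (closedBall x₀ (r + ε))) := by
  obtain ⟨K, hK, hfK⟩ : ∃ K : ℝ, 1 ≤ K ∧ IsLipschitzWithOn K f univ := by
    obtain ⟨K, hfK⟩ := hf
    exact ⟨max K 1, le_max_right _ _, hfK.mono (le_max_left _ _)⟩
  have hK₀ : 0 < K := one_pos.trans_le hK
  obtain ⟨a, ha, haK⟩ : ∃ a : ℝ, 0 < a ∧ K * (2 * a) = ε :=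
    ⟨ε / (2 * K), by positivity, by field_simp⟩
  have haε : 2 * a ≤ ε := by nlinarith
  let b : ContDiffBump (0 : ℝ) := ⟨a / 4, a / 2, by positivity, by linarith⟩
  have hint := integrable_comp_noisyShrink ha b hfK hK₀.le hfK.continuous
  refine ⟨shrinkAverage ha b f, contDiff_shrinkAverage ha b hfK.continuous rfl,
    fun x ↦ ?_, fun x₀ r _ ↦ ?_⟩
  · have hsub : f x - shrinkAverage ha b f x =
        ∫ ω, (f x - f (noisyShrink ha x ω)) ∂Measure.infinitePi fun _ : Γ ↦ b.toMeasure := by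
      rw [integral_sub (integrable_const _) (hint x)]
      simp [shrinkAverage]
    rw [hsub, ← Real.norm_eq_abs]
    refine (norm_integral_le_of_norm_le_const (C := ε) (.of_forall fun ω ↦ ?_)).trans (by simp)
    rw [← haK]
    refine (hfK x (mem_univ x) _ (mem_univ _)).trans (mul_le_mul_of_nonneg_left ?_ hK₀.le)
    rw [dist_comm]
    exact dist_noisyShrink_self_le ha x ω
  · refine csInf_le_csInf ⟨0, fun L hL ↦ hL.1.le⟩
      ⟨K, hK₀, fun x _ y _ ↦ hfK x (mem_univ x) y (mem_univ y)⟩ ?_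
    rintro L ⟨hL, hfL⟩
    refine ⟨hL, fun x hx y hy ↦ ?_⟩
    have hmem {z : C₀(Γ, ℝ)} (hz : z ∈ closedBall x₀ r) (ω : Γ → ℝ) :
        noisyShrink ha z ω ∈ closedBall x₀ (r + ε) := by
      rw [mem_closedBall] at hz ⊢
      linarith [dist_triangle (noisyShrink ha z ω) z x₀, dist_noisyShrink_self_le ha z ω]
    rw [shrinkAverage, shrinkAverage, ← integral_sub (hint x) (hint y), ← Real.norm_eq_abs]
    refine (norm_integral_le_of_norm_le_const (C := L * dist x y)
      (.of_forall fun ω ↦ ?_)).trans (by simp)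
    exact (hfL _ (hmem hx ω) _ (hmem hy ω)).trans
      (mul_le_mul_of_nonneg_left (dist_noisyShrink_le ha x y ω) hL.le)
end
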